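/- Under Conditions (C1)–(C6), for every integer m ≥ 1 and every choice of 0 < u_1 < u_2 < … < u_m < 1, the joint random vector (Z_w^π(⌊n·u_1⌋), …, Z_w^π(⌊n·u_m⌋), Z_diff^π(⌊n·u_1⌋), …, Z_diff^π(⌊n·u_m⌋)) under the permutation null distribution converges in distribution, as n → ∞, to a centered 2m-dimensional Gaussian random vector whose covariance matrix is block diagonal, equal to ρ_w*(u_i,u_j) on the first m×m block, equal to ρ_diff*(u_i,u_j) on the last m×m block, and with all cross-covariances between the Z_w-coordinates and the Z_diff-coordinates equal to zero; in particular the limiting Z_w-process and Z_diff-process are independent. -/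

import Mathlib

open Finset Filter Asymptotics MeasureTheory ProbabilityTheory Topology

namespace RING

/-- `U1^π(t1,t2)`: sum of `R (π i) (π j)` over indices (1-based `i,j ∈ {1,…,n}`,
represented by `Fin n` with `i` standing for index `i+1`) with `t1 < i ≤ t2` and
`t1 < j ≤ t2`. -/
noncomputable def U1 (n : ℕ) (R : Fin n → Fin n → ℝ) (π : Equiv.Perm (Fin n))
    (t1 t2 : ℕ) : ℝ :=
  ∑ i : Fin n, ∑ j : Fin n,
    if t1 ≤ (i : ℕ) ∧ (i : ℕ) < t2 ∧ t1 ≤ (j : ℕ) ∧ (j : ℕ) < t2 then R (π i) (π j) else 0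

/-- `U2^π(t1,t2)`: sum of `R (π i) (π j)` over indices with `i ≤ t1` or `i > t2`,
and `j ≤ t1` or `j > t2`. -/
noncomputable def U2 (n : ℕ) (R : Fin n → Fin n → ℝ) (π : Equiv.Perm (Fin n))
    (t1 t2 : ℕ) : ℝ :=
  ∑ i : Fin n, ∑ j : Fin n,
    if ((i : ℕ) < t1 ∨ t2 ≤ (i : ℕ)) ∧ ((j : ℕ) < t1 ∨ t2 ≤ (j : ℕ)) then R (π i) (π j) else 0

/-- Expectation under the permutation null distribution (uniform over all `n!`
permutations). -/
noncomputable def pexp (n : ℕ) (f : Equiv.Perm (Fin n) → ℝ) : ℝ :=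
  (∑ π : Equiv.Perm (Fin n), f π) / (Nat.factorial n)

/-- Variance under the permutation null distribution. -/
noncomputable def pvar (n : ℕ) (f : Equiv.Perm (Fin n) → ℝ) : ℝ :=
  pexp n (fun π => (f π - pexp n f) ^ 2)

/-- Covariance under the permutation null distribution. -/
noncomputable def pcov (n : ℕ) (f g : Equiv.Perm (Fin n) → ℝ) : ℝ :=
  pexp n (fun π => (f π - pexp n f) * (g π - pexp n g))

/-- `R̄_{i·} = (Σ_j R_{ij})/(n-1)`. -/
noncomputable def Rbar (n : ℕ) (R : Fin n → Fin n → ℝ) (i : Fin n) : ℝ :=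
  (∑ j : Fin n, R i j) / ((n : ℝ) - 1)

/-- `r0 = (1/n) Σ_i R̄_{i·}`. -/
noncomputable def r0 (n : ℕ) (R : Fin n → Fin n → ℝ) : ℝ :=
  (∑ i : Fin n, Rbar n R i) / n

/-- `r1² = (1/n) Σ_i R̄_{i·}²`. -/
noncomputable def r1sq (n : ℕ) (R : Fin n → Fin n → ℝ) : ℝ :=
  (∑ i : Fin n, (Rbar n R i) ^ 2) / n

/-- `r_d² = (1/(n(n-1))) Σ_i Σ_j R_{ij}²`. -/
noncomputable def rdsq (n : ℕ) (R : Fin n → Fin n → ℝ) : ℝ :=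
  (∑ i : Fin n, ∑ j : Fin n, (R i j) ^ 2) / ((n : ℝ) * ((n : ℝ) - 1))

/-- `U_diff^π = U1^π − U2^π`. -/
noncomputable def Udiff (n : ℕ) (R : Fin n → Fin n → ℝ) (π : Equiv.Perm (Fin n))
    (t1 t2 : ℕ) : ℝ :=
  U1 n R π t1 t2 - U2 n R π t1 t2

/-- `U_w^π = ((n−t2+t1−1)·U1^π + (t2−t1−1)·U2^π)/(n−2)`. -/
noncomputable def Uw (n : ℕ) (R : Fin n → Fin n → ℝ) (π : Equiv.Perm (Fin n))
    (t1 t2 : ℕ) : ℝ :=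
  (((n : ℝ) - t2 + t1 - 1) * U1 n R π t1 t2 + ((t2 : ℝ) - t1 - 1) * U2 n R π t1 t2) /
    ((n : ℝ) - 2)

/-- Standardized `Z_w^π(t1,t2)`. -/
noncomputable def Zw (n : ℕ) (R : Fin n → Fin n → ℝ) (π : Equiv.Perm (Fin n))
    (t1 t2 : ℕ) : ℝ :=
  (Uw n R π t1 t2 - pexp n (fun σ => Uw n R σ t1 t2)) /
    Real.sqrt (pvar n (fun σ => Uw n R σ t1 t2))

/-- Standardized `Z_diff^π(t1,t2)`. -/
noncomputable def Zdiff (n : ℕ) (R : Fin n → Fin n → ℝ) (π : Equiv.Perm (Fin n))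
    (t1 t2 : ℕ) : ℝ :=
  (Udiff n R π t1 t2 - pexp n (fun σ => Udiff n R σ t1 t2)) /
    Real.sqrt (pvar n (fun σ => Udiff n R σ t1 t2))

/-- Discrete σ-algebra on the finite permutation group. -/
instance (n : ℕ) : MeasurableSpace (Equiv.Perm (Fin n)) := ⊤

/-- The permutation null distribution: the uniform probability measure on the
`n!` permutations of `{1,…,n}`. -/
noncomputable def permP (n : ℕ) : ProbabilityMeasure (Equiv.Perm (Fin n)) :=
  ⟨(PMF.uniformOfFintype (Equiv.Perm (Fin n))).toMeasure,
    PMF.toMeasure.isProbabilityMeasure _⟩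

/-- The distribution of a real-valued statistic under the permutation null
distribution. -/
noncomputable def permDist (n : ℕ) (f : Equiv.Perm (Fin n) → ℝ) : ProbabilityMeasure ℝ :=
  (permP n).map (f := f) (Measurable.aemeasurable (fun _ _ => trivial))

/-- The centered Gaussian distribution on `ℝ` with variance `v` (for `v ≥ 0`). -/
noncomputable def gaussLimit (v : ℝ) : ProbabilityMeasure ℝ :=
  ⟨gaussianReal 0 (Real.toNNReal v), inferInstance⟩

/-- `ρ_w*(u,v) = (u∧v)(1−(u∨v))/((u∨v)(1−(u∧v)))`. -/
noncomputable def rhoW (u v : ℝ) : ℝ :=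
  (min u v * (1 - max u v)) / (max u v * (1 - min u v))

/-- `ρ_diff*(u,v) = (u∧v)(1−(u∨v))/√((u∧v)(1−(u∧v))·(u∨v)(1−(u∨v)))`. -/
noncomputable def rhoDiff (u v : ℝ) : ℝ :=
  (min u v * (1 - max u v)) /
    Real.sqrt (min u v * (1 - min u v) * (max u v * (1 - max u v)))

/-- Condition (C1): `Σ_i (Σ_j R_{ij}²)² = O(n³ r_d⁴)`. -/
def Cond1 (R : (n : ℕ) → Fin n → Fin n → ℝ) : Prop :=
  (fun n => ∑ i : Fin n, (∑ j : Fin n, (R n i j) ^ 2) ^ 2)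
    =O[atTop] fun n => (n : ℝ) ^ 3 * (rdsq n (R n)) ^ 2

/-- Condition (C2): `Σ_i |R̄_{i·} − r0|³ = o((n(r1² − r0²))^{3/2})`. -/
def Cond2 (R : (n : ℕ) → Fin n → Fin n → ℝ) : Prop :=
  (fun n => ∑ i : Fin n, |Rbar n (R n) i - r0 n (R n)| ^ 3)
    =o[atTop] fun n => ((n : ℝ) * (r1sq n (R n) - (r0 n (R n)) ^ 2)) ^ ((3 : ℝ) / 2)

/-- Condition (C3): `Σ_i (R̄_{i·} − r0)³ = o(n·r_d·(r1² − r0²))`. -/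
def Cond3 (R : (n : ℕ) → Fin n → Fin n → ℝ) : Prop :=
  (fun n => ∑ i : Fin n, (Rbar n (R n) i - r0 n (R n)) ^ 3)
    =o[atTop] fun n =>
      (n : ℝ) * Real.sqrt (rdsq n (R n)) * (r1sq n (R n) - (r0 n (R n)) ^ 2)

/-- Condition (C4): `|Σ_{i≠j≠k} R_{ji} R_{ik} (R̄_{j·} − r0)(R̄_{k·} − r0)| =
o(n³ r_d² (r1² − r0²))`. -/
def Cond4 (R : (n : ℕ) → Fin n → Fin n → ℝ) : Prop :=
  (fun n =>
      |∑ i : Fin n, ∑ j : Fin n, ∑ k : Fin n,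
        if i ≠ j ∧ i ≠ k ∧ j ≠ k then
          R n j i * R n i k * (Rbar n (R n) j - r0 n (R n)) * (Rbar n (R n) k - r0 n (R n))
        else 0|)
    =o[atTop] fun n => (n : ℝ) ^ 3 * rdsq n (R n) * (r1sq n (R n) - (r0 n (R n)) ^ 2)

/-- Condition (C5): `Σ_i Σ_j Σ_{k∉{i,j}} Σ_{l∉{i,j}} R_{ij} R_{kl}
(R_{ik} R_{jl} + R_{il} R_{jk}) = o(n⁴ r_d⁴)`. -/
def Cond5 (R : (n : ℕ) → Fin n → Fin n → ℝ) : Prop :=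
  (fun n =>
      ∑ i : Fin n, ∑ j : Fin n, ∑ k : Fin n, ∑ l : Fin n,
        if k ≠ i ∧ k ≠ j ∧ l ≠ i ∧ l ≠ j then
          R n i j * R n k l * (R n i k * R n j l + R n i l * R n j k)
        else 0)
    =o[atTop] fun n => (n : ℝ) ^ 4 * (rdsq n (R n)) ^ 2

/-- Condition (C6): `r1 = o(r_d)`. -/
def Cond6 (R : (n : ℕ) → Fin n → Fin n → ℝ) : Prop :=
  (fun n => Real.sqrt (r1sq n (R n))) =o[atTop] fun n => Real.sqrt (rdsq n (R n))

end RING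

open RING

namespace RING

section ProductExpectation

variable {ι κ : Type*} [Fintype ι] [DecidableEq ι] [Fintype κ]

/-- Expectation of `f` when the coordinates of `c : ι → κ` are independent with weights `p`. -/
noncomputable def prodExp {F : Type*} [AddCommGroup F] [Module ℝ F] (p : κ → ℝ)
    (f : (ι → κ) → F) : F :=
  ∑ c : ι → κ, (∏ i, p (c i)) • f c

section Module

variable {F : Type*} [AddCommGroup F] [Module ℝ F] (p : κ → ℝ)

lemma prodExp_add (f g : (ι → κ) → F) :
    prodExp p (fun c => f c + g c) = prodExp p f + prodExp p g := by
  simp [prodExp, smul_add, Finset.sum_add_distrib]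

lemma prodExp_sub (f g : (ι → κ) → F) :
    prodExp p (fun c => f c - g c) = prodExp p f - prodExp p g := by
  simp [prodExp, smul_sub, Finset.sum_sub_distrib]

lemma prodExp_sum {σ : Type*} (s : Finset σ) (f : σ → (ι → κ) → F) :
    prodExp p (fun c => ∑ a ∈ s, f a c) = ∑ a ∈ s, prodExp p (f a) := by
  simp only [prodExp, Finset.smul_sum]
  exact Finset.sum_comm

lemma prodExp_smul (a : ℝ) (f : (ι → κ) → F) :
    prodExp p (fun c => a • f c) = a • prodExp p f := by
  simp only [prodExp, Finset.smul_sum]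
  exact Finset.sum_congr rfl fun c _ => smul_comm _ _ _

lemma prodExp_comp_perm (τ : Equiv.Perm ι) (f : (ι → κ) → F) :
    prodExp p (fun c => f (c ∘ τ)) = prodExp p f := by
  unfold prodExp
  refine Fintype.sum_equiv (Equiv.arrowCongr τ.symm (Equiv.refl κ)) _ _ fun c => ?_
  have h : (Equiv.arrowCongr τ.symm (Equiv.refl κ)) c = c ∘ τ := by ext i; simp
  rw [h]
  congr 1
  exact (Equiv.prod_comp τ fun i => p (c i)).symm

/-- Resampling one coordinate does not change the expectation. -/
lemma prodExp_update (hp1 : ∑ k, p k = 1) (i : ι) (f : (ι → κ) → F) :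
    prodExp p (fun c => ∑ k, p k • f (Function.update c i k)) = prodExp p f := by
  have key : ∀ x : (ι → κ) × κ, (∏ j, p (x.1 j)) * p x.2 =
      (∏ j, p (Function.update x.1 i x.2 j)) * p (x.1 i) := by
    intro x
    have h1 : (fun j => p (Function.update x.1 i x.2 j)) =
        Function.update (fun j => p (x.1 j)) i (p x.2) := by
      ext j; by_cases h : j = i
      · subst h; simp
      · simp [h]
    rw [h1, Finset.prod_update_of_mem (Finset.mem_univ i),
      ← Finset.mul_prod_erase Finset.univ _ (Finset.mem_univ i), Finset.sdiff_singleton_eq_erase]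
    ring
  have hinv : Function.Involutive
      (fun x : (ι → κ) × κ => (Function.update x.1 i x.2, x.1 i)) := by
    intro x; simp
  have h2 : ∑ x : (ι → κ) × κ, ((∏ j, p (x.1 j)) * p x.2) • f (Function.update x.1 i x.2) =
      ∑ x : (ι → κ) × κ, ((∏ j, p (x.1 j)) * p x.2) • f x.1 := by
    refine Fintype.sum_equiv hinv.toPerm _ _ fun x => ?_
    rw [key]; rfl
  rw [Fintype.sum_prod_type, Fintype.sum_prod_type] at h2
  simp only [prodExp, Finset.smul_sum, smul_smul]
  rw [h2]
  refine Finset.sum_congr rfl fun c _ => ?_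
  dsimp only
  rw [← Finset.sum_smul, ← Finset.mul_sum, hp1, mul_one]

lemma prodExp_eq_zero (hp1 : ∑ k, p k = 1) (i : ι) (f : (ι → κ) → F)
    (h : ∀ c, ∑ k, p k • f (Function.update c i k) = 0) : prodExp p f = 0 := by
  rw [← prodExp_update p hp1 i f]
  simp [prodExp, h]

lemma prodExp_const (hp1 : ∑ k, p k = 1) (a : F) :
    prodExp p (fun _ : ι → κ => a) = a := by
  have : ∑ c : ι → κ, ∏ i, p (c i) = 1 := by
    have h := Finset.prod_univ_sum (fun _ : ι => (Finset.univ : Finset κ)) (fun _ k => p k)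
    rw [Fintype.piFinset_univ] at h
    rw [← h]; simp [hp1]
  rw [prodExp, ← Finset.sum_smul, this, one_smul]

/-- A coordinate can be averaged separately when the rest does not depend on it. -/
lemma prodExp_apply_coord (hp1 : ∑ k, p k = 1) (i : ι) (f : κ → (ι → κ) → F)
    (hf : ∀ k l c, f k (Function.update c i l) = f k c) :
    prodExp p (fun c => f (c i) c) = ∑ k, p k • prodExp p (f k) := by
  rw [← prodExp_update p hp1 i]
  simp only [Function.update_self, hf]
  rw [prodExp_sum]
  simp only [prodExp_smul]

end Module

variable {p : κ → ℝ}

lemma norm_prodExp_le {F : Type*} [NormedAddCommGroup F] [NormedSpace ℝ F] (hp0 : ∀ k, 0 ≤ p k)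
    (f : (ι → κ) → F) : ‖prodExp p f‖ ≤ prodExp p (fun c => ‖f c‖) := by
  unfold prodExp
  refine (norm_sum_le _ _).trans (Finset.sum_le_sum fun c _ => ?_)
  rw [norm_smul, Real.norm_of_nonneg (Finset.prod_nonneg fun _ _ => hp0 _), smul_eq_mul]

lemma prodExp_mono (hp0 : ∀ k, 0 ≤ p k) {f g : (ι → κ) → ℝ} (h : ∀ c, f c ≤ g c) :
    prodExp p f ≤ prodExp p g :=
  Finset.sum_le_sum fun c _ =>
    mul_le_mul_of_nonneg_left (h c) (Finset.prod_nonneg fun _ _ => hp0 _)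

lemma prodExp_nonneg (hp0 : ∀ k, 0 ≤ p k) {f : (ι → κ) → ℝ} (h : ∀ c, 0 ≤ f c) :
    0 ≤ prodExp p f :=
  Finset.sum_nonneg fun c _ => mul_nonneg (Finset.prod_nonneg fun _ _ => hp0 _) (h c)

lemma prodExp_mul_left (a : ℝ) (f : (ι → κ) → ℝ) :
    prodExp p (fun c => a * f c) = a * prodExp p f := prodExp_smul p a f

lemma sq_prodExp_le (hp0 : ∀ k, 0 ≤ p k) (hp1 : ∑ k, p k = 1) (f : (ι → κ) → ℝ) :
    prodExp p f ^ 2 ≤ prodExp p (fun c => f c ^ 2) := by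
  have h := prodExp_nonneg (p := p) hp0 (f := fun c => (f c - prodExp p f) ^ 2)
    (fun c => sq_nonneg _)
  have h2 : ∀ c, (f c - prodExp p f) ^ 2 =
      f c ^ 2 - 2 * prodExp p f * f c + prodExp p f ^ 2 := fun c => by ring
  simp only [h2] at h
  rw [prodExp_add, prodExp_sub, prodExp_mul_left, prodExp_const p hp1] at h
  nlinarith

lemma prodExp_abs_le (hp0 : ∀ k, 0 ≤ p k) (hp1 : ∑ k, p k = 1) (f : (ι → κ) → ℝ) {a : ℝ}
    (ha : 0 ≤ a) (h : prodExp p (fun c => f c ^ 2) ≤ a ^ 2) :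
    prodExp p (fun c => |f c|) ≤ a := by
  have h1 := sq_prodExp_le hp0 hp1 (fun c => |f c|)
  simp only [sq_abs] at h1
  exact abs_le_of_sq_le_sq' (h1.trans h) ha |>.2

end ProductExpectation

section Moments

variable {ι κ : Type*} [Fintype ι] [DecidableEq ι] {B : ι → ι → ℝ} {g : κ → κ → ℝ}

/-- Removing the index `i` from a symmetric quadratic form without diagonal. -/
lemma quadForm_eq_add_remove (hB : ∀ i j, B i j = B j i) (hB0 : ∀ i, B i i = 0)
    (hg : ∀ k l, g k l = g l k) (i : ι) (c : ι → κ) :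
    ∑ j, ∑ k, B j k * g (c j) (c k) = 2 * ∑ j, B i j * g (c i) (c j) +
      ∑ j ∈ Finset.univ.erase i, ∑ k ∈ Finset.univ.erase i, B j k * g (c j) (c k) := by
  rw [← Finset.add_sum_erase _ _ (Finset.mem_univ i)]
  have h : ∀ j ∈ Finset.univ.erase i, ∑ k, B j k * g (c j) (c k) =
      B i j * g (c i) (c j) + ∑ k ∈ Finset.univ.erase i, B j k * g (c j) (c k) := by
    intro j _
    rw [← Finset.add_sum_erase _ _ (Finset.mem_univ i), hB j i, hg (c j)]
  rw [Finset.sum_congr rfl h, Finset.sum_add_distrib,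
    ← Finset.add_sum_erase Finset.univ (fun j => B i j * g (c i) (c j)) (Finset.mem_univ i), hB0]
  ring

lemma rowForm_update (hB0 : ∀ i, B i i = 0) (i : ι) (c : ι → κ) (k : κ) :
    ∑ j, B i j * g (Function.update c i k i) (Function.update c i k j) =
      ∑ j, B i j * g k (c j) := by
  refine Finset.sum_congr rfl fun j _ => ?_
  by_cases h : j = i
  · subst h; simp [hB0]
  · simp [h]

lemma removeForm_update (i : ι) (c : ι → κ) (k : κ) :
    ∑ j ∈ Finset.univ.erase i, ∑ l ∈ Finset.univ.erase i,
        B j l * g (Function.update c i k j) (Function.update c i k l) =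
      ∑ j ∈ Finset.univ.erase i, ∑ l ∈ Finset.univ.erase i, B j l * g (c j) (c l) :=
  Finset.sum_congr rfl fun j hj => Finset.sum_congr rfl fun l hl => by
    rw [Function.update_of_ne (Finset.ne_of_mem_erase hj),
      Function.update_of_ne (Finset.ne_of_mem_erase hl)]

variable [Fintype κ] {p : κ → ℝ}

/-- Second and fourth moment bounds for sums of independent centered bounded variables. -/
lemma prodExp_sum_moments (hp0 : ∀ k, 0 ≤ p k) (hp1 : ∑ k, p k = 1) (y : ι → κ → ℝ) (M : ι → ℝ)
    (hy : ∀ j, ∑ k, p k * y j k = 0) (hM : ∀ j k, y j k ^ 2 ≤ M j) (s : Finset ι) :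
    prodExp p (fun c : ι → κ => (∑ j ∈ s, y j (c j)) ^ 2) ≤ ∑ j ∈ s, M j ∧
    prodExp p (fun c : ι → κ => (∑ j ∈ s, y j (c j)) ^ 4) ≤ 4 * (∑ j ∈ s, M j) ^ 2 := by
  have hM0 : ∀ c : ι → κ, ∀ j, 0 ≤ M j := fun c j => (sq_nonneg _).trans (hM j (c j))
  induction s using Finset.induction_on with
  | empty => simp [prodExp_const p hp1]
  | insert a s ha ih =>
    obtain ⟨ih2, ih4⟩ := ih
    have hind : ∀ (c : ι → κ) k, ∑ j ∈ s, y j (Function.update c a k j) = ∑ j ∈ s, y j (c j) := by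
      intro c k
      refine Finset.sum_congr rfl fun j hj => ?_
      rw [Function.update_of_ne]
      rintro rfl
      exact ha hj
    have hcross : ∀ r : ℕ, prodExp p (fun c : ι → κ => (∑ j ∈ s, y j (c j)) ^ r * y a (c a)) = 0 := by
      intro r
      refine prodExp_eq_zero p hp1 a _ fun c => ?_
      simp only [hind, Function.update_self, smul_eq_mul]
      have := hy a
      calc ∑ k, p k * ((∑ j ∈ s, y j (c j)) ^ r * y a k)
          = (∑ j ∈ s, y j (c j)) ^ r * ∑ k, p k * y a k := by
            rw [Finset.mul_sum]; exact Finset.sum_congr rfl fun k _ => by ring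
        _ = 0 := by rw [this, mul_zero]
    simp only [Finset.sum_insert ha]
    set A := ∑ j ∈ s, M j with hA
    rcases isEmpty_or_nonempty (ι → κ) with hE | ⟨⟨c0⟩⟩
    · have := prodExp_const (ι := ι) p hp1 (1 : ℝ)
      simp [prodExp] at this
    have hA0 : 0 ≤ A := Finset.sum_nonneg fun j _ => hM0 c0 j
    have hMa : 0 ≤ M a := hM0 c0 a
    constructor
    · calc prodExp p (fun c : ι → κ => (y a (c a) + ∑ j ∈ s, y j (c j)) ^ 2)
          ≤ prodExp p (fun c : ι → κ => M a + (∑ j ∈ s, y j (c j)) ^ 2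
              + 2 * ((∑ j ∈ s, y j (c j)) ^ 1 * y a (c a))) :=
            prodExp_mono hp0 fun c => by nlinarith [hM a (c a)]
        _ = M a + prodExp p (fun c : ι → κ => (∑ j ∈ s, y j (c j)) ^ 2) := by
            rw [prodExp_add, prodExp_add, prodExp_mul_left, hcross, prodExp_const p hp1]; ring
        _ ≤ M a + A := by linarith
    · calc prodExp p (fun c : ι → κ => (y a (c a) + ∑ j ∈ s, y j (c j)) ^ 4)
          ≤ prodExp p (fun c : ι → κ => 3 * M a ^ 2 + 8 * M a * (∑ j ∈ s, y j (c j)) ^ 2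
              + (∑ j ∈ s, y j (c j)) ^ 4 + 4 * ((∑ j ∈ s, y j (c j)) ^ 3 * y a (c a))) :=
            prodExp_mono hp0 fun c => by
              set S := ∑ j ∈ s, y j (c j)
              set Y := y a (c a)
              have h := hM a (c a)
              have h1 : Y ^ 2 * S ^ 2 ≤ M a * S ^ 2 := mul_le_mul_of_nonneg_right h (sq_nonneg _)
              have h2 : Y ^ 2 * Y ^ 2 ≤ M a * M a := mul_le_mul h h (sq_nonneg _) hMa
              nlinarith [sq_nonneg (Y * (S - Y))]
        _ = 3 * M a ^ 2 + 8 * M a * prodExp p (fun c : ι → κ => (∑ j ∈ s, y j (c j)) ^ 2)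
              + prodExp p (fun c : ι → κ => (∑ j ∈ s, y j (c j)) ^ 4) := by
            rw [prodExp_add, prodExp_add, prodExp_add, prodExp_mul_left (8 * M a),
              prodExp_mul_left 4, hcross, prodExp_const p hp1]; ring
        _ ≤ 4 * (M a + A) ^ 2 := by
            have := mul_le_mul_of_nonneg_left ih2 hMa
            nlinarith [sq_nonneg (M a)]

/-- Variance of a sum of independent centered variables. -/
lemma prodExp_sum_sq (hp1 : ∑ k, p k = 1) (y : ι → κ → ℝ)
    (hy : ∀ j, ∑ k, p k * y j k = 0) :
    prodExp p (fun c : ι → κ => (∑ j, y j (c j)) ^ 2) = ∑ j, ∑ k, p k * y j k ^ 2 := by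
  have h1 : ∀ c : ι → κ, (∑ j, y j (c j)) ^ 2 = ∑ j, y j (c j) * ∑ l, y l (c l) := by
    intro c; rw [sq, Finset.sum_mul]
  simp only [h1]
  rw [prodExp_sum]
  refine Finset.sum_congr rfl fun j _ => ?_
  have h2 : ∀ c : ι → κ, y j (c j) * ∑ l, y l (c l) =
      y j (c j) ^ 2 + y j (c j) * ∑ l ∈ Finset.univ.erase j, y l (c l) := by
    intro c; rw [← Finset.add_sum_erase _ _ (Finset.mem_univ j)]; ring
  simp only [h2]
  rw [prodExp_add, prodExp_apply_coord p hp1 j (fun k _ => y j k ^ 2) (fun _ _ _ => rfl),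
    prodExp_eq_zero p hp1 j (fun c => y j (c j) * ∑ l ∈ Finset.univ.erase j, y l (c l)), add_zero]
  · simp only [prodExp_const p hp1, smul_eq_mul]
  · intro c
    have : ∀ k, ∑ l ∈ Finset.univ.erase j, y l (Function.update c j k l)
        = ∑ l ∈ Finset.univ.erase j, y l (c l) := fun k =>
      Finset.sum_congr rfl fun l hl => by
        rw [Function.update_of_ne (Finset.ne_of_mem_erase hl)]
    simp only [this, Function.update_self, smul_eq_mul, ← mul_assoc]
    rw [← Finset.sum_mul, hy, zero_mul]

lemma rowForm_mean (hB0 : ∀ i, B i i = 0) (hg0 : ∀ l, ∑ k, p k * g k l = 0) (i : ι) (c : ι → κ) :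
    ∑ k, p k * ∑ j, B i j * g (Function.update c i k i) (Function.update c i k j) = 0 := by
  simp only [rowForm_update hB0, Finset.mul_sum]
  rw [Finset.sum_comm]
  refine Finset.sum_eq_zero fun j _ => ?_
  calc ∑ k, p k * (B i j * g k (c j)) = B i j * ∑ k, p k * g k (c j) := by
        rw [Finset.mul_sum]; exact Finset.sum_congr rfl fun k _ => by ring
    _ = 0 := by rw [hg0, mul_zero]

lemma prodExp_rowForm_sq (hp1 : ∑ k, p k = 1) (hB0 : ∀ i, B i i = 0)
    (hg : ∀ k l, g k l = g l k) (hg0 : ∀ l, ∑ k, p k * g k l = 0) (i : ι) :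
    prodExp p (fun c : ι → κ => (∑ j, B i j * g (c i) (c j)) ^ 2) =
      (∑ j, B i j ^ 2) * ∑ k, p k * ∑ l, p l * g k l ^ 2 := by
  have hupd : ∀ k l (c : ι → κ), (∑ j, B i j * g k (Function.update c i l j)) ^ 2 =
      (∑ j, B i j * g k (c j)) ^ 2 := by
    intro k l c
    congr 1
    refine Finset.sum_congr rfl fun j _ => ?_
    by_cases h : j = i
    · subst h; simp [hB0]
    · simp [h]
  rw [prodExp_apply_coord p hp1 i (fun k c => (∑ j, B i j * g k (c j)) ^ 2) hupd, Finset.mul_sum]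
  refine Finset.sum_congr rfl fun k _ => ?_
  rw [prodExp_sum_sq hp1 (fun j l => B i j * g k l)]
  · simp only [smul_eq_mul, mul_pow]
    rw [mul_left_comm, Finset.sum_mul]
    congr 1
    refine Finset.sum_congr rfl fun j _ => ?_
    rw [Finset.mul_sum]
    exact Finset.sum_congr rfl fun l _ => by ring
  · intro j
    calc ∑ l, p l * (B i j * g k l) = B i j * ∑ l, p l * g l k := by
          rw [Finset.mul_sum]; exact Finset.sum_congr rfl fun l _ => by rw [hg k l]; ring
      _ = 0 := by rw [hg0, mul_zero]

/-- Second moment of a degenerate quadratic form. -/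
lemma prodExp_quadForm_sq (hp1 : ∑ k, p k = 1) (hB : ∀ i j, B i j = B j i)
    (hB0 : ∀ i, B i i = 0) (hg : ∀ k l, g k l = g l k) (hg0 : ∀ l, ∑ k, p k * g k l = 0) :
    prodExp p (fun c : ι → κ => (∑ i, ∑ j, B i j * g (c i) (c j)) ^ 2) =
      2 * (∑ i, ∑ j, B i j ^ 2) * ∑ k, p k * ∑ l, p l * g k l ^ 2 := by
  have h1 : ∀ c : ι → κ, (∑ i, ∑ j, B i j * g (c i) (c j)) ^ 2 =
      ∑ i, (2 * (∑ j, B i j * g (c i) (c j)) ^ 2 + (∑ j, B i j * g (c i) (c j)) *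
        ∑ j ∈ Finset.univ.erase i, ∑ k ∈ Finset.univ.erase i, B j k * g (c j) (c k)) := by
    intro c
    rw [sq, Finset.sum_mul]
    refine Finset.sum_congr rfl fun i _ => ?_
    rw [quadForm_eq_add_remove hB hB0 hg i c]
    ring
  simp only [h1]
  rw [prodExp_sum, Finset.mul_sum Finset.univ _ (2 : ℝ), Finset.sum_mul]
  refine Finset.sum_congr rfl fun i _ => ?_
  rw [prodExp_add, prodExp_mul_left, prodExp_rowForm_sq hp1 hB0 hg hg0,
    prodExp_eq_zero p hp1 i, add_zero, mul_assoc]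
  intro c
  simp only [removeForm_update, smul_eq_mul, ← mul_assoc]
  rw [← Finset.sum_mul, rowForm_mean hB0 hg0, zero_mul]

/-- A degenerate quadratic form is centered. -/
lemma prodExp_quadForm (hp1 : ∑ k, p k = 1)
    (hB0 : ∀ i, B i i = 0) (hg0 : ∀ l, ∑ k, p k * g k l = 0) :
    prodExp p (fun c : ι → κ => ∑ i, ∑ j, B i j * g (c i) (c j)) = 0 := by
  rw [prodExp_sum]
  refine Finset.sum_eq_zero fun i _ => ?_
  refine prodExp_eq_zero p hp1 i _ fun c => ?_
  simpa only [smul_eq_mul] using rowForm_mean hB0 hg0 i c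

end Moments

section Stein

/-- The character `exp (i t x)`. -/
noncomputable def expChar (t x : ℝ) : ℂ := Complex.exp (Complex.I * ((t * x : ℝ) : ℂ))

lemma norm_expChar (t x : ℝ) : ‖expChar t x‖ = 1 := Complex.norm_exp_I_mul_ofReal _

lemma expChar_add (t x y : ℝ) : expChar t (x + y) = expChar t x * expChar t y := by
  rw [expChar, expChar, expChar, ← Complex.exp_add]
  congr 1
  push_cast
  ring

lemma norm_expChar_sub_one_le (t x : ℝ) : ‖expChar t x - 1‖ ≤ |t * x| := by
  simpa [expChar] using Real.norm_exp_I_mul_ofReal_sub_one_le (x := t * x)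

lemma norm_expChar_sub_le (t x y : ℝ) : ‖expChar t x - expChar t y‖ ≤ |t| * |x - y| := by
  have h : expChar t x - expChar t y = expChar t y * (expChar t (x - y) - 1) := by
    rw [mul_sub, ← expChar_add]; simp
  rw [h, norm_mul, norm_expChar, one_mul, ← abs_mul]
  exact norm_expChar_sub_one_le t _

lemma norm_expChar_sub_one_sub_le (t x : ℝ) :
    ‖expChar t x - 1 - Complex.I * ((t * x : ℝ) : ℂ)‖ ≤ 2 * (t * x) ^ 2 := by
  have hn : ‖Complex.I * ((t * x : ℝ) : ℂ)‖ = |t * x| := by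
    rw [norm_mul, Complex.norm_I, one_mul, Complex.norm_real, Real.norm_eq_abs]
  rcases le_total |t * x| 1 with h | h
  · have := Complex.norm_exp_sub_one_sub_id_le (x := Complex.I * ((t * x : ℝ) : ℂ)) (hn.le.trans h)
    rw [hn, sq_abs] at this
    exact this.trans (by nlinarith [sq_nonneg (t * x)])
  · refine (norm_sub_le _ _).trans ?_
    rw [hn]
    have := norm_expChar_sub_one_le t x
    nlinarith [sq_abs (t * x)]

variable {ι κ : Type*} [Fintype ι] [DecidableEq ι] [Fintype κ] {p : κ → ℝ}

lemma prodExp_complex_mul (z : ℂ) (f : (ι → κ) → ℂ) :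
    prodExp p (fun c => z * f c) = z * prodExp p f := by
  simp only [prodExp, Finset.mul_sum, mul_smul_comm]

variable {T : (ι → κ) → ℝ} {w Δ b : ι → (ι → κ) → ℝ}

lemma norm_prodExp_smul_expChar_sub_le (hp0 : ∀ k, 0 ≤ p k) (hp1 : ∑ k, p k = 1)
    (i : ι)
    (hind : ∀ c k, T (Function.update c i k) - Δ i (Function.update c i k) = T c - Δ i c)
    (hw0 : ∀ c, ∑ k, p k * w i (Function.update c i k) = 0)
    (hwb : ∀ c, |w i c| ≤ b i c) (hΔb : ∀ c, |Δ i c| ≤ 2 * b i c) (t : ℝ) :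
    ‖prodExp p (fun c => w i c • expChar t (T c)) - (Complex.I * t) *
      prodExp p (fun c => (∑ k, p k * (w i (Function.update c i k) * Δ i (Function.update c i k))) •
        expChar t (T c))‖ ≤ 12 * t ^ 2 * prodExp p (fun c => b i c ^ 3) := by
  set v : (ι → κ) → ℝ := fun c =>
    ∑ k, p k * (w i (Function.update c i k) * Δ i (Function.update c i k)) with hv
  have hb : ∀ c, 0 ≤ b i c := fun c => (abs_nonneg _).trans (hwb c)
  have hzero : prodExp p (fun c => w i c • expChar t (T c - Δ i c)) = 0 := by
    refine prodExp_eq_zero p hp1 i _ fun c => ?_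
    simp only [hind, smul_smul]
    rw [← Finset.sum_smul, hw0, zero_smul]
  have hmid : prodExp p (fun c => (w i c * Δ i c) • expChar t (T c - Δ i c)) =
      prodExp p (fun c => v c • expChar t (T c - Δ i c)) := by
    rw [← prodExp_update p hp1 i]
    congr 1
    funext c
    simp only [hind, smul_smul]
    rw [← Finset.sum_smul]
  have hdecomp : prodExp p (fun c => w i c • expChar t (T c)) - (Complex.I * t) *
      prodExp p (fun c => v c • expChar t (T c)) =
      prodExp p (fun c => w i c • (expChar t (T c) - expChar t (T c - Δ i c) -
        (Complex.I * t) * (Δ i c • expChar t (T c - Δ i c)))) +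
      (Complex.I * t) *
        prodExp p (fun c => v c • (expChar t (T c - Δ i c) - expChar t (T c))) := by
    have e1 : ∀ c, w i c • (expChar t (T c) - expChar t (T c - Δ i c) -
        (Complex.I * t) * (Δ i c • expChar t (T c - Δ i c))) =
        w i c • expChar t (T c) - w i c • expChar t (T c - Δ i c) -
        (Complex.I * t) * ((w i c * Δ i c) • expChar t (T c - Δ i c)) := by
      intro c
      simp only [Complex.real_smul]
      push_cast
      ring
    simp only [e1, smul_sub]
    rw [prodExp_sub, prodExp_sub, prodExp_sub, prodExp_complex_mul, hzero, hmid]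
    ring
  have hA : ‖prodExp p (fun c => w i c • (expChar t (T c) - expChar t (T c - Δ i c) -
        (Complex.I * t) * (Δ i c • expChar t (T c - Δ i c))))‖ ≤
      8 * t ^ 2 * prodExp p (fun c => b i c ^ 3) := by
    refine (norm_prodExp_le hp0 _).trans ?_
    rw [← prodExp_mul_left]
    refine prodExp_mono hp0 fun c => ?_
    have e2 : expChar t (T c) - expChar t (T c - Δ i c) -
        (Complex.I * t) * (Δ i c • expChar t (T c - Δ i c)) = expChar t (T c - Δ i c) *
        (expChar t (Δ i c) - 1 - Complex.I * ((t * Δ i c : ℝ) : ℂ)) := by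
      rw [mul_sub, mul_sub, ← expChar_add, sub_add_cancel, Complex.real_smul]
      push_cast
      ring
    rw [norm_smul, e2, norm_mul, norm_expChar, one_mul, Real.norm_eq_abs]
    have h1 := norm_expChar_sub_one_sub_le t (Δ i c)
    have h2 : (Δ i c) ^ 2 ≤ (2 * b i c) ^ 2 := sq_le_sq' (abs_le.1 (hΔb c)).1 (abs_le.1 (hΔb c)).2
    have h3 : 2 * (t * Δ i c) ^ 2 ≤ 8 * t ^ 2 * b i c ^ 2 := by
      nlinarith [mul_le_mul_of_nonneg_left h2 (sq_nonneg t)]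
    calc |w i c| * _ ≤ b i c * (8 * t ^ 2 * b i c ^ 2) :=
          mul_le_mul (hwb c) (h1.trans h3) (norm_nonneg _) (hb c)
      _ = 8 * t ^ 2 * b i c ^ 3 := by ring
  have hB : ‖prodExp p (fun c => v c • (expChar t (T c - Δ i c) - expChar t (T c)))‖ ≤
      |t| * (4 * prodExp p (fun c => b i c ^ 3)) := by
    refine (norm_prodExp_le hp0 _).trans ?_
    have e3 : prodExp p (fun c : ι → κ => ∑ k, p k • (b i (Function.update c i k)) ^ 3) =
        prodExp p (fun c => b i c ^ 3) := prodExp_update p hp1 i (fun c => b i c ^ 3)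
    have e4 : |t| * (4 * prodExp p (fun c => b i c ^ 3)) = prodExp p (fun c : ι → κ =>
        |t| * (4 / 3 * (2 * (∑ k, p k • (b i (Function.update c i k)) ^ 3) + b i c ^ 3))) := by
      rw [prodExp_mul_left, prodExp_mul_left, prodExp_add, prodExp_mul_left, e3]
      ring
    rw [e4]
    refine prodExp_mono hp0 fun c => ?_
    have h5 : ‖expChar t (T c - Δ i c) - expChar t (T c)‖ ≤ |t| * (2 * b i c) := by
      refine (norm_expChar_sub_le _ _ _).trans (mul_le_mul_of_nonneg_left ?_ (abs_nonneg t))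
      rw [sub_sub_cancel_left, abs_neg]
      exact hΔb c
    have h6 : |v c| ≤ ∑ k, p k * (2 * b i (Function.update c i k) ^ 2) := by
      refine (Finset.abs_sum_le_sum_abs _ _).trans (Finset.sum_le_sum fun k _ => ?_)
      rw [abs_mul, abs_of_nonneg (hp0 k), abs_mul]
      refine mul_le_mul_of_nonneg_left ?_ (hp0 k)
      calc |w i (Function.update c i k)| * |Δ i (Function.update c i k)| ≤
          b i (Function.update c i k) * (2 * b i (Function.update c i k)) :=
            mul_le_mul (hwb _) (hΔb _) (abs_nonneg _) (hb _)
        _ = _ := by ring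
    rw [norm_smul, Real.norm_eq_abs]
    calc |v c| * ‖expChar t (T c - Δ i c) - expChar t (T c)‖ ≤
        (∑ k, p k * (2 * b i (Function.update c i k) ^ 2)) * (|t| * (2 * b i c)) :=
          mul_le_mul h6 h5 (norm_nonneg _) ((abs_nonneg _).trans h6)
      _ = |t| * ∑ k, p k * (4 * b i (Function.update c i k) ^ 2 * b i c) := by
          rw [Finset.sum_mul, Finset.mul_sum]
          exact Finset.sum_congr rfl fun k _ => by ring
      _ ≤ |t| * ∑ k, p k * (4 / 3 * (2 * b i (Function.update c i k) ^ 3 + b i c ^ 3)) := by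
          refine mul_le_mul_of_nonneg_left (Finset.sum_le_sum fun k _ =>
            mul_le_mul_of_nonneg_left ?_ (hp0 k)) (abs_nonneg t)
          set x := b i (Function.update c i k)
          set y := b i c
          have hx : 0 ≤ x := hb _
          have hy : 0 ≤ y := hb _
          nlinarith [mul_nonneg (add_nonneg (add_nonneg hx hx) hy) (sq_nonneg (x - y))]
      _ = _ := by
          congr 1
          have : ∀ k, p k * (4 / 3 * (2 * b i (Function.update c i k) ^ 3 + b i c ^ 3)) =
              8 / 3 * (p k • b i (Function.update c i k) ^ 3) + p k * (4 / 3 * b i c ^ 3) := by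
            intro k; rw [smul_eq_mul]; ring
          simp only [this]
          rw [Finset.sum_add_distrib, ← Finset.mul_sum, ← Finset.sum_mul, hp1]
          ring
  rw [hdecomp]
  refine (norm_add_le _ _).trans ?_
  rw [norm_mul, norm_mul, Complex.norm_I, one_mul, Complex.norm_real, Real.norm_eq_abs]
  have := mul_le_mul_of_nonneg_left hB (abs_nonneg t)
  have h7 : |t| * (|t| * (4 * prodExp p (fun c => b i c ^ 3))) =
      4 * t ^ 2 * prodExp p (fun c => b i c ^ 3) := by
    rw [← sq_abs t]; ring
  linarith

/-- Stein's identity, up to an error, for the characteristic function of a function of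
independent variables. -/
lemma norm_prodExp_stein_le (hp0 : ∀ k, 0 ≤ p k) (hp1 : ∑ k, p k = 1)
    (hT : ∀ c, T c = ∑ i, w i c)
    (hind : ∀ i c k, T (Function.update c i k) - Δ i (Function.update c i k) = T c - Δ i c)
    (hw0 : ∀ i c, ∑ k, p k * w i (Function.update c i k) = 0)
    (hwb : ∀ i c, |w i c| ≤ b i c) (hΔb : ∀ i c, |Δ i c| ≤ 2 * b i c) (v t : ℝ) :
    ‖prodExp p (fun c => T c • expChar t (T c)) - (Complex.I * t) *
      (v * prodExp p (fun c => expChar t (T c)))‖ ≤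
    12 * t ^ 2 * ∑ i, prodExp p (fun c => b i c ^ 3) + |t| * prodExp p (fun c =>
      |∑ i, ∑ k, p k * (w i (Function.update c i k) * Δ i (Function.update c i k)) - v|) := by
  set V : (ι → κ) → ℝ := fun c =>
    ∑ i, ∑ k, p k * (w i (Function.update c i k) * Δ i (Function.update c i k)) with hV
  have h1 : prodExp p (fun c => T c • expChar t (T c)) =
      ∑ i, prodExp p (fun c => w i c • expChar t (T c)) := by
    rw [← prodExp_sum]
    congr 1
    funext c
    rw [← Finset.sum_smul, ← hT]
  have h2 : prodExp p (fun c => V c • expChar t (T c)) = ∑ i, prodExp p (fun c =>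
      (∑ k, p k * (w i (Function.update c i k) * Δ i (Function.update c i k))) •
        expChar t (T c)) := by
    rw [← prodExp_sum]
    congr 1
    funext c
    rw [← Finset.sum_smul]
  have h3 : prodExp p (fun c => T c • expChar t (T c)) - (Complex.I * t) *
      (v * prodExp p (fun c => expChar t (T c))) =
      ∑ i, (prodExp p (fun c => w i c • expChar t (T c)) - (Complex.I * t) *
        prodExp p (fun c => (∑ k, p k * (w i (Function.update c i k) *
          Δ i (Function.update c i k))) • expChar t (T c))) +
      (Complex.I * t) * prodExp p (fun c => (V c - v) • expChar t (T c)) := by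
    simp only [sub_smul]
    rw [Finset.sum_sub_distrib, ← h1, ← Finset.mul_sum, ← h2, prodExp_sub, prodExp_smul,
      Complex.real_smul]
    ring
  rw [h3]
  refine (norm_add_le _ _).trans (add_le_add ?_ ?_)
  · refine (norm_sum_le _ _).trans ?_
    rw [Finset.mul_sum]
    exact Finset.sum_le_sum fun i _ => norm_prodExp_smul_expChar_sub_le hp0 hp1 i (hind i)
      (hw0 i) (hwb i) (hΔb i) t
  · rw [norm_mul, norm_mul, Complex.norm_I, one_mul, Complex.norm_real, Real.norm_eq_abs]
    refine mul_le_mul_of_nonneg_left ((norm_prodExp_le hp0 _).trans ?_) (abs_nonneg t)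
    refine prodExp_mono hp0 fun c => ?_
    rw [norm_smul, norm_expChar, mul_one, Real.norm_eq_abs]

lemma hasDerivAt_expChar (x t : ℝ) :
    HasDerivAt (fun s => expChar s x) (Complex.I * (x • expChar t x)) t := by
  have h1 : HasDerivAt (fun s : ℝ => Complex.I * ((s * x : ℝ) : ℂ)) (Complex.I * (x : ℂ)) t := by
    have h0 := ((hasDerivAt_id t).mul_const x).ofReal_comp
    simpa using h0.const_mul Complex.I
  have h2 := h1.cexp
  convert! h2 using 1
  rw [Complex.real_smul, expChar]
  ring

/-- A quantitative normal approximation from an approximate Stein identity. -/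
lemma norm_sub_gaussian_le (φ φ' : ℝ → ℂ) (hφ : ∀ t, HasDerivAt φ (φ' t) t) (h0 : φ 0 = 1)
    {v M N : ℝ} (hv : 0 ≤ v) (hM : 0 ≤ M) (hN : 0 ≤ N)
    (h : ∀ t, ‖φ' t + (v * t : ℝ) * φ t‖ ≤ M * t ^ 2 + N * |t|) (t : ℝ) :
    ‖φ t - Complex.exp ((-(v * t ^ 2 / 2) : ℝ) : ℂ)‖ ≤ |t| * (M * t ^ 2 + N * |t|) := by
  set ψ : ℝ → ℂ := fun s => φ s * Complex.exp ((v * s ^ 2 / 2 : ℝ) : ℂ) with hψ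
  have hd : ∀ s, HasDerivAt ψ ((φ' s + (v * s : ℝ) * φ s) *
      Complex.exp ((v * s ^ 2 / 2 : ℝ) : ℂ)) s := by
    intro s
    have h1 : HasDerivAt (fun s : ℝ => v * s ^ 2 / 2) (v * s) s := by
      have := (((hasDerivAt_id s).pow 2).const_mul v).div_const 2
      convert! this using 1
      simp; ring
    have h2 := (hφ s).mul h1.ofReal_comp.cexp
    convert! h2 using 1
    ring
  have hnorm : ∀ x : ℝ, ‖Complex.exp (x : ℂ)‖ = Real.exp x := fun x => by
    rw [Complex.norm_exp, Complex.ofReal_re]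
  have hmv := Convex.norm_image_sub_le_of_norm_hasDerivWithin_le (f := ψ)
    (f' := fun s => (φ' s + (v * s : ℝ) * φ s) * Complex.exp ((v * s ^ 2 / 2 : ℝ) : ℂ))
    (s := Set.Icc (-|t|) |t|) (x := 0) (y := t)
    (C := (M * t ^ 2 + N * |t|) * Real.exp (v * t ^ 2 / 2))
    (fun s _ => (hd s).hasDerivWithinAt) (fun s hs => by
      have hst : |s| ≤ |t| := abs_le.2 hs
      have hs2 : s ^ 2 ≤ t ^ 2 := sq_le_sq.2 hst
      rw [norm_mul, hnorm]
      refine mul_le_mul ((h s).trans ?_) (Real.exp_le_exp.2 ?_) (Real.exp_pos _).le (by positivity)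
      · gcongr
      · gcongr) (convex_Icc _ _) ⟨by simp, by simp⟩ ⟨neg_abs_le t, le_abs_self t⟩
  have h4 : φ t - Complex.exp ((-(v * t ^ 2 / 2) : ℝ) : ℂ) =
      (ψ t - ψ 0) * Complex.exp ((-(v * t ^ 2 / 2) : ℝ) : ℂ) := by
    have h5 : ψ t * Complex.exp ((-(v * t ^ 2 / 2) : ℝ) : ℂ) = φ t := by
      simp only [hψ]
      rw [mul_assoc, ← Complex.exp_add]
      simp
    have h6 : ψ 0 = 1 := by simp [hψ, h0]
    rw [sub_mul, h5, h6, one_mul]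
  rw [h4, norm_mul, hnorm]
  calc ‖ψ t - ψ 0‖ * Real.exp (-(v * t ^ 2 / 2)) ≤
      ((M * t ^ 2 + N * |t|) * Real.exp (v * t ^ 2 / 2) * ‖t - 0‖) *
        Real.exp (-(v * t ^ 2 / 2)) :=
        mul_le_mul_of_nonneg_right hmv (Real.exp_pos _).le
    _ = |t| * (M * t ^ 2 + N * |t|) *
        (Real.exp (v * t ^ 2 / 2) * Real.exp (-(v * t ^ 2 / 2))) := by
        rw [sub_zero, Real.norm_eq_abs]; ring
    _ = _ := by rw [← Real.exp_add]; simp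

/-- Normal approximation for a function of independent variables. -/
lemma norm_prodExp_expChar_sub_gaussian_le (hp0 : ∀ k, 0 ≤ p k) (hp1 : ∑ k, p k = 1)
    (hT : ∀ c, T c = ∑ i, w i c)
    (hind : ∀ i c k, T (Function.update c i k) - Δ i (Function.update c i k) = T c - Δ i c)
    (hw0 : ∀ i c, ∑ k, p k * w i (Function.update c i k) = 0)
    (hwb : ∀ i c, |w i c| ≤ b i c) (hΔb : ∀ i c, |Δ i c| ≤ 2 * b i c) {v M N : ℝ}
    (hv : 0 ≤ v) (hM : ∑ i, prodExp p (fun c => b i c ^ 3) ≤ M)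
    (hN : prodExp p (fun c =>
      |∑ i, ∑ k, p k * (w i (Function.update c i k) * Δ i (Function.update c i k)) - v|) ≤ N)
    (t : ℝ) :
    ‖prodExp p (fun c => expChar t (T c)) - Complex.exp ((-(v * t ^ 2 / 2) : ℝ) : ℂ)‖ ≤
      |t| * (12 * M * t ^ 2 + N * |t|) := by
  have hM0 : 0 ≤ M := (Finset.sum_nonneg fun i _ => prodExp_nonneg hp0 fun c =>
    pow_nonneg ((abs_nonneg _).trans (hwb i c)) 3).trans hM
  have hN0 : 0 ≤ N := (prodExp_nonneg hp0 fun c => abs_nonneg _).trans hN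
  refine norm_sub_gaussian_le (fun s => prodExp p (fun c => expChar s (T c)))
    (fun s => Complex.I * prodExp p (fun c => T c • expChar s (T c))) (fun s => ?_) ?_ hv
    (by positivity) hN0 (fun s => ?_) t
  · rw [← prodExp_complex_mul]
    unfold prodExp
    exact HasDerivAt.fun_sum fun c _ => (hasDerivAt_expChar (T c) s).const_smul _
  · simp only [expChar, zero_mul, Complex.ofReal_zero, mul_zero, Complex.exp_zero]
    exact prodExp_const p hp1 1
  · have h := norm_prodExp_stein_le hp0 hp1 hT hind hw0 hwb hΔb v s
    have e : Complex.I * prodExp p (fun c => T c • expChar s (T c)) + ((v * s : ℝ) : ℂ) *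
        prodExp p (fun c => expChar s (T c)) = Complex.I *
        (prodExp p (fun c => T c • expChar s (T c)) - (Complex.I * s) *
          (v * prodExp p (fun c => expChar s (T c)))) := by
      push_cast
      linear_combination ((s : ℂ) * v * prodExp p (fun c => expChar s (T c))) * Complex.I_mul_I
    rw [e, norm_mul, Complex.norm_I, one_mul]
    refine h.trans ?_
    have h1 := mul_le_mul_of_nonneg_left hM (by positivity : 0 ≤ 12 * s ^ 2)
    have h2 := mul_le_mul_of_nonneg_left hN (abs_nonneg s)
    linarith

end Stein

section QuadraticPlusLinear

variable {ι κ : Type*} [Fintype ι] [DecidableEq ι] [Fintype κ] {p : κ → ℝ}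
  {D : ι → ι → ℝ} {α : ι → ℝ} {g : κ → κ → ℝ} {h : κ → ℝ} {K θ : ℝ}

lemma abs_weighted_sum_le (hp0 : ∀ k, 0 ≤ p k) (hp1 : ∑ k, p k = 1) {f : κ → ℝ} {a : ℝ}
    (hf : ∀ k, |f k| ≤ a) : |∑ k, p k * f k| ≤ a := by
  calc |∑ k, p k * f k| ≤ ∑ k, p k * a := by
        refine (Finset.abs_sum_le_sum_abs _ _).trans (Finset.sum_le_sum fun k _ => ?_)
        rw [abs_mul, abs_of_nonneg (hp0 k)]
        exact mul_le_mul_of_nonneg_left (hf k) (hp0 k)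
    _ = a := by rw [← Finset.sum_mul, hp1, one_mul]

lemma prodExp_rowForm_pow_four_le (hp0 : ∀ k, 0 ≤ p k) (hp1 : ∑ k, p k = 1)
    (hD0 : ∀ i, D i i = 0) (hg : ∀ k l, g k l = g l k) (hg0 : ∀ l, ∑ k, p k * g k l = 0)
    (hgK : ∀ k l, |g k l| ≤ K) (i : ι) :
    prodExp p (fun c : ι → κ => (∑ j, D i j * g (c i) (c j)) ^ 4) ≤
      4 * K ^ 4 * (∑ j, D i j ^ 2) ^ 2 := by
  have hupd : ∀ k l (c : ι → κ), (∑ j, D i j * g k (Function.update c i l j)) ^ 4 =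
      (∑ j, D i j * g k (c j)) ^ 4 := by
    intro k l c
    congr 1
    refine Finset.sum_congr rfl fun j _ => ?_
    by_cases hj : j = i
    · subst hj; simp [hD0]
    · simp [hj]
  rw [prodExp_apply_coord p hp1 i (fun k c => (∑ j, D i j * g k (c j)) ^ 4) hupd]
  have hk : ∀ k, prodExp p (fun c : ι → κ => (∑ j, D i j * g k (c j)) ^ 4) ≤
      4 * K ^ 4 * (∑ j, D i j ^ 2) ^ 2 := by
    intro k
    refine (prodExp_sum_moments hp0 hp1 (fun j l => D i j * g k l) (fun j => D i j ^ 2 * K ^ 2)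
      (fun j => ?_) (fun j l => ?_) Finset.univ).2.trans (le_of_eq ?_)
    · calc ∑ l, p l * (D i j * g k l) = D i j * ∑ l, p l * g l k := by
            rw [Finset.mul_sum]; exact Finset.sum_congr rfl fun l _ => by rw [hg k l]; ring
        _ = 0 := by rw [hg0, mul_zero]
    · rw [mul_pow]
      refine mul_le_mul_of_nonneg_left ?_ (sq_nonneg _)
      exact sq_le_sq' (abs_le.1 (hgK k l)).1 (abs_le.1 (hgK k l)).2
    · rw [← Finset.sum_mul]; ring
  calc ∑ k, p k • prodExp p (fun c : ι → κ => (∑ j, D i j * g k (c j)) ^ 4) ≤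
      ∑ k, p k * (4 * K ^ 4 * (∑ j, D i j ^ 2) ^ 2) :=
        Finset.sum_le_sum fun k _ => mul_le_mul_of_nonneg_left (hk k) (hp0 k)
    _ = _ := by rw [← Finset.sum_mul, hp1, one_mul]

omit [DecidableEq ι] in
lemma sum_sq_row_sq_le (hDs : ∀ i j, D i j = D j i) :
    ∑ i, (∑ j, D i j ^ 2) ^ 2 ≤ ∑ i, ∑ j, (∑ l, D l i * D l j) ^ 2 := by
  refine Finset.sum_le_sum fun i _ => ?_
  have : (∑ j, D i j ^ 2) = ∑ l, D l i * D l i :=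
    Finset.sum_congr rfl fun j _ => by rw [hDs i j]; ring
  rw [this]
  exact Finset.single_le_sum (f := fun j => (∑ l, D l i * D l j) ^ 2)
    (fun j _ => sq_nonneg _) (Finset.mem_univ i)

/-- Third absolute moments of the influence of the coordinates. -/
lemma sum_prodExp_influence_le (hp0 : ∀ k, 0 ≤ p k) (hp1 : ∑ k, p k = 1)
    (hDs : ∀ i j, D i j = D j i) (hD0 : ∀ i, D i i = 0)
    (hD1 : ∑ i, ∑ j, D i j ^ 2 = 1)
    (hg : ∀ k l, g k l = g l k) (hg0 : ∀ l, ∑ k, p k * g k l = 0)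
    (hK : 1 ≤ K) (hgK : ∀ k l, |g k l| ≤ K) (hhK : ∀ k, |h k| ≤ K) (hθ : 0 < θ) (hθ1 : θ ≤ 1)
    (hB : ∑ i, ∑ j, (∑ l, D l i * D l j) ^ 2 ≤ θ ^ 4) (hα3 : ∑ i, |α i| ^ 3 ≤ θ) :
    ∑ i, prodExp p (fun c : ι → κ =>
      (|∑ j, D i j * g (c i) (c j)| + |α i * h (c i)|) ^ 3) ≤ 14 * K ^ 4 * θ := by
  have hgsq : ∑ k, p k * ∑ l, p l * g k l ^ 2 ≤ K ^ 2 := by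
    refine (le_abs_self _).trans (abs_weighted_sum_le hp0 hp1 fun k =>
      abs_weighted_sum_le hp0 hp1 fun l => ?_)
    rw [abs_of_nonneg (sq_nonneg _)]
    exact sq_le_sq' (abs_le.1 (hgK k l)).1 (abs_le.1 (hgK k l)).2
  have hi : ∀ i, prodExp p (fun c : ι → κ =>
      (|∑ j, D i j * g (c i) (c j)| + |α i * h (c i)|) ^ 3) ≤
      2 * θ ^ 2 * K ^ 2 * (∑ j, D i j ^ 2) + 8 * K ^ 4 / θ ^ 2 * (∑ j, D i j ^ 2) ^ 2 +
        4 * K ^ 3 * |α i| ^ 3 := by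
    intro i
    have h4 := prodExp_rowForm_pow_four_le hp0 hp1 hD0 hg hg0 hgK i
    have h2 := prodExp_rowForm_sq hp1 hD0 hg hg0 i
    calc prodExp p (fun c : ι → κ => (|∑ j, D i j * g (c i) (c j)| + |α i * h (c i)|) ^ 3) ≤
        prodExp p (fun c : ι → κ => 2 * θ ^ 2 * (∑ j, D i j * g (c i) (c j)) ^ 2 +
          2 / θ ^ 2 * (∑ j, D i j * g (c i) (c j)) ^ 4 + 4 * K ^ 3 * |α i| ^ 3) := by
          refine prodExp_mono hp0 fun c => ?_
          set q := ∑ j, D i j * g (c i) (c j)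
          have hl : |α i * h (c i)| ^ 3 ≤ K ^ 3 * |α i| ^ 3 := by
            rw [abs_mul, mul_pow, mul_comm]
            exact mul_le_mul_of_nonneg_right (pow_le_pow_left₀ (abs_nonneg _) (hhK _) 3)
              (by positivity)
          have hq : |q| ^ 3 ≤ θ ^ 2 / 2 * q ^ 2 + 1 / (2 * θ ^ 2) * q ^ 4 := by
            have e : θ ^ 2 / 2 * q ^ 2 + 1 / (2 * θ ^ 2) * q ^ 4 - |q| ^ 3 =
                q ^ 2 * (θ - |q| / θ) ^ 2 / 2 := by
              have : q ^ 4 = |q| ^ 4 := by rw [← abs_pow]; exact (abs_of_nonneg (by positivity)).symm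
              rw [this, ← sq_abs q]
              field_simp
              ring
            have : 0 ≤ q ^ 2 * (θ - |q| / θ) ^ 2 / 2 := by positivity
            linarith
          have hs : (|q| + |α i * h (c i)|) ^ 3 ≤ 4 * (|q| ^ 3 + |α i * h (c i)| ^ 3) := by
            nlinarith [mul_nonneg (add_nonneg (abs_nonneg q) (abs_nonneg (α i * h (c i))))
              (sq_nonneg (|q| - |α i * h (c i)|))]
          have e2 : 4 * (1 / (2 * θ ^ 2) * q ^ 4) = 2 / θ ^ 2 * q ^ 4 := by field_simp; ring
          linarith
      _ = 2 * θ ^ 2 * prodExp p (fun c : ι → κ => (∑ j, D i j * g (c i) (c j)) ^ 2) +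
          2 / θ ^ 2 * prodExp p (fun c : ι → κ => (∑ j, D i j * g (c i) (c j)) ^ 4) +
          4 * K ^ 3 * |α i| ^ 3 := by
          rw [prodExp_add, prodExp_add, prodExp_mul_left (2 * θ ^ 2), prodExp_mul_left (2 / θ ^ 2),
            prodExp_const p hp1]
      _ ≤ 2 * θ ^ 2 * ((∑ j, D i j ^ 2) * K ^ 2) +
          2 / θ ^ 2 * (4 * K ^ 4 * (∑ j, D i j ^ 2) ^ 2) + 4 * K ^ 3 * |α i| ^ 3 := by
          rw [h2]
          have h0 : 0 ≤ ∑ j, D i j ^ 2 := Finset.sum_nonneg fun j _ => sq_nonneg _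
          gcongr
      _ = _ := by ring
  refine (Finset.sum_le_sum fun i _ => hi i).trans ?_
  rw [Finset.sum_add_distrib, Finset.sum_add_distrib, ← Finset.mul_sum, ← Finset.mul_sum,
    ← Finset.mul_sum, hD1]
  have h5 := (sum_sq_row_sq_le hDs).trans hB
  have h6 : 8 * K ^ 4 / θ ^ 2 * ∑ i, (∑ j, D i j ^ 2) ^ 2 ≤ 8 * K ^ 4 * θ ^ 2 := by
    calc _ ≤ 8 * K ^ 4 / θ ^ 2 * θ ^ 4 := mul_le_mul_of_nonneg_left h5 (by positivity)
      _ = _ := by field_simp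
  have h7 : 4 * K ^ 3 * ∑ i, |α i| ^ 3 ≤ 4 * K ^ 3 * θ :=
    mul_le_mul_of_nonneg_left hα3 (by positivity)
  have h8 : θ ^ 2 ≤ θ := by nlinarith
  have h9 : K ^ 2 * θ ^ 2 ≤ K ^ 4 * θ :=
    mul_le_mul (pow_le_pow_right₀ hK (by norm_num)) h8 (by positivity) (by positivity)
  have h10 : K ^ 3 * θ ≤ K ^ 4 * θ :=
    mul_le_mul_of_nonneg_right (pow_le_pow_right₀ hK (by norm_num)) hθ.le
  have h11 : K ^ 4 * θ ^ 2 ≤ K ^ 4 * θ := mul_le_mul_of_nonneg_left h8 (by positivity)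
  linarith

omit [DecidableEq ι] in
lemma sum_mulVec_sq_le (hDs : ∀ i j, D i j = D j i) (hα1 : ∑ i, α i ^ 2 = 1)
    (hB : ∑ i, ∑ j, (∑ l, D l i * D l j) ^ 2 ≤ θ ^ 4) :
    ∑ j, (∑ i, α i * D i j) ^ 2 ≤ θ ^ 2 := by
  have h1 : ∑ j, (∑ i, α i * D i j) ^ 2 =
      ∑ x : ι × ι, (α x.1 * α x.2) * ∑ l, D l x.1 * D l x.2 := by
    rw [Fintype.sum_prod_type]
    have h0 : ∀ j, (∑ i, α i * D i j) ^ 2 = ∑ i, ∑ k, (α i * D i j) * (α k * D k j) := by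
      intro j; rw [sq, Finset.sum_mul_sum]
    simp only [h0, Finset.mul_sum]
    rw [Finset.sum_comm]
    refine Finset.sum_congr rfl fun i _ => ?_
    rw [Finset.sum_comm]
    refine Finset.sum_congr rfl fun k _ => Finset.sum_congr rfl fun j _ => ?_
    rw [hDs i j, hDs k j]; ring
  have h2 := Finset.sum_mul_sq_le_sq_mul_sq Finset.univ (fun x : ι × ι => α x.1 * α x.2)
    (fun x => ∑ l, D l x.1 * D l x.2)
  rw [← h1, Fintype.sum_prod_type, Fintype.sum_prod_type] at h2
  have h3 : ∑ x, ∑ y, (α x * α y) ^ 2 = 1 := by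
    simp only [mul_pow]
    rw [← Finset.sum_mul_sum, hα1, one_mul]
  rw [h3, one_mul] at h2
  have h4 : (∑ j, (∑ i, α i * D i j) ^ 2) ^ 2 ≤ (θ ^ 2) ^ 2 := by
    refine h2.trans (hB.trans (le_of_eq (by ring)))
  exact (abs_le_of_sq_le_sq' h4 (sq_nonneg θ)).2

/-- The sum of the conditional covariances appearing in Stein's identity. -/
lemma condCov_eq (hD0 : ∀ i, D i i = 0) (c : ι → κ) :
    ∑ i, ∑ k, p k *
      ((∑ j, D i j * g (Function.update c i k i) (Function.update c i k j) +
          α i * h (Function.update c i k i)) *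
        (2 * ∑ j, D i j * g (Function.update c i k i) (Function.update c i k j) +
          α i * h (Function.update c i k i))) =
      2 * ∑ j, ∑ l, (∑ i, D i j * D i l) * ∑ k, p k * (g k (c j) * g k (c l)) +
      3 * ∑ j, (∑ i, α i * D i j) * ∑ k, p k * (h k * g k (c j)) +
      (∑ i, α i ^ 2) * ∑ k, p k * h k ^ 2 := by
  simp only [rowForm_update hD0]
  simp only [Function.update_self]
  have h1 : ∀ i k, p k * ((∑ j, D i j * g k (c j) + α i * h k) *
      (2 * ∑ j, D i j * g k (c j) + α i * h k)) =
      2 * (p k * (∑ j, D i j * g k (c j)) ^ 2) +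
      3 * (∑ j, α i * D i j * (p k * (h k * g k (c j)))) + α i ^ 2 * (p k * h k ^ 2) := by
    intro i k
    have : ∑ j, α i * D i j * (p k * (h k * g k (c j))) =
        α i * p k * h k * ∑ j, D i j * g k (c j) := by
      rw [Finset.mul_sum]; exact Finset.sum_congr rfl fun j _ => by ring
    rw [this]; ring
  simp only [h1, Finset.sum_add_distrib, ← Finset.mul_sum]
  congr 1
  · congr 1
    · congr 1
      have h2 : ∀ i k, p k * (∑ j, D i j * g k (c j)) ^ 2 =
          ∑ j, ∑ l, D i j * D i l * (p k * (g k (c j) * g k (c l))) := by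
        intro i k
        rw [sq, Finset.sum_mul_sum, Finset.mul_sum]
        refine Finset.sum_congr rfl fun j _ => ?_
        rw [Finset.mul_sum]
        exact Finset.sum_congr rfl fun l _ => by ring
      simp only [h2, Finset.sum_mul, Finset.mul_sum]
      calc ∑ i, ∑ k, ∑ j, ∑ l, D i j * D i l * (p k * (g k (c j) * g k (c l)))
          = ∑ i, ∑ j, ∑ l, ∑ k, D i j * D i l * (p k * (g k (c j) * g k (c l))) := by
            refine Finset.sum_congr rfl fun i _ => ?_
            rw [Finset.sum_comm]
            exact Finset.sum_congr rfl fun j _ => Finset.sum_comm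
        _ = _ := by
            rw [Finset.sum_comm]
            refine Finset.sum_congr rfl fun j _ => ?_
            rw [Finset.sum_comm]
            exact Finset.sum_congr rfl fun l _ => Finset.sum_comm
    · congr 1
      simp only [Finset.sum_mul, Finset.mul_sum]
      calc ∑ i, ∑ k, ∑ j, α i * D i j * (p k * (h k * g k (c j)))
          = ∑ i, ∑ j, ∑ k, α i * D i j * (p k * (h k * g k (c j))) :=
            Finset.sum_congr rfl fun i _ => Finset.sum_comm
        _ = _ := by
            rw [Finset.sum_comm]
            exact Finset.sum_congr rfl fun j _ => Finset.sum_comm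
  · rw [Finset.sum_mul]

/-- The conditional covariances concentrate. -/
lemma prodExp_condCov_sub_le (hp0 : ∀ k, 0 ≤ p k) (hp1 : ∑ k, p k = 1)
    (hDs : ∀ i j, D i j = D j i) (hD0 : ∀ i, D i i = 0)
    (hD1 : ∑ i, ∑ j, D i j ^ 2 = 1) (hα1 : ∑ i, α i ^ 2 = 1)
    (hg : ∀ k l, g k l = g l k) (hg0 : ∀ l, ∑ k, p k * g k l = 0)
    (hK : 1 ≤ K) (hgK : ∀ k l, |g k l| ≤ K) (hhK : ∀ k, |h k| ≤ K) (hθ : 0 < θ) (hθ1 : θ ≤ 1)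
    (hB : ∑ i, ∑ j, (∑ l, D l i * D l j) ^ 2 ≤ θ ^ 4) :
    prodExp p (fun c : ι → κ => |∑ i, ∑ k, p k *
      ((∑ j, D i j * g (Function.update c i k i) (Function.update c i k j) +
          α i * h (Function.update c i k i)) *
        (2 * ∑ j, D i j * g (Function.update c i k i) (Function.update c i k j) +
          α i * h (Function.update c i k i))) -
      (2 * ∑ k, p k * ∑ l, p l * g k l ^ 2 + ∑ k, p k * h k ^ 2)|) ≤ 11 * K ^ 2 * θ := by
  set G := ∑ k, p k * ∑ l, p l * g k l ^ 2 with hG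
  set B : ι → ι → ℝ := fun i j => ∑ l, D l i * D l j with hBdef
  set B0 : ι → ι → ℝ := fun i j => if i = j then 0 else B i j with hB0def
  set r : κ → κ → ℝ := fun a b => ∑ k, p k * (g k a * g k b) with hr
  set s : κ → ℝ := fun b => ∑ k, p k * (h k * g k b) with hs
  set β : ι → ℝ := fun j => ∑ i, α i * D i j with hβ
  have hrK : ∀ a b, |r a b| ≤ K ^ 2 := fun a b => abs_weighted_sum_le hp0 hp1 fun k => by
    rw [abs_mul, sq]; exact mul_le_mul (hgK _ _) (hgK _ _) (abs_nonneg _) (by linarith)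
  have hsK : ∀ b, |s b| ≤ K ^ 2 := fun b => abs_weighted_sum_le hp0 hp1 fun k => by
    rw [abs_mul, sq]; exact mul_le_mul (hhK _) (hgK _ _) (abs_nonneg _) (by linarith)
  have hmean : ∀ (f : κ → ℝ), ∑ b, p b * ∑ k, p k * (f k * g k b) = 0 := by
    intro f
    have h1 : ∀ b k, p b * (p k * (f k * g k b)) = p k * f k * (p b * g b k) := by
      intro b k; rw [hg k b]; ring
    simp only [Finset.mul_sum, h1]
    rw [Finset.sum_comm]
    simp only [← Finset.mul_sum, hg0, mul_zero, Finset.sum_const_zero]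
  have hr0 : ∀ b, ∑ a, p a * r a b = 0 := by
    intro b
    have := hmean (fun k => g k b)
    simpa only [hr, mul_comm (g _ b)] using this
  have hrs : ∀ a b, r a b = r b a := fun a b =>
    Finset.sum_congr rfl fun k _ => by rw [mul_comm (g k a)]
  have hrdiag : ∑ b, p b * r b b = G := by
    rw [hG]
    refine Finset.sum_congr rfl fun b _ => ?_
    congr 1
    exact Finset.sum_congr rfl fun k _ => by rw [hg k b]; ring
  have hGK : |G| ≤ K ^ 2 := by
    rw [← hrdiag]; exact abs_weighted_sum_le hp0 hp1 fun b => hrK b b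
  have hBs : ∀ i j, B i j = B j i := fun i j => Finset.sum_congr rfl fun l _ => mul_comm _ _
  have hBtr : ∑ j, B j j = 1 := by
    rw [← hD1, Finset.sum_comm]
    exact Finset.sum_congr rfl fun j _ => Finset.sum_congr rfl fun l _ => (sq _).symm
  have hdecomp : ∀ c : ι → κ, ∑ i, ∑ k, p k *
      ((∑ j, D i j * g (Function.update c i k i) (Function.update c i k j) +
          α i * h (Function.update c i k i)) *
        (2 * ∑ j, D i j * g (Function.update c i k i) (Function.update c i k j) +
          α i * h (Function.update c i k i))) - (2 * G + ∑ k, p k * h k ^ 2) =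
      2 * (∑ i, ∑ j, B0 i j * r (c i) (c j)) + 2 * (∑ j, B j j * (r (c j) (c j) - G)) +
        3 * ∑ j, β j * s (c j) := by
    intro c
    rw [condCov_eq hD0, hα1]
    have h2 : ∑ j, ∑ l, B j l * r (c j) (c l) =
        ∑ i, ∑ j, B0 i j * r (c i) (c j) + ∑ j, B j j * r (c j) (c j) := by
      rw [← Finset.sum_add_distrib]
      refine Finset.sum_congr rfl fun j _ => ?_
      have h3 : ∀ l, B j l * r (c j) (c l) = B0 j l * r (c j) (c l) +
          if j = l then B j l * r (c j) (c l) else 0 := by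
        intro l
        by_cases hjl : j = l <;> simp [B0, hjl]
      rw [Finset.sum_congr rfl (fun l _ => h3 l), Finset.sum_add_distrib]
      simp
    have h4 : ∑ j, B j j * (r (c j) (c j) - G) = ∑ j, B j j * r (c j) (c j) - G := by
      simp only [mul_sub]
      rw [Finset.sum_sub_distrib, ← Finset.sum_mul, hBtr, one_mul]
    change 2 * ∑ j, ∑ l, B j l * r (c j) (c l) + 3 * ∑ j, β j * s (c j) + _ - _ = _
    rw [h2, h4]
    ring
  have hBdiag : ∑ j, B j j ^ 2 ≤ θ ^ 4 := by
    refine (Finset.sum_le_sum fun j _ => ?_).trans hB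
    exact Finset.single_le_sum (f := fun l => B j l ^ 2) (fun l _ => sq_nonneg _)
      (Finset.mem_univ j)
  have hB0sq : ∑ i, ∑ j, B0 i j ^ 2 ≤ θ ^ 4 := by
    refine (Finset.sum_le_sum fun i _ => Finset.sum_le_sum fun j _ => ?_).trans hB
    by_cases hij : i = j
    · simp only [B0, if_pos hij]; nlinarith [sq_nonneg (B i j)]
    · simp only [B0, if_neg hij]; exact le_rfl
  have hO : prodExp p (fun c : ι → κ => |∑ i, ∑ j, B0 i j * r (c i) (c j)|) ≤
      2 * K ^ 2 * θ ^ 2 := by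
    refine prodExp_abs_le hp0 hp1 _ (by positivity) ?_
    rw [prodExp_quadForm_sq hp1 (fun i j => by
      by_cases hij : i = j
      · simp [B0, hij]
      · simp [B0, hij, Ne.symm hij, hBs i j]) (fun i => by simp [B0]) hrs hr0]
    have h5 : ∑ k, p k * ∑ l, p l * r k l ^ 2 ≤ K ^ 4 :=
      (le_abs_self _).trans (abs_weighted_sum_le hp0 hp1 fun k =>
        abs_weighted_sum_le hp0 hp1 fun l => by
          rw [abs_of_nonneg (sq_nonneg _), ← sq_abs]
          calc |r k l| ^ 2 ≤ (K ^ 2) ^ 2 := pow_le_pow_left₀ (abs_nonneg _) (hrK k l) 2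
            _ = K ^ 4 := by ring)
    calc 2 * (∑ i, ∑ j, B0 i j ^ 2) * ∑ k, p k * ∑ l, p l * r k l ^ 2 ≤ 2 * θ ^ 4 * K ^ 4 := by
          gcongr
          exact Finset.sum_nonneg fun k _ => mul_nonneg (hp0 k)
            (Finset.sum_nonneg fun l _ => mul_nonneg (hp0 l) (sq_nonneg _))
      _ ≤ (2 * K ^ 2 * θ ^ 2) ^ 2 := by
          have : 0 ≤ θ ^ 4 * K ^ 4 := by positivity
          nlinarith
  have hDi : prodExp p (fun c : ι → κ => |∑ j, B j j * (r (c j) (c j) - G)|) ≤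
      2 * K ^ 2 * θ ^ 2 := by
    refine prodExp_abs_le hp0 hp1 _ (by positivity) ?_
    refine (prodExp_sum_moments hp0 hp1 (fun j b => B j j * (r b b - G))
      (fun j => B j j ^ 2 * (2 * K ^ 2) ^ 2) (fun j => ?_) (fun j b => ?_) Finset.univ).1.trans ?_
    · calc ∑ b, p b * (B j j * (r b b - G)) = B j j * (∑ b, p b * r b b - (∑ b, p b) * G) := by
            generalize B j j = x
            rw [Finset.sum_mul, ← Finset.sum_sub_distrib, Finset.mul_sum]
            exact Finset.sum_congr rfl fun b _ => by ring
        _ = 0 := by rw [hrdiag, hp1]; ring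
    · rw [mul_pow]
      refine mul_le_mul_of_nonneg_left ?_ (sq_nonneg _)
      rw [← sq_abs]
      refine pow_le_pow_left₀ (abs_nonneg _) ?_ 2
      exact (abs_sub _ _).trans (by linarith [hrK b b])
    · rw [← Finset.sum_mul]
      calc _ ≤ θ ^ 4 * (2 * K ^ 2) ^ 2 := mul_le_mul_of_nonneg_right hBdiag (by positivity)
        _ = _ := by ring
  have hLi : prodExp p (fun c : ι → κ => |∑ j, β j * s (c j)|) ≤ K ^ 2 * θ := by
    refine prodExp_abs_le hp0 hp1 _ (by positivity) ?_
    refine (prodExp_sum_moments hp0 hp1 (fun j b => β j * s b)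
      (fun j => β j ^ 2 * (K ^ 2) ^ 2) (fun j => ?_) (fun j b => ?_) Finset.univ).1.trans ?_
    · calc ∑ b, p b * (β j * s b) = β j * ∑ b, p b * s b := by
            rw [Finset.mul_sum]; exact Finset.sum_congr rfl fun b _ => by ring
        _ = 0 := by rw [hmean h, mul_zero]
    · rw [mul_pow]
      refine mul_le_mul_of_nonneg_left ?_ (sq_nonneg _)
      rw [← sq_abs]
      exact pow_le_pow_left₀ (abs_nonneg _) (hsK b) 2
    · rw [← Finset.sum_mul]
      calc _ ≤ θ ^ 2 * (K ^ 2) ^ 2 :=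
            mul_le_mul_of_nonneg_right (sum_mulVec_sq_le hDs hα1 hB) (by positivity)
        _ = _ := by ring
  simp only [hdecomp]
  calc prodExp p (fun c : ι → κ => |2 * (∑ i, ∑ j, B0 i j * r (c i) (c j)) +
        2 * (∑ j, B j j * (r (c j) (c j) - G)) + 3 * ∑ j, β j * s (c j)|) ≤
      prodExp p (fun c : ι → κ => 2 * |∑ i, ∑ j, B0 i j * r (c i) (c j)| +
        2 * |∑ j, B j j * (r (c j) (c j) - G)| + 3 * |∑ j, β j * s (c j)|) := by
        refine prodExp_mono hp0 fun c => (abs_add_three _ _ _).trans (le_of_eq ?_)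
        rw [abs_mul, abs_mul, abs_mul]
        norm_num
    _ ≤ 2 * (2 * K ^ 2 * θ ^ 2) + 2 * (2 * K ^ 2 * θ ^ 2) + 3 * (K ^ 2 * θ) := by
        rw [prodExp_add, prodExp_add, prodExp_mul_left, prodExp_mul_left, prodExp_mul_left]
        linarith
    _ ≤ 11 * K ^ 2 * θ := by
        have h8 : θ ^ 2 ≤ θ := by nlinarith
        have := mul_le_mul_of_nonneg_left h8 (by positivity : 0 ≤ K ^ 2)
        linarith

/-- Normal approximation for the sum of a degenerate quadratic form and a linear form in
independent variables. -/
theorem norm_prodExp_quadForm_add_linear_sub_gaussian_le (hp0 : ∀ k, 0 ≤ p k)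
    (hp1 : ∑ k, p k = 1) (hDs : ∀ i j, D i j = D j i) (hD0 : ∀ i, D i i = 0)
    (hD1 : ∑ i, ∑ j, D i j ^ 2 = 1) (hα1 : ∑ i, α i ^ 2 = 1)
    (hg : ∀ k l, g k l = g l k) (hg0 : ∀ l, ∑ k, p k * g k l = 0) (hh0 : ∑ k, p k * h k = 0)
    (hK : 1 ≤ K) (hgK : ∀ k l, |g k l| ≤ K) (hhK : ∀ k, |h k| ≤ K) (hθ : 0 < θ) (hθ1 : θ ≤ 1)
    (hB : ∑ i, ∑ j, (∑ l, D l i * D l j) ^ 2 ≤ θ ^ 4) (hα3 : ∑ i, |α i| ^ 3 ≤ θ) (t : ℝ) :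
    ‖prodExp p (fun c : ι → κ =>
        expChar t (∑ i, ∑ j, D i j * g (c i) (c j) + ∑ i, α i * h (c i))) -
      Complex.exp ((-((2 * ∑ k, p k * ∑ l, p l * g k l ^ 2 + ∑ k, p k * h k ^ 2) * t ^ 2 / 2) : ℝ)
        : ℂ)‖ ≤ |t| * (12 * (14 * K ^ 4 * θ) * t ^ 2 + 11 * K ^ 2 * θ * |t|) := by
  refine norm_prodExp_expChar_sub_gaussian_le (b := fun i c =>
      |∑ j, D i j * g (c i) (c j)| + |α i * h (c i)|)
    (w := fun i c => ∑ j, D i j * g (c i) (c j) + α i * h (c i))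
    (Δ := fun i c => 2 * ∑ j, D i j * g (c i) (c j) + α i * h (c i))
    hp0 hp1 (fun c => Finset.sum_add_distrib.symm) (fun i c k => ?_) (fun i c => ?_)
    (fun i c => abs_add_le _ _) (fun i c => ?_) ?_
    (sum_prodExp_influence_le hp0 hp1 hDs hD0 hD1 hg hg0 hK hgK hhK hθ hθ1 hB hα3)
    (prodExp_condCov_sub_le hp0 hp1 hDs hD0 hD1 hα1 hg hg0 hK hgK hhK hθ hθ1 hB) t
  · have key : ∀ c : ι → κ, ∑ i, ∑ j, D i j * g (c i) (c j) + ∑ i, α i * h (c i) -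
        (2 * ∑ j, D i j * g (c i) (c j) + α i * h (c i)) =
        ∑ j ∈ Finset.univ.erase i, ∑ l ∈ Finset.univ.erase i, D j l * g (c j) (c l) +
        ∑ j ∈ Finset.univ.erase i, α j * h (c j) := by
      intro c
      rw [quadForm_eq_add_remove hDs hD0 hg i c,
        ← Finset.add_sum_erase Finset.univ (fun j => α j * h (c j)) (Finset.mem_univ i)]
      ring
    rw [key, key, removeForm_update]
    congr 1
    refine Finset.sum_congr rfl fun j hj => ?_
    rw [Function.update_of_ne (Finset.ne_of_mem_erase hj)]
  · simp only [mul_add]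
    rw [Finset.sum_add_distrib, rowForm_mean hD0 hg0, zero_add]
    simp only [Function.update_self]
    calc ∑ k, p k * (α i * h k) = α i * ∑ k, p k * h k := by
          rw [Finset.mul_sum]; exact Finset.sum_congr rfl fun k _ => by ring
      _ = 0 := by rw [hh0, mul_zero]
  · refine (abs_add_le _ _).trans ?_
    rw [abs_mul, abs_two]
    linarith [abs_nonneg (α i * h (c i))]
  · refine add_nonneg (mul_nonneg zero_le_two (Finset.sum_nonneg fun k _ => mul_nonneg (hp0 k)
      (Finset.sum_nonneg fun l _ => mul_nonneg (hp0 l) (sq_nonneg _))))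
      (Finset.sum_nonneg fun k _ => mul_nonneg (hp0 k) (sq_nonneg _))

end QuadraticPlusLinear

section PermutationAverages

variable {n : ℕ}

lemma pexp_add (f g : Equiv.Perm (Fin n) → ℝ) :
    pexp n (fun π => f π + g π) = pexp n f + pexp n g := by
  simp [pexp, Finset.sum_add_distrib, add_div]

lemma pexp_sub (f g : Equiv.Perm (Fin n) → ℝ) :
    pexp n (fun π => f π - g π) = pexp n f - pexp n g := by
  simp [pexp, Finset.sum_sub_distrib, sub_div]

lemma pexp_mul_left (a : ℝ) (f : Equiv.Perm (Fin n) → ℝ) :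
    pexp n (fun π => a * f π) = a * pexp n f := by
  simp [pexp, ← Finset.mul_sum, mul_div_assoc]

lemma pexp_sum {σ : Type*} (s : Finset σ) (f : σ → Equiv.Perm (Fin n) → ℝ) :
    pexp n (fun π => ∑ a ∈ s, f a π) = ∑ a ∈ s, pexp n (f a) := by
  simp only [pexp]
  rw [Finset.sum_comm, Finset.sum_div]

lemma pexp_const (a : ℝ) : pexp n (fun _ => a) = a := by
  have : (n.factorial : ℝ) ≠ 0 := by exact_mod_cast n.factorial_ne_zero
  simp [pexp, Fintype.card_perm, this]

lemma pexp_nonneg {f : Equiv.Perm (Fin n) → ℝ} (h : ∀ π, 0 ≤ f π) : 0 ≤ pexp n f :=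
  div_nonneg (Finset.sum_nonneg fun π _ => h π) (by positivity)

lemma pexp_comp_inv (f : Equiv.Perm (Fin n) → ℝ) : pexp n (fun π => f π⁻¹) = pexp n f := by
  unfold pexp
  rw [Fintype.sum_equiv (Equiv.inv (Equiv.Perm (Fin n))) (fun π => f π⁻¹) f fun π => rfl]

lemma pexp_comp_mul_right (τ : Equiv.Perm (Fin n)) (f : Equiv.Perm (Fin n) → ℝ) :
    pexp n (fun π => f (π * τ)) = pexp n f := by
  unfold pexp
  rw [Fintype.sum_equiv (Equiv.mulRight τ) (fun π => f (π * τ)) f fun π => rfl]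

lemma exists_perm_apply_eq {α : Type*} [DecidableEq α] [Fintype α] {k : ℕ} {x y : Fin k → α}
    (hx : Function.Injective x) (hy : Function.Injective y) :
    ∃ τ : Equiv.Perm α, ∀ i, τ (x i) = y i := by
  obtain ⟨τ, hτ⟩ := (Equiv.Perm.isMultiplyPretransitive α k).exists_smul_eq
    (⟨x, hx⟩ : Fin k ↪ α) ⟨y, hy⟩
  exact ⟨τ, fun i => by simpa using congrArg (fun e : Fin k ↪ α => e i) hτ⟩

/-- Second moment of a permuted linear statistic with centered coefficients. -/
lemma pexp_linear_sq_le (hn : 2 ≤ n) (α v : Fin n → ℝ) (hα : ∑ i, α i = 0) :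
    pexp n (fun π => (∑ x, α (π x) * v x) ^ 2) ≤ 2 * (∑ i, α i ^ 2) * (∑ i, v i ^ 2) / n := by
  set F : Fin n → Fin n → ℝ := fun a b => pexp n (fun π => v (π a) * v (π b)) with hF
  have hn0 : (0 : ℝ) < n := by exact_mod_cast (by omega : 0 < n)
  have hinv : ∀ (τ : Equiv.Perm (Fin n)) a b, F (τ a) (τ b) = F a b := fun τ a b =>
    pexp_comp_mul_right τ (fun π => v (π a) * v (π b))
  let e0 : Fin n := ⟨0, by omega⟩
  let e1 : Fin n := ⟨1, by omega⟩
  have he : e0 ≠ e1 := by simp [e0, e1]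
  have hdiag : ∀ a, F a a = F e0 e0 := by
    intro a
    obtain ⟨τ, hτ⟩ := exists_perm_apply_eq (x := ![e0]) (y := ![a])
      (Function.injective_of_subsingleton _) (Function.injective_of_subsingleton _)
    have := hτ 0
    simp only [Matrix.cons_val_zero] at this
    rw [← hinv τ e0 e0, this]
  have hoff : ∀ a b, a ≠ b → F a b = F e0 e1 := by
    intro a b hab
    obtain ⟨τ, hτ⟩ := exists_perm_apply_eq (x := ![e0, e1]) (y := ![a, b])
      (by intro i j; fin_cases i <;> fin_cases j <;> simp [he, he.symm])
      (by intro i j; fin_cases i <;> fin_cases j <;> simp [hab, hab.symm])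
    have h0 := hτ 0
    have h1 := hτ 1
    simp only [Matrix.cons_val_zero, Matrix.cons_val_one] at h0 h1
    rw [← hinv τ e0 e1, h0, h1]
  have hFform : ∀ a b, F a b = F e0 e1 + if a = b then F e0 e0 - F e0 e1 else 0 := by
    intro a b
    by_cases hab : a = b
    · subst hab; simp [hdiag]
    · simp [hab, hoff]
  have hsum : pexp n (fun π => (∑ x, α (π x) * v x) ^ 2) = (F e0 e0 - F e0 e1) * ∑ i, α i ^ 2 := by
    have h1 : ∀ π : Equiv.Perm (Fin n), ∑ x, α (π x) * v x = ∑ a, α a * v (π⁻¹ a) := fun π =>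
      Fintype.sum_equiv π _ _ fun x => by simp
    simp only [h1]
    rw [pexp_comp_inv (fun π => (∑ a, α a * v (π a)) ^ 2)]
    have h2 : ∀ π : Equiv.Perm (Fin n), (∑ a, α a * v (π a)) ^ 2 =
        ∑ a, ∑ b, (α a * α b) * (v (π a) * v (π b)) := by
      intro π
      rw [sq, Finset.sum_mul_sum]
      exact Finset.sum_congr rfl fun a _ => Finset.sum_congr rfl fun b _ => by ring
    simp only [h2, pexp_sum, pexp_mul_left]
    change ∑ a, ∑ b, α a * α b * F a b = _
    have h3 : ∀ a, ∑ b, α a * α b * F a b = (F e0 e0 - F e0 e1) * α a ^ 2 := by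
      intro a
      have : ∀ b, α a * α b * F a b =
          α a * F e0 e1 * α b + if a = b then (F e0 e0 - F e0 e1) * (α a * α b) else 0 := by
        intro b
        rw [hFform a b]
        split_ifs <;> ring
      rw [Finset.sum_congr rfl fun b _ => this b, Finset.sum_add_distrib, ← Finset.mul_sum, hα]
      simp [sq]
    rw [Finset.sum_congr rfl fun a _ => h3 a, ← Finset.mul_sum]
  have hq : -F e0 e1 ≤ F e0 e0 := by
    have h1 : pexp n (fun π => (v (π e0) + v (π e1)) ^ 2) = F e0 e0 + F e1 e1 + 2 * F e0 e1 := by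
      simp only [hF]
      rw [← pexp_mul_left, ← pexp_add, ← pexp_add]
      congr 1; ext π; ring
    have h2 : 0 ≤ pexp n (fun π => (v (π e0) + v (π e1)) ^ 2) := pexp_nonneg fun π => sq_nonneg _
    rw [h1, hdiag e1] at h2
    linarith
  have hn1 : (n : ℝ) * F e0 e0 = ∑ i, v i ^ 2 := by
    have h1 : ∑ a, F a a = n * F e0 e0 := by simp [hdiag]
    rw [← h1]
    simp only [hF]
    rw [← pexp_sum]
    have : ∀ π : Equiv.Perm (Fin n), ∑ a, v (π a) * v (π a) = ∑ i, v i ^ 2 := by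
      intro π
      rw [Equiv.sum_comp π (fun a => v a * v a)]
      exact Finset.sum_congr rfl fun i _ => (sq _).symm
    simp only [this, pexp_const]
  rw [hsum, le_div_iff₀ hn0, ← hn1]
  have hA : 0 ≤ ∑ i, α i ^ 2 := Finset.sum_nonneg fun i _ => sq_nonneg _
  have := mul_le_mul_of_nonneg_right (by linarith : F e0 e0 - F e0 e1 ≤ 2 * F e0 e0)
    (mul_nonneg hA hn0.le)
  linarith

/-- Second moment of a permuted quadratic statistic whose coefficient matrix has zero row sums. -/
lemma pexp_quadForm_sq_le (hn : 4 ≤ n) (D Φ : Fin n → Fin n → ℝ) (hD : ∀ i j, D i j = D j i)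
    (hD0 : ∀ i, D i i = 0) (hDr : ∀ i, ∑ j, D i j = 0) (hΦ : ∀ i j, Φ i j = Φ j i) :
    pexp n (fun π => (∑ x, ∑ y, D (π x) (π y) * Φ x y) ^ 2) ≤
      8 * (∑ i, ∑ j, D i j ^ 2) * (∑ i, ∑ j, Φ i j ^ 2) / (n * (n - 1)) := by
  set F : Fin n → Fin n → Fin n → Fin n → ℝ :=
    fun a b c d => pexp n (fun π => Φ (π a) (π b) * Φ (π c) (π d)) with hF
  have hn0 : (0 : ℝ) < n * (n - 1) := by
    have : (4 : ℝ) ≤ n := by exact_mod_cast hn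
    nlinarith
  have hinv : ∀ (τ : Equiv.Perm (Fin n)) a b c d, F (τ a) (τ b) (τ c) (τ d) = F a b c d :=
    fun τ a b c d => pexp_comp_mul_right τ (fun π => Φ (π a) (π b) * Φ (π c) (π d))
  have hs1 : ∀ a b c d, F a b c d = F b a c d := fun a b c d => by
    simp only [hF]; congr 1; ext π; rw [hΦ (π a)]
  have hs2 : ∀ a b c d, F a b c d = F a b d c := fun a b c d => by
    simp only [hF]; congr 1; ext π; rw [hΦ (π c)]
  let e0 : Fin n := ⟨0, by omega⟩
  let e1 : Fin n := ⟨1, by omega⟩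
  let e2 : Fin n := ⟨2, by omega⟩
  let e3 : Fin n := ⟨3, by omega⟩
  set q2 := F e0 e1 e0 e1 with hq2
  set q3 := F e0 e1 e0 e2 with hq3
  set q4 := F e0 e1 e2 e3 with hq4
  have h2 : ∀ a b, a ≠ b → F a b a b = q2 := by
    intro a b hab
    obtain ⟨τ, hτ⟩ := exists_perm_apply_eq (x := ![e0, e1]) (y := ![a, b])
      (by intro i j; fin_cases i <;> fin_cases j <;> simp [e0, e1])
      (by intro i j; fin_cases i <;> fin_cases j <;> simp [hab, hab.symm])
    have h0 := hτ 0
    have h1 := hτ 1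
    simp only [Matrix.cons_val_zero, Matrix.cons_val_one] at h0 h1
    rw [hq2, ← hinv τ e0 e1, h0, h1]
  have h3 : ∀ a b d, a ≠ b → a ≠ d → b ≠ d → F a b a d = q3 := by
    intro a b d hab had hbd
    obtain ⟨τ, hτ⟩ := exists_perm_apply_eq (x := ![e0, e1, e2]) (y := ![a, b, d])
      (by intro i j; fin_cases i <;> fin_cases j <;> simp [e0, e1, e2])
      (by intro i j; fin_cases i <;> fin_cases j <;>
            simp [hab, hab.symm, had, had.symm, hbd, hbd.symm])
    have h0 := hτ 0
    have h1 := hτ 1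
    have h2 := hτ 2
    simp only [Matrix.cons_val_zero, Matrix.cons_val_one, Matrix.cons_val] at h0 h1 h2
    rw [hq3, ← hinv τ e0 e1, h0, h1, h2]
  have h4 : ∀ a b c d, a ≠ b → a ≠ c → a ≠ d → b ≠ c → b ≠ d → c ≠ d → F a b c d = q4 := by
    intro a b c d hab hac had hbc hbd hcd
    obtain ⟨τ, hτ⟩ := exists_perm_apply_eq (x := ![e0, e1, e2, e3]) (y := ![a, b, c, d])
      (by intro i j; fin_cases i <;> fin_cases j <;> simp [e0, e1, e2, e3])
      (by intro i j; fin_cases i <;> fin_cases j <;>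
            simp [hab, hab.symm, hac, hac.symm, had, had.symm, hbc, hbc.symm, hbd, hbd.symm,
              hcd, hcd.symm])
    have h0 := hτ 0
    have h1 := hτ 1
    have h2 := hτ 2
    have h3 := hτ 3
    simp only [Matrix.cons_val_zero, Matrix.cons_val_one, Matrix.cons_val] at h0 h1 h2 h3
    rw [hq4, ← hinv τ e0 e1, h0, h1, h2, h3]
  have hFform : ∀ a b c d, a ≠ b → c ≠ d → F a b c d = q4 +
      (q3 - q4) * ((if c = a then 1 else 0) + (if c = b then 1 else 0) + (if d = a then 1 else 0) +
        (if d = b then 1 else 0)) +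
      (q2 - 2 * q3 + q4) * ((if c = a then (if d = b then 1 else 0) else 0) +
        (if c = b then (if d = a then 1 else 0) else 0)) := by
    intro a b c d hab hcd
    by_cases hca : c = a
    · subst hca
      by_cases hdb : d = b
      · subst hdb
        rw [h2 c d hcd]; simp [hcd, hcd.symm]; ring
      · rw [h3 c b d hab hcd (Ne.symm hdb)]
        simp [hab, hcd.symm, hdb]
    · by_cases hcb : c = b
      · subst hcb
        by_cases hda : d = a
        · subst hda
          rw [hs2, h2 d c hab]; simp [hab, hab.symm]; ring
        · rw [hs1, h3 c a d hab.symm hcd (Ne.symm hda)]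
          simp [hab.symm, hcd.symm, hda]
      · by_cases hda : d = a
        · subst hda
          rw [hs2, h3 d b c hab (Ne.symm hca) (Ne.symm hcb)]
          simp [hca, hcb, hab]
        · by_cases hdb : d = b
          · subst hdb
            rw [hs1, hs2, h3 d a c hab.symm (Ne.symm hcb) (Ne.symm hca)]
            simp [hca, hcb, hab.symm]
          · rw [h4 a b c d hab (Ne.symm hca) (Ne.symm hda) (Ne.symm hcb) (Ne.symm hdb) hcd]
            simp [hca, hcb, hda, hdb]
  have hDc : ∀ j, ∑ i, D i j = 0 := fun j => by
    rw [← hDr j]; exact Finset.sum_congr rfl fun i _ => hD i j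
  have hsum : pexp n (fun π => (∑ x, ∑ y, D (π x) (π y) * Φ x y) ^ 2) =
      2 * (q2 - 2 * q3 + q4) * ∑ i, ∑ j, D i j ^ 2 := by
    have e1 : ∀ π : Equiv.Perm (Fin n), ∑ x, ∑ y, D (π x) (π y) * Φ x y =
        ∑ a, ∑ b, D a b * Φ (π⁻¹ a) (π⁻¹ b) := fun π =>
      Fintype.sum_equiv π _ _ fun x => Fintype.sum_equiv π _ _ fun y => by simp
    simp only [e1]
    rw [pexp_comp_inv (fun π => (∑ a, ∑ b, D a b * Φ (π a) (π b)) ^ 2)]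
    have e2 : ∀ π : Equiv.Perm (Fin n), (∑ a, ∑ b, D a b * Φ (π a) (π b)) ^ 2 =
        ∑ a, ∑ b, ∑ c, ∑ d, (D a b * D c d) * (Φ (π a) (π b) * Φ (π c) (π d)) := by
      intro π
      rw [sq, Finset.sum_mul]
      refine Finset.sum_congr rfl fun a _ => ?_
      rw [Finset.sum_mul]
      refine Finset.sum_congr rfl fun b _ => ?_
      rw [Finset.mul_sum]
      refine Finset.sum_congr rfl fun c _ => ?_
      rw [Finset.mul_sum]
      exact Finset.sum_congr rfl fun d _ => by ring
    simp only [e2, pexp_sum, pexp_mul_left]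
    change ∑ a, ∑ b, ∑ c, ∑ d, D a b * D c d * F a b c d = _
    rw [Finset.mul_sum]
    refine Finset.sum_congr rfl fun a _ => ?_
    rw [Finset.mul_sum]
    refine Finset.sum_congr rfl fun b _ => ?_
    by_cases hab : a = b
    · subst hab; simp [hD0]
    have e3 : ∀ c d, D a b * D c d * F a b c d = D a b * (q4 * D c d +
        (q3 - q4) * ((if c = a then D c d else 0) + (if c = b then D c d else 0) +
          (if d = a then D c d else 0) + (if d = b then D c d else 0)) +
        (q2 - 2 * q3 + q4) * ((if c = a then (if d = b then D c d else 0) else 0) +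
          (if c = b then (if d = a then D c d else 0) else 0))) := by
      intro c d
      by_cases hcd : c = d
      · subst hcd; simp [hD0]
      rw [hFform a b c d hab hcd, mul_assoc]
      congr 1
      simp only [mul_add, add_mul, mul_ite, mul_one, mul_zero]
      congr 1
      · congr 1
        · ring
        · simp only [mul_comm (D c d)]
      · simp only [mul_comm (D c d)]
    simp only [e3, ← Finset.mul_sum, Finset.sum_add_distrib, hDr]
    simp [hDr, hDc, hD b a]
    ring
  have hq2a : ∀ a b, a ≠ b → pexp n (fun π => Φ (π a) (π b) ^ 2) = q2 := by
    intro a b hab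
    rw [← h2 a b hab]
    simp only [hF, sq]
  have he01 : e0 ≠ e1 := by simp [e0, e1]
  have he02 : e0 ≠ e2 := by simp [e0, e2]
  have he23 : e2 ≠ e3 := by simp [e2, e3]
  have hb3 : 0 ≤ 2 * q2 + 2 * q3 := by
    have : 0 ≤ pexp n (fun π => (Φ (π e0) (π e1) + Φ (π e0) (π e2)) ^ 2) :=
      pexp_nonneg fun π => sq_nonneg _
    have h : ∀ π : Equiv.Perm (Fin n), (Φ (π e0) (π e1) + Φ (π e0) (π e2)) ^ 2 =
      Φ (π e0) (π e1) ^ 2 + Φ (π e0) (π e2) ^ 2 + 2 * (Φ (π e0) (π e1) * Φ (π e0) (π e2)) :=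
      fun π => by ring
    simp only [h, pexp_add, pexp_mul_left, hq2a e0 e1 he01, hq2a e0 e2 he02] at this
    change 0 ≤ q2 + q2 + 2 * q3 at this
    linarith
  have hb4 : 0 ≤ 2 * q2 - 2 * q4 := by
    have : 0 ≤ pexp n (fun π => (Φ (π e0) (π e1) - Φ (π e2) (π e3)) ^ 2) :=
      pexp_nonneg fun π => sq_nonneg _
    have h : ∀ π : Equiv.Perm (Fin n), (Φ (π e0) (π e1) - Φ (π e2) (π e3)) ^ 2 =
      Φ (π e0) (π e1) ^ 2 + Φ (π e2) (π e3) ^ 2 - 2 * (Φ (π e0) (π e1) * Φ (π e2) (π e3)) :=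
      fun π => by ring
    simp only [h, pexp_add, pexp_sub, pexp_mul_left, hq2a e0 e1 he01, hq2a e2 e3 he23] at this
    change 0 ≤ q2 + q2 - 2 * q4 at this
    linarith
  have hnq : (n * (n - 1) : ℝ) * q2 ≤ ∑ i, ∑ j, Φ i j ^ 2 := by
    have e1 : ∑ a : Fin n, ∑ b ∈ Finset.univ.erase a, pexp n (fun π => Φ (π a) (π b) ^ 2) =
        n * (n - 1) * q2 := by
      have : ∀ a : Fin n, ∑ b ∈ Finset.univ.erase a, pexp n (fun π => Φ (π a) (π b) ^ 2) =
          (n - 1) * q2 := by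
        intro a
        rw [Finset.sum_congr rfl fun b hb => hq2a a b (Finset.ne_of_mem_erase hb).symm]
        rw [Finset.sum_const, Finset.card_erase_of_mem (Finset.mem_univ a), Finset.card_univ,
          Fintype.card_fin, nsmul_eq_mul, Nat.cast_sub (by omega), Nat.cast_one]
      rw [Finset.sum_congr rfl fun a _ => this a]
      simp; ring
    rw [← e1]
    calc ∑ a : Fin n, ∑ b ∈ Finset.univ.erase a, pexp n (fun π => Φ (π a) (π b) ^ 2) ≤
        ∑ a : Fin n, ∑ b, pexp n (fun π => Φ (π a) (π b) ^ 2) :=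
          Finset.sum_le_sum fun a _ => Finset.sum_le_sum_of_subset_of_nonneg
            (Finset.erase_subset _ _) fun b _ _ => pexp_nonneg fun π => sq_nonneg _
      _ = pexp n (fun π => ∑ a, ∑ b, Φ (π a) (π b) ^ 2) := by simp only [pexp_sum]
      _ = ∑ i, ∑ j, Φ i j ^ 2 := by
          have : ∀ π : Equiv.Perm (Fin n), ∑ a, ∑ b, Φ (π a) (π b) ^ 2 = ∑ i, ∑ j, Φ i j ^ 2 :=
            fun π => Fintype.sum_equiv π _ _ fun x => Fintype.sum_equiv π _ _ fun y => rfl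
          simp only [this, pexp_const]
  rw [hsum, le_div_iff₀ hn0]
  have hA : 0 ≤ ∑ i, ∑ j, D i j ^ 2 :=
    Finset.sum_nonneg fun i _ => Finset.sum_nonneg fun j _ => sq_nonneg _
  calc 2 * (q2 - 2 * q3 + q4) * (∑ i, ∑ j, D i j ^ 2) * (n * (n - 1)) ≤
      2 * (4 * q2) * (∑ i, ∑ j, D i j ^ 2) * (n * (n - 1)) := by
        gcongr; linarith
    _ = 8 * (∑ i, ∑ j, D i j ^ 2) * ((n * (n - 1)) * q2) := by ring
    _ ≤ _ := mul_le_mul_of_nonneg_left hnq (by positivity)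

end PermutationAverages

section WeightedSums

variable {Ω : Type*} [Fintype Ω] {w : Ω → ℝ}

lemma sq_weighted_sum_mul_le (hw : ∀ ω, 0 ≤ w ω) (f g : Ω → ℝ) :
    (∑ ω, w ω * (f ω * g ω)) ^ 2 ≤ (∑ ω, w ω * f ω ^ 2) * ∑ ω, w ω * g ω ^ 2 := by
  have h := Finset.sum_mul_sq_le_sq_mul_sq Finset.univ (fun ω => Real.sqrt (w ω) * f ω)
    (fun ω => Real.sqrt (w ω) * g ω)
  have e : ∀ x y : Ω → ℝ, ∀ ω, Real.sqrt (w ω) * x ω * (Real.sqrt (w ω) * y ω) =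
      w ω * (x ω * y ω) := by
    intro x y ω
    calc Real.sqrt (w ω) * x ω * (Real.sqrt (w ω) * y ω)
        = Real.sqrt (w ω) * Real.sqrt (w ω) * (x ω * y ω) := by ring
      _ = _ := by rw [Real.mul_self_sqrt (hw ω)]
  simp only [e, mul_pow, Real.sq_sqrt (hw _)] at h
  exact h

lemma weighted_sum_abs_le_sqrt (hw : ∀ ω, 0 ≤ w ω) (hw1 : ∑ ω, w ω = 1) (f : Ω → ℝ) :
    ∑ ω, w ω * |f ω| ≤ Real.sqrt (∑ ω, w ω * f ω ^ 2) := by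
  refine Real.le_sqrt_of_sq_le ?_
  have h := sq_weighted_sum_mul_le hw (fun ω => |f ω|) (fun _ => 1)
  simpa [hw1] using h

/-- Standardized variables are close in mean square when the variables are. -/
lemma weighted_sum_standardized_sub_sq_le (hw : ∀ ω, 0 ≤ w ω) (hw1 : ∑ ω, w ω = 1)
    {f g : Ω → ℝ} {μ s v : ℝ} (hμ : ∑ ω, w ω * f ω = μ) (hs : 0 < s) (hv : 0 < v)
    (hfs : ∑ ω, w ω * (f ω - μ) ^ 2 = s ^ 2) (hg : ∑ ω, w ω * g ω = 0)
    (hgv : ∑ ω, w ω * g ω ^ 2 = v ^ 2) :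
    ∑ ω, w ω * ((f ω - μ) / s - g ω / v) ^ 2 ≤ 4 * (∑ ω, w ω * (f ω - g ω) ^ 2) / v ^ 2 := by
  set δ := ∑ ω, w ω * (f ω - g ω) ^ 2
  set e := ∑ ω, w ω * ((f ω - μ) * g ω) with he
  have hfg : δ = s ^ 2 + v ^ 2 - 2 * e + μ ^ 2 := by
    have h1 : ∀ ω, w ω * (f ω - g ω) ^ 2 = w ω * (f ω - μ) ^ 2 + w ω * g ω ^ 2 -
        2 * (w ω * ((f ω - μ) * g ω)) + 2 * μ * (w ω * f ω) - 2 * μ * (w ω * g ω) -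
        μ ^ 2 * w ω := fun ω => by ring
    simp only [δ, h1, Finset.sum_sub_distrib, Finset.sum_add_distrib, ← Finset.mul_sum, hfs, hgv,
      hμ, hg, hw1, ← he]
    ring
  have hcs : e ≤ s * v := by
    have := sq_weighted_sum_mul_le hw (fun ω => f ω - μ) g
    rw [hfs, hgv, ← mul_pow] at this
    exact (abs_le_of_sq_le_sq' this (by positivity)).2
  have h2 : ∑ ω, w ω * ((f ω - μ) / s - g ω / v) ^ 2 = 2 - 2 * e / (s * v) := by
    have h1 : ∀ ω, w ω * ((f ω - μ) / s - g ω / v) ^ 2 = (w ω * (f ω - μ) ^ 2) / s ^ 2 +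
        (w ω * g ω ^ 2) / v ^ 2 - 2 / (s * v) * (w ω * ((f ω - μ) * g ω)) := fun ω => by
      field_simp; ring
    simp only [h1, Finset.sum_sub_distrib, Finset.sum_add_distrib, ← Finset.mul_sum,
      ← Finset.sum_div, hfs, hgv, ← he]
    field_simp
    ring
  rw [h2]
  have h3 : 2 - 2 * e / (s * v) = 2 * (s * v - e) / (s * v) := by field_simp
  rw [h3, div_le_div_iff₀ (by positivity) (by positivity)]
  have h5 : 2 * (s * v - e) ≤ δ := by nlinarith [sq_nonneg (s - v), sq_nonneg μ]
  have h6 : (s - v) ^ 2 ≤ δ := by nlinarith [sq_nonneg μ]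
  have h7 : 0 ≤ s * v - e := by linarith
  by_cases hsv : v ≤ 4 * s
  · have : v ^ 2 ≤ 4 * (s * v) := by nlinarith
    calc 2 * (s * v - e) * v ^ 2 ≤ δ * (4 * (s * v)) :=
          mul_le_mul h5 this (by positivity) (by linarith)
      _ = _ := by ring
  · push Not at hsv
    have h8 : δ = (s - v) ^ 2 + 2 * (s * v - e) + μ ^ 2 := by rw [hfg]; ring
    have h9 : -(s * v) ≤ e := by
      have := sq_weighted_sum_mul_le hw (fun ω => f ω - μ) g
      rw [hfs, hgv, ← mul_pow] at this
      exact (abs_le_of_sq_le_sq' this (by positivity)).1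
    have hp : 0 ≤ μ ^ 2 * (s * v) := by positivity
    have h10 : 0 ≤ (2 * (s * v) - (s * v - e)) * (v * (v - 4 * s)) :=
      mul_nonneg (by linarith) (mul_nonneg hv.le (by linarith))
    have h11 : 0 ≤ s * v * (s ^ 2 + 2 * (s * v)) := by positivity
    rw [h8]
    nlinarith

end WeightedSums

section Coupling

variable {κ : Type*} [Fintype κ] {n : ℕ} {p : κ → ℝ}

/-- The joint law of a uniform permutation and of independent labels. -/
noncomputable def cplWeight (p : κ → ℝ) (ω : Equiv.Perm (Fin n) × (Fin n → κ)) : ℝ :=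
  (n.factorial : ℝ)⁻¹ * ∏ i, p (ω.2 i)

omit [Fintype κ] in
lemma cplWeight_nonneg (hp0 : ∀ k, 0 ≤ p k) (ω : Equiv.Perm (Fin n) × (Fin n → κ)) :
    0 ≤ cplWeight p ω :=
  mul_nonneg (by positivity) (Finset.prod_nonneg fun _ _ => hp0 _)

lemma sum_cplWeight_smul {F : Type*} [AddCommGroup F] [Module ℝ F]
    (f : Equiv.Perm (Fin n) × (Fin n → κ) → F) :
    ∑ ω, cplWeight p ω • f ω =
      (n.factorial : ℝ)⁻¹ • ∑ π : Equiv.Perm (Fin n), prodExp p (fun c => f (π, c)) := by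
  rw [Fintype.sum_prod_type, Finset.smul_sum]
  refine Finset.sum_congr rfl fun π _ => ?_
  rw [prodExp, Finset.smul_sum]
  exact Finset.sum_congr rfl fun c _ => by rw [cplWeight, mul_smul]

lemma sum_cplWeight_smul_fst (hp1 : ∑ k, p k = 1) {F : Type*} [AddCommGroup F] [Module ℝ F]
    (f : Equiv.Perm (Fin n) → F) :
    ∑ ω : Equiv.Perm (Fin n) × (Fin n → κ), cplWeight p ω • f ω.1 =
      (n.factorial : ℝ)⁻¹ • ∑ π : Equiv.Perm (Fin n), f π := by
  rw [sum_cplWeight_smul]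
  simp only [prodExp_const p hp1]

lemma sum_cplWeight_mul_fst (hp1 : ∑ k, p k = 1) (f : Equiv.Perm (Fin n) → ℝ) :
    ∑ ω : Equiv.Perm (Fin n) × (Fin n → κ), cplWeight p ω * f ω.1 = pexp n f := by
  have := sum_cplWeight_smul_fst hp1 f
  simp only [smul_eq_mul] at this
  rw [this, pexp, div_eq_inv_mul]

lemma sum_cplWeight (hp1 : ∑ k, p k = 1) :
    ∑ ω : Equiv.Perm (Fin n) × (Fin n → κ), cplWeight p ω = 1 := by
  simpa [pexp_const] using sum_cplWeight_mul_fst (n := n) hp1 (fun _ => 1)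

lemma sum_cplWeight_mul_eq_prodExp_pexp (f : Equiv.Perm (Fin n) × (Fin n → κ) → ℝ) :
    ∑ ω, cplWeight p ω * f ω = prodExp p (fun c => pexp n (fun π => f (π, c))) := by
  rw [Fintype.sum_prod_type, Finset.sum_comm, prodExp]
  refine Finset.sum_congr rfl fun c _ => ?_
  rw [smul_eq_mul, pexp, div_eq_inv_mul, Finset.mul_sum, Finset.mul_sum]
  exact Finset.sum_congr rfl fun π _ => by rw [cplWeight]; ring

variable [LinearOrder κ]

/-- The labels rearranged so that the permutation lists the indices by increasing label. -/
def sortedLabel (ω : Equiv.Perm (Fin n) × (Fin n → κ)) : Fin n → κ :=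
  ω.2 ∘ (Tuple.sort ω.2 * ω.1⁻¹ : Equiv.Perm (Fin n))

omit [Fintype κ] in
lemma sortedLabel_apply (π : Equiv.Perm (Fin n)) (c : Fin n → κ) (x : Fin n) :
    sortedLabel (π, c) (π x) = c (Tuple.sort c x) := by
  simp [sortedLabel]

lemma sum_cplWeight_smul_sortedLabel {F : Type*} [AddCommGroup F] [Module ℝ F]
    (G : (Fin n → κ) → F) :
    ∑ ω : Equiv.Perm (Fin n) × (Fin n → κ), cplWeight p ω • G (sortedLabel ω) = prodExp p G := by
  have h1 : ∀ c : Fin n → κ, ∑ π : Equiv.Perm (Fin n), G (sortedLabel (π, c)) =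
      ∑ τ : Equiv.Perm (Fin n), G (c ∘ τ) := fun c =>
    Fintype.sum_equiv ((Equiv.inv _).trans (Equiv.mulLeft (Tuple.sort c))) _ _ fun π => rfl
  have hn : (n.factorial : ℝ) ≠ 0 := by exact_mod_cast n.factorial_ne_zero
  calc ∑ ω : Equiv.Perm (Fin n) × (Fin n → κ), cplWeight p ω • G (sortedLabel ω)
      = ∑ c : Fin n → κ, ((n.factorial : ℝ)⁻¹ * ∏ i, p (c i)) •
          ∑ π : Equiv.Perm (Fin n), G (sortedLabel (π, c)) := by
        rw [Fintype.sum_prod_type, Finset.sum_comm]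
        exact Finset.sum_congr rfl fun c _ => by rw [Finset.smul_sum]; rfl
    _ = (n.factorial : ℝ)⁻¹ • ∑ τ : Equiv.Perm (Fin n), prodExp p (fun c => G (c ∘ τ)) := by
        simp only [h1, prodExp]
        rw [Finset.sum_comm, Finset.smul_sum]
        refine Finset.sum_congr rfl fun c _ => ?_
        rw [mul_smul, Finset.smul_sum]
    _ = prodExp p G := by
        simp only [prodExp_comp_perm]
        rw [Finset.sum_const, Finset.card_univ, Fintype.card_perm, Fintype.card_fin,
          ← Nat.cast_smul_eq_nsmul ℝ, smul_smul, inv_mul_cancel₀ hn, one_smul]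

lemma sum_cplWeight_mul_sortedLabel (G : (Fin n → κ) → ℝ) :
    ∑ ω : Equiv.Perm (Fin n) × (Fin n → κ), cplWeight p ω * G (sortedLabel ω) = prodExp p G :=
  sum_cplWeight_smul_sortedLabel G

/-- The indicator of the first `t` positions. -/
def firstInd (n t : ℕ) (x : Fin n) : ℝ := if (x : ℕ) < t then 1 else 0

lemma sum_firstInd {t : ℕ} (ht : t ≤ n) : ∑ x, firstInd n t x = t := by
  simp only [firstInd]
  rw [Fin.sum_univ_eq_sum_range (fun i => if i < t then (1 : ℝ) else 0) n, Finset.sum_boole]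
  congr 1
  rw [show (Finset.range n).filter (fun i => i < t) = Finset.range t by
    ext i; simp; omega, Finset.card_range]

lemma sum_abs_sub_eq_of_antitone {χ ξ : Fin n → ℝ} (hχ : Antitone χ) (hξ : Antitone ξ)
    (hχ2 : ∀ x, χ x = 0 ∨ χ x = 1) (hξ2 : ∀ x, ξ x = 0 ∨ ξ x = 1) :
    ∑ x, |χ x - ξ x| = |∑ x, χ x - ∑ x, ξ x| := by
  rw [← Finset.sum_sub_distrib]
  by_cases h : ∃ x, χ x = 1 ∧ ξ x = 0
  · obtain ⟨x, hx1, hx0⟩ := h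
    have : ∀ y, 0 ≤ χ y - ξ y := by
      intro y
      rcases le_total y x with hyx | hyx
      · have := hχ hyx
        rcases hχ2 y with h1 | h1 <;> rcases hξ2 y with h2 | h2 <;> linarith
      · have := hξ hyx
        rcases hχ2 y with h1 | h1 <;> rcases hξ2 y with h2 | h2 <;> linarith
    rw [abs_of_nonneg (Finset.sum_nonneg fun y _ => this y)]
    exact Finset.sum_congr rfl fun y _ => abs_of_nonneg (this y)
  · push Not at h
    have : ∀ y, χ y - ξ y ≤ 0 := by
      intro y
      rcases hχ2 y with h1 | h1 <;> rcases hξ2 y with h2 | h2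
      · rw [h1, h2]; norm_num
      · rw [h1, h2]; norm_num
      · exact absurd h2 (h y h1)
      · rw [h1, h2]; norm_num
    rw [abs_of_nonpos (Finset.sum_nonpos fun y _ => this y), ← Finset.sum_neg_distrib]
    exact Finset.sum_congr rfl fun y _ => abs_of_nonpos (this y)

omit [Fintype κ] in
lemma sum_abs_firstInd_sub (q : κ → ℝ) (hq : Antitone q) (hq2 : ∀ k, q k = 0 ∨ q k = 1) {t : ℕ}
    (ht : t ≤ n) (c : Fin n → κ) :
    ∑ x, |firstInd n t x - q (c (Tuple.sort c x))| = |t - ∑ i, q (c i)| := by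
  rw [sum_abs_sub_eq_of_antitone, sum_firstInd ht, Equiv.sum_comp (Tuple.sort c) (fun i => q (c i))]
  · intro x y hxy
    have : (x : ℕ) ≤ y := hxy
    simp only [firstInd]
    split_ifs <;> first | omega | norm_num
  · exact fun x y hxy => hq (Tuple.monotone_sort c hxy)
  · intro x; simp only [firstInd]; split_ifs <;> simp
  · exact fun x => hq2 _

omit [LinearOrder κ] in
/-- The expected discrepancy between a deterministic and a random number of labels. -/
lemma prodExp_abs_count_sub_le (hp0 : ∀ k, 0 ≤ p k) (hp1 : ∑ k, p k = 1) (q : κ → ℝ)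
    (hq2 : ∀ k, q k = 0 ∨ q k = 1) {u : ℝ} (hu0 : 0 ≤ u) (hu1 : u ≤ 1) (hu : ∑ k, p k * q k = u) :
    prodExp p (fun c : Fin n → κ => |(⌊(n : ℝ) * u⌋₊ : ℝ) - ∑ i, q (c i)|) ≤
      Real.sqrt n + 1 := by
  have h1 : prodExp p (fun c : Fin n → κ => |∑ i, (q (c i) - u)|) ≤ Real.sqrt n := by
    refine prodExp_abs_le hp0 hp1 _ (Real.sqrt_nonneg _) ?_
    rw [Real.sq_sqrt (by positivity)]
    refine (prodExp_sum_moments hp0 hp1 (fun _ k => q k - u) (fun _ => 1) (fun j => ?_)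
      (fun j k => ?_) Finset.univ).1.trans (by simp)
    · simp only [mul_sub, Finset.sum_sub_distrib, hu, ← Finset.sum_mul, hp1]; ring
    · rcases hq2 k with h | h <;> rw [h] <;> nlinarith
  have h2 : |(⌊(n : ℝ) * u⌋₊ : ℝ) - n * u| ≤ 1 := by
    have ha := Nat.floor_le (mul_nonneg (Nat.cast_nonneg (α := ℝ) n) hu0)
    have hb := Nat.lt_floor_add_one ((n : ℝ) * u)
    rw [abs_le]; constructor <;> linarith
  calc prodExp p (fun c : Fin n → κ => |(⌊(n : ℝ) * u⌋₊ : ℝ) - ∑ i, q (c i)|) ≤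
      prodExp p (fun c : Fin n → κ => |∑ i, (q (c i) - u)| + 1) := by
        refine prodExp_mono hp0 fun c => ?_
        have : (⌊(n : ℝ) * u⌋₊ : ℝ) - ∑ i, q (c i) =
            ((⌊(n : ℝ) * u⌋₊ : ℝ) - n * u) - ∑ i, (q (c i) - u) := by
          simp [Finset.sum_sub_distrib]
        rw [this]
        refine (abs_sub _ _).trans ?_
        linarith
    _ ≤ _ := by rw [prodExp_add, prodExp_const p hp1]; linarith

lemma quadForm_sub_const {D : Fin n → Fin n → ℝ} (hDs : ∀ i j, D i j = D j i)
    (hDr : ∀ i, ∑ j, D i j = 0) (y : Fin n → ℝ) (u : ℝ) :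
    ∑ i, ∑ j, D i j * ((y i - u) * (y j - u)) = ∑ i, ∑ j, D i j * (y i * y j) := by
  have hDc : ∀ j, ∑ i, D i j = 0 := fun j => by
    rw [← hDr j]; exact Finset.sum_congr rfl fun i _ => hDs i j
  have h : ∀ i j, D i j * ((y i - u) * (y j - u)) =
      D i j * (y i * y j) - u * y i * D i j + (u ^ 2 * D i j - u * (D i j * y j)) := fun i j => by
    ring
  simp only [h, Finset.sum_sub_distrib, Finset.sum_add_distrib, ← Finset.mul_sum, hDr]
  rw [Finset.sum_comm (f := fun i j => D i j * y j)]
  simp [← Finset.sum_mul, hDc]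

/-- The quadratic statistic of the permutation is close to that of the sorted labels. -/
lemma sum_cplWeight_quadForm_sub_sq_le (hn : 4 ≤ n) (hp0 : ∀ k, 0 ≤ p k) (hp1 : ∑ k, p k = 1)
    {D : Fin n → Fin n → ℝ} (hDs : ∀ i j, D i j = D j i) (hD0 : ∀ i, D i i = 0)
    (hDr : ∀ i, ∑ j, D i j = 0) (hD1 : ∑ i, ∑ j, D i j ^ 2 = 1)
    (q : κ → ℝ) (hq : Antitone q) (hq2 : ∀ k, q k = 0 ∨ q k = 1) {u : ℝ} (hu0 : 0 ≤ u)
    (hu1 : u ≤ 1) (hu : ∑ k, p k * q k = u) :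
    ∑ ω : Equiv.Perm (Fin n) × (Fin n → κ), cplWeight p ω *
      (∑ x, ∑ y, D (ω.1 x) (ω.1 y) *
          (firstInd n ⌊(n : ℝ) * u⌋₊ x * firstInd n ⌊(n : ℝ) * u⌋₊ y) -
        ∑ i, ∑ j, D i j * ((q (sortedLabel ω i) - u) * (q (sortedLabel ω j) - u))) ^ 2 ≤
      16 * (Real.sqrt n + 1) / (n - 1) := by
  set t := ⌊(n : ℝ) * u⌋₊ with ht
  have htn : t ≤ n := Nat.floor_le_of_le (by nlinarith [Nat.cast_nonneg (α := ℝ) n])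
  have hn0 : (4 : ℝ) ≤ n := by exact_mod_cast hn
  rw [sum_cplWeight_mul_eq_prodExp_pexp]
  have hc : ∀ c : Fin n → κ, pexp n (fun π =>
      (∑ x, ∑ y, D (π x) (π y) * (firstInd n t x * firstInd n t y) -
        ∑ i, ∑ j, D i j * ((q (sortedLabel (π, c) i) - u) * (q (sortedLabel (π, c) j) - u))) ^ 2) ≤
      16 / (n - 1) * |(t : ℝ) - ∑ i, q (c i)| := by
    intro c
    set ξ : Fin n → ℝ := fun x => q (c (Tuple.sort c x)) with hξ
    set χ : Fin n → ℝ := firstInd n t with hχ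
    have h1 : ∀ π : Equiv.Perm (Fin n), ∑ x, ∑ y, D (π x) (π y) * (χ x * χ y) -
        ∑ i, ∑ j, D i j * ((q (sortedLabel (π, c) i) - u) * (q (sortedLabel (π, c) j) - u)) =
        ∑ x, ∑ y, D (π x) (π y) * (χ x * χ y - ξ x * ξ y) := by
      intro π
      rw [quadForm_sub_const hDs hDr (fun i => q (sortedLabel (π, c) i)) u,
        ← Equiv.sum_comp π (fun i => ∑ j, D i j *
          (q (sortedLabel (π, c) i) * q (sortedLabel (π, c) j))), ← Finset.sum_sub_distrib]
      refine Finset.sum_congr rfl fun x _ => ?_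
      rw [← Equiv.sum_comp π (fun j => D (π x) j *
          (q (sortedLabel (π, c) (π x)) * q (sortedLabel (π, c) j))), ← Finset.sum_sub_distrib]
      refine Finset.sum_congr rfl fun y _ => ?_
      rw [sortedLabel_apply, sortedLabel_apply, mul_sub]
    simp only [h1]
    refine (pexp_quadForm_sq_le hn D (fun x y => χ x * χ y - ξ x * ξ y) hDs hD0 hDr
      (fun i j => by ring)).trans ?_
    have h2 : ∑ x, ∑ y, (χ x * χ y - ξ x * ξ y) ^ 2 ≤ 2 * n * |(t : ℝ) - ∑ i, q (c i)| := by
      rw [← sum_abs_firstInd_sub q hq hq2 htn c]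
      calc ∑ x, ∑ y, (χ x * χ y - ξ x * ξ y) ^ 2 ≤ ∑ x, ∑ y, (|χ x - ξ x| + |χ y - ξ y|) := by
            refine Finset.sum_le_sum fun x _ => Finset.sum_le_sum fun y _ => ?_
            have hχ2 : ∀ x, χ x = 0 ∨ χ x = 1 := by
              intro x; simp only [χ, firstInd]; split_ifs <;> simp
            rcases hχ2 x with h1 | h1 <;> rcases hχ2 y with h2 | h2 <;>
              rcases hq2 (c (Tuple.sort c x)) with h3 | h3 <;>
              rcases hq2 (c (Tuple.sort c y)) with h4 | h4 <;>
              simp only [hξ, h1, h2, h3, h4] <;> norm_num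
        _ = _ := by
            simp only [Finset.sum_add_distrib, Finset.sum_const, Finset.card_univ,
              Fintype.card_fin, nsmul_eq_mul, ← Finset.mul_sum]
            change (n : ℝ) * ∑ x, |χ x - ξ x| + n * ∑ x, |χ x - ξ x| = 2 * n * ∑ x, |χ x - ξ x|
            ring
    rw [hD1]
    calc 8 * 1 * (∑ x, ∑ y, (χ x * χ y - ξ x * ξ y) ^ 2) / (n * (n - 1)) ≤
        8 * 1 * (2 * n * |(t : ℝ) - ∑ i, q (c i)|) / (n * (n - 1)) := by
          have : (0 : ℝ) ≤ n * (n - 1) := by nlinarith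
          gcongr
      _ = _ := by
          have : (n : ℝ) - 1 ≠ 0 := by linarith
          have : (n : ℝ) ≠ 0 := by linarith
          field_simp
          ring
  calc _ ≤ prodExp p (fun c : Fin n → κ => 16 / ((n : ℝ) - 1) * |(t : ℝ) - ∑ i, q (c i)|) :=
        prodExp_mono hp0 hc
    _ ≤ 16 / ((n : ℝ) - 1) * (Real.sqrt n + 1) := by
        rw [prodExp_mul_left]
        exact mul_le_mul_of_nonneg_left (prodExp_abs_count_sub_le hp0 hp1 q hq2 hu0 hu1 hu)
          (div_nonneg (by norm_num) (by linarith))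
    _ = _ := by ring

/-- The linear statistic of the permutation is close to that of the sorted labels. -/
lemma sum_cplWeight_linear_sub_sq_le (hn : 4 ≤ n) (hp0 : ∀ k, 0 ≤ p k) (hp1 : ∑ k, p k = 1)
    {α : Fin n → ℝ} (hα0 : ∑ i, α i = 0) (hα1 : ∑ i, α i ^ 2 = 1)
    (q : κ → ℝ) (hq : Antitone q) (hq2 : ∀ k, q k = 0 ∨ q k = 1) {u : ℝ} (hu0 : 0 ≤ u)
    (hu1 : u ≤ 1) (hu : ∑ k, p k * q k = u) :
    ∑ ω : Equiv.Perm (Fin n) × (Fin n → κ), cplWeight p ω *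
      (∑ x, α (ω.1 x) * firstInd n ⌊(n : ℝ) * u⌋₊ x -
        ∑ i, α i * (q (sortedLabel ω i) - u)) ^ 2 ≤ 16 * (Real.sqrt n + 1) / (n - 1) := by
  set t := ⌊(n : ℝ) * u⌋₊ with ht
  have htn : t ≤ n := Nat.floor_le_of_le (by nlinarith [Nat.cast_nonneg (α := ℝ) n])
  have hn0 : (4 : ℝ) ≤ n := by exact_mod_cast hn
  rw [sum_cplWeight_mul_eq_prodExp_pexp]
  have hc : ∀ c : Fin n → κ, pexp n (fun π =>
      (∑ x, α (π x) * firstInd n t x - ∑ i, α i * (q (sortedLabel (π, c) i) - u)) ^ 2) ≤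
      2 / n * |(t : ℝ) - ∑ i, q (c i)| := by
    intro c
    set ξ : Fin n → ℝ := fun x => q (c (Tuple.sort c x)) with hξ
    set χ : Fin n → ℝ := firstInd n t with hχ
    have h1 : ∀ π : Equiv.Perm (Fin n), ∑ x, α (π x) * χ x -
        ∑ i, α i * (q (sortedLabel (π, c) i) - u) = ∑ x, α (π x) * (χ x - ξ x) := by
      intro π
      have h0 : ∑ i, α i * (q (sortedLabel (π, c) i) - u) =
          ∑ i, α i * q (sortedLabel (π, c) i) := by
        simp only [mul_sub, Finset.sum_sub_distrib, ← Finset.sum_mul, hα0]; ring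
      rw [h0, ← Equiv.sum_comp π (fun i => α i * q (sortedLabel (π, c) i)),
        ← Finset.sum_sub_distrib]
      refine Finset.sum_congr rfl fun x _ => ?_
      rw [sortedLabel_apply, mul_sub]
    simp only [h1]
    refine (pexp_linear_sq_le (by omega) α (fun x => χ x - ξ x) hα0).trans ?_
    have h2 : ∑ x, (χ x - ξ x) ^ 2 = |(t : ℝ) - ∑ i, q (c i)| := by
      rw [← sum_abs_firstInd_sub q hq hq2 htn c]
      refine Finset.sum_congr rfl fun x _ => ?_
      have hχ2 : χ x = 0 ∨ χ x = 1 := by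
        simp only [χ, firstInd]; split_ifs <;> simp
      rcases hχ2 with h1 | h1 <;> rcases hq2 (c (Tuple.sort c x)) with h3 | h3 <;>
        simp only [hχ, hξ] at * <;> rw [h1, h3] <;> norm_num
    rw [hα1, h2]
    exact le_of_eq (by ring)
  calc _ ≤ prodExp p (fun c : Fin n → κ => 2 / (n : ℝ) * |(t : ℝ) - ∑ i, q (c i)|) :=
        prodExp_mono hp0 hc
    _ ≤ 2 / (n : ℝ) * (Real.sqrt n + 1) := by
        rw [prodExp_mul_left]
        exact mul_le_mul_of_nonneg_left (prodExp_abs_count_sub_le hp0 hp1 q hq2 hu0 hu1 hu)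
          (by positivity)
    _ ≤ 16 / ((n : ℝ) - 1) * (Real.sqrt n + 1) := by
        refine mul_le_mul_of_nonneg_right ?_ (by positivity)
        rw [div_le_div_iff₀ (by linarith) (by linarith)]
        linarith
    _ = _ := by ring

end Coupling

section Labels

variable {m : ℕ} {u : Fin m → ℝ}

/-- The indicator that a label is at most `s`. -/
def labelInd (s : Fin m) (k : Fin (m + 1)) : ℝ := if (k : ℕ) ≤ s then 1 else 0

lemma labelInd_antitone (s : Fin m) : Antitone (labelInd s) := by
  intro k l hkl
  have : (k : ℕ) ≤ l := hkl
  simp only [labelInd]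
  split_ifs <;> first | omega | norm_num

lemma labelInd_eq_zero_or_one (s : Fin m) (k : Fin (m + 1)) :
    labelInd s k = 0 ∨ labelInd s k = 1 := by
  simp only [labelInd]; split_ifs <;> simp

lemma exists_label_weights (hmono : StrictMono u) (hu0 : ∀ i, 0 < u i) (hu1 : ∀ i, u i < 1) :
    ∃ p : Fin (m + 1) → ℝ, (∀ k, 0 ≤ p k) ∧ ∑ k, p k = 1 ∧
      ∀ s, ∑ k, p k * labelInd s k = u s := by
  set V : ℕ → ℝ := fun j => if j = 0 then 0 else if h : j - 1 < m then u ⟨j - 1, h⟩ else 1 with hV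
  refine ⟨fun k => V (k + 1) - V k, fun k => ?_, ?_, fun s => ?_⟩
  · obtain ⟨k, hk⟩ := k
    simp only [hV, Nat.add_sub_cancel, Nat.succ_ne_zero, if_false, sub_nonneg]
    rcases Nat.eq_zero_or_pos k with rfl | hkpos
    · simp only [if_true]
      split_ifs
      · exact (hu0 _).le
      · exact zero_le_one
    · rw [if_neg (by omega), dif_pos (by omega : k - 1 < m)]
      split_ifs with h
      · exact hmono.monotone (Fin.mk_le_mk.2 (by omega))
      · exact (hu1 _).le
  · rw [Fin.sum_univ_eq_sum_range (fun k => V (k + 1) - V k) (m + 1), Finset.sum_range_sub]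
    simp [hV]
  · simp only [labelInd]
    rw [Fin.sum_univ_eq_sum_range (fun k => (V (k + 1) - V k) * if k ≤ (s : ℕ) then 1 else 0)
      (m + 1)]
    have hsub : Finset.range ((s : ℕ) + 1) ⊆ Finset.range (m + 1) :=
      Finset.range_subset_range.2 (by omega)
    rw [← Finset.sum_subset hsub fun k _ hk => by
      rw [if_neg (by simpa using hk), mul_zero]]
    rw [Finset.sum_congr rfl fun k hk => by
      rw [if_pos (by simpa [Nat.lt_succ_iff] using hk), mul_one], Finset.sum_range_sub]
    simp [hV]

lemma label_cov (hmono : StrictMono u) {p : Fin (m + 1) → ℝ} (hp1 : ∑ k, p k = 1)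
    (hpu : ∀ s, ∑ k, p k * labelInd s k = u s) (s s' : Fin m) :
    ∑ k, p k * ((labelInd s k - u s) * (labelInd s' k - u s')) =
      min (u s) (u s') * (1 - max (u s) (u s')) := by
  have hmain : ∀ s s' : Fin m, s ≤ s' →
      ∑ k, p k * ((labelInd s k - u s) * (labelInd s' k - u s')) = u s * (1 - u s') := by
    intro s s' hss
    have h : ∀ k, p k * ((labelInd s k - u s) * (labelInd s' k - u s')) =
        p k * labelInd s k - u s * (p k * labelInd s' k) - u s' * (p k * labelInd s k) +
          u s * u s' * p k := by
      intro k
      have : labelInd s k * labelInd s' k = labelInd s k := by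
        have : (s : ℕ) ≤ s' := hss
        simp only [labelInd]
        split_ifs <;> first | omega | norm_num
      linear_combination p k * this
    simp only [h, Finset.sum_sub_distrib, Finset.sum_add_distrib, ← Finset.mul_sum, hpu, hp1]
    ring
  rcases le_total s s' with hss | hss
  · rw [hmain s s' hss, min_eq_left (hmono.monotone hss), max_eq_right (hmono.monotone hss)]
  · rw [min_eq_right (hmono.monotone hss), max_eq_left (hmono.monotone hss), ← hmain s' s hss]
    exact Finset.sum_congr rfl fun k _ => by ring

end Labels

section LimitVariance

variable {m : ℕ} {κ : Type*} [Fintype κ] {p : κ → ℝ} {u : Fin m → ℝ} {X : Fin m → κ → ℝ}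

/-- The limiting standard deviations of the two families of statistics. -/
noncomputable def limSd (u : Fin m → ℝ) : Fin m ⊕ Fin m → ℝ :=
  Sum.elim (fun i => Real.sqrt 2 * (u i * (1 - u i))) (fun i => Real.sqrt (u i * (1 - u i)))

lemma limSd_pos (hu0 : ∀ i, 0 < u i) (hu1 : ∀ i, u i < 1) (s : Fin m ⊕ Fin m) : 0 < limSd u s := by
  have h : ∀ i, 0 < u i * (1 - u i) := fun i => mul_pos (hu0 i) (by linarith [hu1 i])
  rcases s with i | i
  · exact mul_pos (by positivity) (h i)
  · exact Real.sqrt_pos.2 (h i)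

/-- The kernel of the limiting quadratic statistic. -/
noncomputable def quadKernel (u : Fin m → ℝ) (X : Fin m → κ → ℝ) (a : Fin m ⊕ Fin m → ℝ)
    (k l : κ) : ℝ :=
  ∑ i, a (Sum.inl i) / limSd u (Sum.inl i) * (X i k * X i l)

/-- The kernel of the limiting linear statistic. -/
noncomputable def linKernel (u : Fin m → ℝ) (X : Fin m → κ → ℝ) (a : Fin m ⊕ Fin m → ℝ)
    (k : κ) : ℝ :=
  ∑ i, a (Sum.inr i) / limSd u (Sum.inr i) * X i k

lemma min_mul_max_form (x y : ℝ) :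
    min x y * (1 - min x y) * (max x y * (1 - max x y)) = x * (1 - x) * (y * (1 - y)) := by
  rcases le_total x y with h | h
  · rw [min_eq_left h, max_eq_right h]
  · rw [min_eq_right h, max_eq_left h]; ring

lemma limit_variance_eq (hu0 : ∀ i, 0 < u i) (hu1 : ∀ i, u i < 1)
    (hcov : ∀ s s', ∑ k, p k * (X s k * X s' k) = min (u s) (u s') * (1 - max (u s) (u s')))
    (a : Fin m ⊕ Fin m → ℝ) :
    2 * ∑ k, p k * ∑ l, p l * quadKernel u X a k l ^ 2 + ∑ k, p k * linKernel u X a k ^ 2 =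
      ∑ i, ∑ j, (a (Sum.inl i) * a (Sum.inl j) * rhoW (u i) (u j)
        + a (Sum.inr i) * a (Sum.inr j) * rhoDiff (u i) (u j)) := by
  have hpos : ∀ i, 0 < u i * (1 - u i) := fun i => mul_pos (hu0 i) (by linarith [hu1 i])
  have hmin : ∀ i j, 0 < min (u i) (u j) := fun i j => lt_min (hu0 i) (hu0 j)
  have hmin1 : ∀ i j, min (u i) (u j) < 1 := fun i j => (min_le_left _ _).trans_lt (hu1 i)
  have hmax1 : ∀ i j, max (u i) (u j) < 1 := fun i j => max_lt (hu1 i) (hu1 j)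
  have hmax : ∀ i j, 0 < max (u i) (u j) := fun i j => (hu0 i).trans_le (le_max_left _ _)
  have h1 : ∑ k, p k * linKernel u X a k ^ 2 =
      ∑ i, ∑ j, a (Sum.inr i) * a (Sum.inr j) * rhoDiff (u i) (u j) := by
    have e : ∀ k, p k * linKernel u X a k ^ 2 = ∑ i, ∑ j,
        a (Sum.inr i) / limSd u (Sum.inr i) * (a (Sum.inr j) / limSd u (Sum.inr j)) *
          (p k * (X i k * X j k)) := by
      intro k
      rw [linKernel, sq, Finset.sum_mul_sum, Finset.mul_sum]
      refine Finset.sum_congr rfl fun i _ => ?_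
      rw [Finset.mul_sum]
      exact Finset.sum_congr rfl fun j _ => by ring
    simp only [e]
    rw [Finset.sum_comm]
    refine Finset.sum_congr rfl fun i _ => ?_
    rw [Finset.sum_comm]
    refine Finset.sum_congr rfl fun j _ => ?_
    rw [← Finset.mul_sum, hcov, rhoDiff, min_mul_max_form, Real.sqrt_mul (hpos i).le]
    simp only [limSd, Sum.elim_inr]
    have := Real.sqrt_pos.2 (hpos i)
    have := Real.sqrt_pos.2 (hpos j)
    field_simp
  have h2 : 2 * ∑ k, p k * ∑ l, p l * quadKernel u X a k l ^ 2 =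
      ∑ i, ∑ j, a (Sum.inl i) * a (Sum.inl j) * rhoW (u i) (u j) := by
    have e : ∀ k l, p k * (p l * quadKernel u X a k l ^ 2) = ∑ i, ∑ j,
        a (Sum.inl i) / limSd u (Sum.inl i) * (a (Sum.inl j) / limSd u (Sum.inl j)) *
          ((p k * (X i k * X j k)) * (p l * (X i l * X j l))) := by
      intro k l
      rw [quadKernel, sq, Finset.sum_mul_sum, Finset.mul_sum, Finset.mul_sum]
      refine Finset.sum_congr rfl fun i _ => ?_
      rw [Finset.mul_sum, Finset.mul_sum]
      exact Finset.sum_congr rfl fun j _ => by ring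
    have e2 : ∑ k, p k * ∑ l, p l * quadKernel u X a k l ^ 2 = ∑ i, ∑ j,
        a (Sum.inl i) / limSd u (Sum.inl i) * (a (Sum.inl j) / limSd u (Sum.inl j)) *
          (min (u i) (u j) * (1 - max (u i) (u j))) ^ 2 := by
      calc ∑ k, p k * ∑ l, p l * quadKernel u X a k l ^ 2
          = ∑ x : κ × κ, ∑ i, ∑ j,
            a (Sum.inl i) / limSd u (Sum.inl i) * (a (Sum.inl j) / limSd u (Sum.inl j)) *
              ((p x.1 * (X i x.1 * X j x.1)) * (p x.2 * (X i x.2 * X j x.2))) := by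
            rw [Fintype.sum_prod_type]
            refine Finset.sum_congr rfl fun k _ => ?_
            rw [Finset.mul_sum]
            exact Finset.sum_congr rfl fun l _ => e k l
        _ = _ := by
            rw [Finset.sum_comm]
            refine Finset.sum_congr rfl fun i _ => ?_
            rw [Finset.sum_comm]
            refine Finset.sum_congr rfl fun j _ => ?_
            rw [← Finset.mul_sum, Fintype.sum_prod_type]
            simp only [← Finset.mul_sum, ← Finset.sum_mul, hcov]
            rw [sq]
    rw [e2, Finset.mul_sum]
    refine Finset.sum_congr rfl fun i _ => ?_
    rw [Finset.mul_sum]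
    refine Finset.sum_congr rfl fun j _ => ?_
    have hw : rhoW (u i) (u j) = (min (u i) (u j) * (1 - max (u i) (u j))) ^ 2 /
        (u i * (1 - u i) * (u j * (1 - u j))) := by
      rw [rhoW, ← min_mul_max_form]
      have := hmin i j
      have := hmax i j
      have : 0 < 1 - max (u i) (u j) := by linarith [hmax1 i j]
      have : 0 < 1 - min (u i) (u j) := by linarith [hmin1 i j]
      field_simp
    rw [hw]
    simp only [limSd, Sum.elim_inl]
    have hi : u i ≠ 0 := (hu0 i).ne'
    have hj : u j ≠ 0 := (hu0 j).ne'
    have hi1 : 1 - u i ≠ 0 := by linarith [hu1 i]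
    have hj1 : 1 - u j ≠ 0 := by linarith [hu1 j]
    have h22 : Real.sqrt 2 ^ 2 = 2 := Real.sq_sqrt (by norm_num)
    have h20 : Real.sqrt 2 ≠ 0 := by positivity
    field_simp
    rw [h22]
    ring
  rw [h1, h2, ← Finset.sum_add_distrib]
  exact Finset.sum_congr rfl fun i _ => Finset.sum_add_distrib.symm

end LimitVariance

section PermutationApproximation

variable {m n : ℕ} {u : Fin m → ℝ} {p : Fin (m + 1) → ℝ} {D : Fin n → Fin n → ℝ} {α : Fin n → ℝ}

/-- The permuted quadratic and linear statistics at the given time fractions. -/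
noncomputable def permStat (u : Fin m → ℝ) (D : Fin n → Fin n → ℝ) (α : Fin n → ℝ)
    (s : Fin m ⊕ Fin m) (π : Equiv.Perm (Fin n)) : ℝ :=
  Sum.elim
    (fun i => ∑ x, ∑ y, D (π x) (π y) *
      (firstInd n ⌊(n : ℝ) * u i⌋₊ x * firstInd n ⌊(n : ℝ) * u i⌋₊ y))
    (fun i => ∑ x, α (π x) * firstInd n ⌊(n : ℝ) * u i⌋₊ x) s

/-- The analogues of the permuted statistics for independent labels. -/
def labelStat (u : Fin m → ℝ) (D : Fin n → Fin n → ℝ) (α : Fin n → ℝ)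
    (s : Fin m ⊕ Fin m) (c : Fin n → Fin (m + 1)) : ℝ :=
  Sum.elim
    (fun i => ∑ x, ∑ y, D x y * ((labelInd i (c x) - u i) * (labelInd i (c y) - u i)))
    (fun i => ∑ x, α x * (labelInd i (c x) - u i)) s

/-- A standardized statistic under the permutation distribution. -/
noncomputable def permStd (f : Equiv.Perm (Fin n) → ℝ) (π : Equiv.Perm (Fin n)) : ℝ :=
  (f π - pexp n f) / Real.sqrt (pvar n f)

lemma label_centered (hp1 : ∑ k, p k = 1) (hpu : ∀ s, ∑ k, p k * labelInd s k = u s) (s : Fin m) :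
    ∑ k, p k * (labelInd s k - u s) = 0 := by
  simp only [mul_sub, Finset.sum_sub_distrib, hpu, ← Finset.sum_mul, hp1]; ring

lemma label_variance (hmono : StrictMono u) (hp1 : ∑ k, p k = 1)
    (hpu : ∀ s, ∑ k, p k * labelInd s k = u s) (s : Fin m) :
    ∑ k, p k * (labelInd s k - u s) ^ 2 = u s * (1 - u s) := by
  simpa [← sq] using label_cov hmono hp1 hpu s s

lemma prodExp_labelStat (hp1 : ∑ k, p k = 1) (hpu : ∀ s, ∑ k, p k * labelInd s k = u s)
    (hD0 : ∀ i, D i i = 0) (s : Fin m ⊕ Fin m) : prodExp p (labelStat u D α s) = 0 := by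
  rcases s with i | i
  · refine prodExp_quadForm hp1 (g := fun k l => (labelInd i k - u i) * (labelInd i l - u i)) hD0
      fun l => ?_
    simp only [← mul_assoc, ← Finset.sum_mul, label_centered hp1 hpu, zero_mul]
  · change prodExp p (fun c : Fin n → Fin (m + 1) => ∑ x, α x * (labelInd i (c x) - u i)) = 0
    rw [prodExp_sum]
    refine Finset.sum_eq_zero fun x _ => prodExp_eq_zero p hp1 x _ fun c => ?_
    simp only [Function.update_self, smul_eq_mul]
    calc ∑ k, p k * (α x * (labelInd i k - u i)) = α x * ∑ k, p k * (labelInd i k - u i) := by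
          rw [Finset.mul_sum]; exact Finset.sum_congr rfl fun k _ => by ring
      _ = 0 := by rw [label_centered hp1 hpu, mul_zero]

lemma prodExp_labelStat_sq (hmono : StrictMono u) (hu0 : ∀ i, 0 < u i) (hu1 : ∀ i, u i < 1)
    (hp1 : ∑ k, p k = 1) (hpu : ∀ s, ∑ k, p k * labelInd s k = u s)
    (hDs : ∀ i j, D i j = D j i) (hD0 : ∀ i, D i i = 0) (hD1 : ∑ i, ∑ j, D i j ^ 2 = 1)
    (hα1 : ∑ i, α i ^ 2 = 1) (s : Fin m ⊕ Fin m) :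
    prodExp p (fun c => labelStat u D α s c ^ 2) = limSd u s ^ 2 := by
  rcases s with i | i
  · refine (prodExp_quadForm_sq hp1 (g := fun k l => (labelInd i k - u i) * (labelInd i l - u i))
      hDs hD0 (fun k l => mul_comm _ _) fun l => ?_).trans ?_
    · simp only [← mul_assoc, ← Finset.sum_mul, label_centered hp1 hpu, zero_mul]
    · have h : ∀ k l, p l * ((labelInd i k - u i) * (labelInd i l - u i)) ^ 2 =
          (labelInd i k - u i) ^ 2 * (p l * (labelInd i l - u i) ^ 2) := fun k l => by ring
      have e : ∑ k, p k * ∑ l, p l * ((labelInd i k - u i) * (labelInd i l - u i)) ^ 2 =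
          (u i * (1 - u i)) ^ 2 := by
        simp only [h, ← Finset.mul_sum, label_variance hmono hp1 hpu]
        simp only [← mul_assoc, ← Finset.sum_mul, label_variance hmono hp1 hpu]
        ring
      rw [e, hD1]
      simp only [limSd, Sum.elim_inl, mul_pow]
      rw [Real.sq_sqrt (by norm_num)]
      ring
  · refine (prodExp_sum_sq hp1 (fun x k => α x * (labelInd i k - u i)) fun x => ?_).trans ?_
    · calc ∑ k, p k * (α x * (labelInd i k - u i)) = α x * ∑ k, p k * (labelInd i k - u i) := by
            rw [Finset.mul_sum]; exact Finset.sum_congr rfl fun k _ => by ring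
        _ = 0 := by rw [label_centered hp1 hpu, mul_zero]
    · have h : ∀ x k, p k * (α x * (labelInd i k - u i)) ^ 2 =
          α x ^ 2 * (p k * (labelInd i k - u i) ^ 2) := fun k l => by ring
      simp only [h, ← Finset.mul_sum, label_variance hmono hp1 hpu, ← Finset.sum_mul, hα1]
      simp only [limSd, Sum.elim_inr]
      rw [Real.sq_sqrt (mul_pos (hu0 i) (by linarith [hu1 i])).le, one_mul]

lemma sum_cplWeight_permStat_sub_sq_le (hn : 4 ≤ n) (hu0 : ∀ i, 0 < u i) (hu1 : ∀ i, u i < 1)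
    (hp0 : ∀ k, 0 ≤ p k) (hp1 : ∑ k, p k = 1) (hpu : ∀ s, ∑ k, p k * labelInd s k = u s)
    (hDs : ∀ i j, D i j = D j i) (hD0 : ∀ i, D i i = 0)
    (hDr : ∀ i, ∑ j, D i j = 0) (hD1 : ∑ i, ∑ j, D i j ^ 2 = 1)
    (hα0 : ∑ i, α i = 0) (hα1 : ∑ i, α i ^ 2 = 1) (s : Fin m ⊕ Fin m) :
    ∑ ω : Equiv.Perm (Fin n) × (Fin n → Fin (m + 1)), cplWeight p ω *
      (permStat u D α s ω.1 - labelStat u D α s (sortedLabel ω)) ^ 2 ≤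
      16 * (Real.sqrt n + 1) / (n - 1) := by
  rcases s with i | i
  · exact sum_cplWeight_quadForm_sub_sq_le hn hp0 hp1 hDs hD0 hDr hD1 (labelInd i)
      (labelInd_antitone i) (labelInd_eq_zero_or_one i) (hu0 i).le (hu1 i).le (hpu i)
  · exact sum_cplWeight_linear_sub_sq_le hn hp0 hp1 hα0 hα1 (labelInd i)
      (labelInd_antitone i) (labelInd_eq_zero_or_one i) (hu0 i).le (hu1 i).le (hpu i)

lemma sum_cplWeight_permStd_sub_sq_le (hn : 4 ≤ n) (hmono : StrictMono u) (hu0 : ∀ i, 0 < u i)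
    (hu1 : ∀ i, u i < 1)
    (hp0 : ∀ k, 0 ≤ p k) (hp1 : ∑ k, p k = 1) (hpu : ∀ s, ∑ k, p k * labelInd s k = u s)
    (hDs : ∀ i j, D i j = D j i) (hD0 : ∀ i, D i i = 0)
    (hDr : ∀ i, ∑ j, D i j = 0) (hD1 : ∑ i, ∑ j, D i j ^ 2 = 1)
    (hα0 : ∑ i, α i = 0) (hα1 : ∑ i, α i ^ 2 = 1) (s : Fin m ⊕ Fin m)
    (hvar : 0 < pvar n (permStat u D α s)) :
    ∑ ω : Equiv.Perm (Fin n) × (Fin n → Fin (m + 1)), cplWeight p ω *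
      (permStd (permStat u D α s) ω.1 - labelStat u D α s (sortedLabel ω) / limSd u s) ^ 2 ≤
      4 / limSd u s ^ 2 * (16 * (Real.sqrt n + 1) / (n - 1)) := by
  refine (weighted_sum_standardized_sub_sq_le (f := fun ω => permStat u D α s ω.1)
    (g := fun ω => labelStat u D α s (sortedLabel ω)) (cplWeight_nonneg hp0) (sum_cplWeight hp1)
    (sum_cplWeight_mul_fst hp1 _) (Real.sqrt_pos.2 hvar) (limSd_pos hu0 hu1 s) ?_ ?_ ?_).trans ?_
  · rw [Real.sq_sqrt hvar.le]
    exact sum_cplWeight_mul_fst hp1 (fun π => (permStat u D α s π - _) ^ 2)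
  · rw [sum_cplWeight_mul_sortedLabel, prodExp_labelStat hp1 hpu hD0]
  · rw [sum_cplWeight_mul_sortedLabel (fun c => labelStat u D α s c ^ 2),
      prodExp_labelStat_sq hmono hu0 hu1 hp1 hpu hDs hD0 hD1 hα1]
  · rw [div_mul_eq_mul_div]
    have := sum_cplWeight_permStat_sub_sq_le hn hu0 hu1 hp0 hp1 hpu hDs hD0 hDr hD1 hα0 hα1 s
    gcongr

lemma sum_labelStat_eq (a : Fin m ⊕ Fin m → ℝ) (c : Fin n → Fin (m + 1)) :
    ∑ s, a s * (labelStat u D α s c / limSd u s) =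
      ∑ x, ∑ y, D x y * quadKernel u (fun i k => labelInd i k - u i) a (c x) (c y) +
        ∑ x, α x * linKernel u (fun i k => labelInd i k - u i) a (c x) := by
  rw [Fintype.sum_sum_type]
  congr 1
  · simp only [quadKernel, Finset.mul_sum]
    rw [Finset.sum_congr rfl fun x _ => Finset.sum_comm, Finset.sum_comm]
    refine Finset.sum_congr rfl fun i _ => ?_
    simp only [labelStat, Sum.elim_inl]
    rw [Finset.sum_div, Finset.mul_sum]
    refine Finset.sum_congr rfl fun x _ => ?_
    rw [Finset.sum_div, Finset.mul_sum]
    exact Finset.sum_congr rfl fun y _ => by ring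
  · simp only [linKernel, Finset.mul_sum]
    rw [Finset.sum_comm]
    refine Finset.sum_congr rfl fun i _ => ?_
    simp only [labelStat, Sum.elim_inr]
    rw [Finset.sum_div, Finset.mul_sum]
    exact Finset.sum_congr rfl fun x _ => by ring

/-- Quantitative normal approximation for standardized permutation statistics. -/
theorem exists_norm_permStat_charFun_sub_le (hmono : StrictMono u) (hu0 : ∀ i, 0 < u i)
    (hu1 : ∀ i, u i < 1) (a : Fin m ⊕ Fin m → ℝ) :
    ∃ C K : ℝ, ∀ (n : ℕ) (D : Fin n → Fin n → ℝ) (α : Fin n → ℝ) (θ t : ℝ), 4 ≤ n →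
      (∀ i j, D i j = D j i) → (∀ i, D i i = 0) → (∀ i, ∑ j, D i j = 0) →
      ∑ i, ∑ j, D i j ^ 2 = 1 → ∑ i, α i = 0 → ∑ i, α i ^ 2 = 1 →
      (∀ s, 0 < pvar n (permStat u D α s)) → 0 < θ → θ ≤ 1 →
      ∑ i, ∑ j, (∑ l, D l i * D l j) ^ 2 ≤ θ ^ 4 → ∑ i, |α i| ^ 3 ≤ θ →
      ‖(n.factorial : ℝ)⁻¹ • ∑ π : Equiv.Perm (Fin n),
          expChar t (∑ s, a s * permStd (permStat u D α s) π) -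
        Complex.exp ((-((∑ i, ∑ j, (a (Sum.inl i) * a (Sum.inl j) * rhoW (u i) (u j)
          + a (Sum.inr i) * a (Sum.inr j) * rhoDiff (u i) (u j))) * t ^ 2 / 2) : ℝ) : ℂ)‖ ≤
      |t| * Real.sqrt (C * (16 * (Real.sqrt n + 1) / (n - 1))) +
        |t| * (12 * (14 * K ^ 4 * θ) * t ^ 2 + 11 * K ^ 2 * θ * |t|) := by
  obtain ⟨p, hp0, hp1, hpu⟩ := exists_label_weights hmono hu0 hu1
  set X : Fin m → Fin (m + 1) → ℝ := fun i k => labelInd i k - u i with hX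
  have hXc : ∀ i, ∑ k, p k * X i k = 0 := label_centered hp1 hpu
  set K : ℝ := 1 + ∑ k, ∑ l, |quadKernel u X a k l| + ∑ k, |linKernel u X a k| with hKdef
  have hA0 : 0 ≤ ∑ k, ∑ l, |quadKernel u X a k l| :=
    Finset.sum_nonneg fun k _ => Finset.sum_nonneg fun l _ => abs_nonneg _
  have hB0 : 0 ≤ ∑ k, |linKernel u X a k| := Finset.sum_nonneg fun k _ => abs_nonneg _
  have hK : 1 ≤ K := by linarith
  have hgK : ∀ k l, |quadKernel u X a k l| ≤ K := by
    intro k l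
    have h1 := Finset.single_le_sum (f := fun l => |quadKernel u X a k l|)
      (fun l _ => abs_nonneg _) (Finset.mem_univ l)
    have h2 := Finset.single_le_sum (f := fun k => ∑ l, |quadKernel u X a k l|)
      (fun k _ => Finset.sum_nonneg fun l _ => abs_nonneg _) (Finset.mem_univ k)
    linarith
  have hhK : ∀ k, |linKernel u X a k| ≤ K := by
    intro k
    have h1 := Finset.single_le_sum (f := fun k => |linKernel u X a k|)
      (fun l _ => abs_nonneg _) (Finset.mem_univ k)
    linarith
  refine ⟨(∑ s, a s ^ 2) * ∑ s, 4 / limSd u s ^ 2, K, ?_⟩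
  intro n D α θ t hn hDs hD0 hDr hD1 hα0 hα1 hvar hθ hθ1 hB hα3
  have hg : ∀ k l, quadKernel u X a k l = quadKernel u X a l k := fun k l =>
    Finset.sum_congr rfl fun i _ => by ring
  have hg0 : ∀ l, ∑ k, p k * quadKernel u X a k l = 0 := by
    intro l
    simp only [quadKernel, Finset.mul_sum]
    rw [Finset.sum_comm]
    refine Finset.sum_eq_zero fun i _ => ?_
    calc ∑ k, p k * (a (Sum.inl i) / limSd u (Sum.inl i) * (X i k * X i l)) =
        a (Sum.inl i) / limSd u (Sum.inl i) * X i l * ∑ k, p k * X i k := by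
          rw [Finset.mul_sum]; exact Finset.sum_congr rfl fun k _ => by ring
      _ = 0 := by rw [hXc, mul_zero]
  have hh0 : ∑ k, p k * linKernel u X a k = 0 := by
    simp only [linKernel, Finset.mul_sum]
    rw [Finset.sum_comm]
    refine Finset.sum_eq_zero fun i _ => ?_
    calc ∑ k, p k * (a (Sum.inr i) / limSd u (Sum.inr i) * X i k) =
        a (Sum.inr i) / limSd u (Sum.inr i) * ∑ k, p k * X i k := by
          rw [Finset.mul_sum]; exact Finset.sum_congr rfl fun k _ => by ring
      _ = 0 := by rw [hXc, mul_zero]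
  have hclt := norm_prodExp_quadForm_add_linear_sub_gaussian_le hp0 hp1 hDs hD0 hD1 hα1 hg hg0 hh0
    hK hgK hhK hθ hθ1 hB hα3 t
  rw [limit_variance_eq hu0 hu1 (label_cov hmono hp1 hpu) a] at hclt
  simp only [← sum_labelStat_eq, hX] at hclt
  refine (norm_sub_le_norm_sub_add_norm_sub _ (prodExp p (fun c : Fin n → Fin (m + 1) =>
    expChar t (∑ s, a s * (labelStat u D α s c / limSd u s)))) _).trans (add_le_add ?_ hclt)
  rw [← sum_cplWeight_smul_fst hp1, ← sum_cplWeight_smul_sortedLabel, ← Finset.sum_sub_distrib]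
  set Δ : Equiv.Perm (Fin n) × (Fin n → Fin (m + 1)) → ℝ := fun ω =>
    ∑ s, a s * permStd (permStat u D α s) ω.1 -
      ∑ s, a s * (labelStat u D α s (sortedLabel ω) / limSd u s) with hΔ
  calc _ ≤ ∑ ω, cplWeight p ω * (|t| * |Δ ω|) := by
        refine (norm_sum_le _ _).trans (Finset.sum_le_sum fun ω _ => ?_)
        rw [← smul_sub, norm_smul, Real.norm_of_nonneg (cplWeight_nonneg hp0 ω)]
        exact mul_le_mul_of_nonneg_left (norm_expChar_sub_le _ _ _) (cplWeight_nonneg hp0 ω)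
    _ = |t| * ∑ ω, cplWeight p ω * |Δ ω| := by
        rw [Finset.mul_sum]; exact Finset.sum_congr rfl fun ω _ => by ring
    _ ≤ |t| * Real.sqrt (∑ ω, cplWeight p ω * Δ ω ^ 2) :=
        mul_le_mul_of_nonneg_left (weighted_sum_abs_le_sqrt (cplWeight_nonneg hp0)
          (sum_cplWeight hp1) Δ) (abs_nonneg t)
    _ ≤ _ := by
        refine mul_le_mul_of_nonneg_left (Real.sqrt_le_sqrt ?_) (abs_nonneg t)
        calc ∑ ω, cplWeight p ω * Δ ω ^ 2 ≤ ∑ ω, cplWeight p ω * ((∑ s, a s ^ 2) *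
              ∑ s, (permStd (permStat u D α s) ω.1 -
                labelStat u D α s (sortedLabel ω) / limSd u s) ^ 2) := by
              refine Finset.sum_le_sum fun ω _ =>
                mul_le_mul_of_nonneg_left ?_ (cplWeight_nonneg hp0 ω)
              have : Δ ω = ∑ s, a s * (permStd (permStat u D α s) ω.1 -
                  labelStat u D α s (sortedLabel ω) / limSd u s) := by
                simp only [hΔ, mul_sub, Finset.sum_sub_distrib]
              rw [this]
              exact Finset.sum_mul_sq_le_sq_mul_sq _ _ _
          _ = (∑ s, a s ^ 2) * ∑ s, ∑ ω, cplWeight p ω * (permStd (permStat u D α s) ω.1 -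
                labelStat u D α s (sortedLabel ω) / limSd u s) ^ 2 := by
              rw [Finset.sum_comm, Finset.mul_sum]
              refine Finset.sum_congr rfl fun ω _ => ?_
              rw [← Finset.mul_sum]; ring
          _ ≤ (∑ s, a s ^ 2) * ∑ s, 4 / limSd u s ^ 2 * (16 * (Real.sqrt n + 1) / (n - 1)) := by
              refine mul_le_mul_of_nonneg_left (Finset.sum_le_sum fun s _ => ?_)
                (Finset.sum_nonneg fun s _ => sq_nonneg _)
              exact sum_cplWeight_permStd_sub_sq_le hn hmono hu0 hu1 hp0 hp1 hpu hDs hD0 hDr hD1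
                hα0 hα1 s (hvar s)
          _ = _ := by rw [← Finset.sum_mul, mul_assoc]

end PermutationApproximation

section Decomposition

variable {n : ℕ} {R : Fin n → Fin n → ℝ}

/-- The coefficients of the linear part of the kernel `R`. -/
noncomputable def linCoeff (n : ℕ) (R : Fin n → Fin n → ℝ) (i : Fin n) : ℝ :=
  ((n : ℝ) - 1) / (n - 2) * (Rbar n R i - r0 n R)

/-- The degenerate (doubly centered, zero-diagonal) part of the kernel `R`. -/
noncomputable def degKernel (n : ℕ) (R : Fin n → Fin n → ℝ) (i j : Fin n) : ℝ :=
  R i j - (r0 n R + linCoeff n R i + linCoeff n R j) +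
    if i = j then r0 n R + linCoeff n R i + linCoeff n R j else 0

lemma sum_Rbar_sub (hn : 0 < n) : ∑ i, (Rbar n R i - r0 n R) = 0 := by
  have h : (n : ℝ) ≠ 0 := by exact_mod_cast hn.ne'
  rw [Finset.sum_sub_distrib, Finset.sum_const, Finset.card_univ, Fintype.card_fin, nsmul_eq_mul,
    r0, mul_div_cancel₀ _ h, sub_self]

lemma sum_linCoeff (hn : 0 < n) : ∑ i, linCoeff n R i = 0 := by
  simp only [linCoeff, ← Finset.mul_sum, sum_Rbar_sub hn, mul_zero]

lemma degKernel_symm (hs : ∀ i j, R i j = R j i) (i j : Fin n) :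
    degKernel n R i j = degKernel n R j i := by
  simp only [degKernel, hs i j, eq_comm (a := i) (b := j)]
  split_ifs <;> ring

lemma degKernel_self (h0 : ∀ i, R i i = 0) (i : Fin n) : degKernel n R i i = 0 := by
  simp only [degKernel, h0, if_true]
  ring

lemma sum_degKernel (hn : 4 ≤ n) (i : Fin n) : ∑ j, degKernel n R i j = 0 := by
  have h4 : (4 : ℝ) ≤ n := by exact_mod_cast hn
  have hR : ∑ j, R i j = ((n : ℝ) - 1) * Rbar n R i := by
    rw [Rbar, mul_div_cancel₀]; linarith
  have hα : ((n : ℝ) - 2) * linCoeff n R i = ((n : ℝ) - 1) * (Rbar n R i - r0 n R) := by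
    rw [linCoeff, ← mul_assoc, mul_div_cancel₀]; linarith
  simp only [degKernel, Finset.sum_add_distrib, Finset.sum_sub_distrib, hR,
    sum_linCoeff (by omega : 0 < n), Finset.sum_const, Finset.card_univ, Fintype.card_fin,
    nsmul_eq_mul, Finset.sum_ite_eq, Finset.mem_univ, if_true]
  linarith

/-- Expansion of a quadratic form in an indicator vector into its degenerate, linear and
constant parts. -/
lemma sum_kernel_mul_indicator (π : Equiv.Perm (Fin n)) (χ : Fin n → ℝ)
    (hχ : ∀ x, χ x * χ x = χ x) :
    ∑ x, ∑ y, R (π x) (π y) * (χ x * χ y) =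
      ∑ x, ∑ y, degKernel n R (π x) (π y) * (χ x * χ y) +
        r0 n R * ((∑ x, χ x) ^ 2 - ∑ x, χ x) +
        2 * (∑ x, χ x - 1) * ∑ x, linCoeff n R (π x) * χ x := by
  set α := linCoeff n R
  have hd : ∀ x, ∑ y, (if π x = π y then r0 n R + α (π x) + α (π y) else 0) * (χ x * χ y) =
      r0 n R * χ x + 2 * (α (π x) * χ x) := by
    intro x
    simp only [π.injective.eq_iff, ite_mul, zero_mul, Finset.sum_ite_eq, Finset.mem_univ, if_true,
      hχ]
    ring
  have hD : ∀ x y, degKernel n R (π x) (π y) * (χ x * χ y) = R (π x) (π y) * (χ x * χ y) -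
      (r0 n R * χ x * χ y + (α (π x) * χ x) * χ y + χ x * (α (π y) * χ y)) +
        (if π x = π y then r0 n R + α (π x) + α (π y) else 0) * (χ x * χ y) := by
    intro x y; simp only [degKernel, α]; ring
  simp only [hD, Finset.sum_add_distrib, Finset.sum_sub_distrib, hd, ← Finset.mul_sum,
    ← Finset.sum_mul]
  ring

lemma firstInd_mul_self (t : ℕ) (x : Fin n) : firstInd n t x * firstInd n t x = firstInd n t x := by
  simp only [firstInd]; split_ifs <;> simp

lemma U1_eq (π : Equiv.Perm (Fin n)) (t : ℕ) :
    U1 n R π 0 t = ∑ x, ∑ y, R (π x) (π y) * (firstInd n t x * firstInd n t y) := by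
  refine Finset.sum_congr rfl fun x _ => Finset.sum_congr rfl fun y _ => ?_
  by_cases hx : (x : ℕ) < t <;> by_cases hy : (y : ℕ) < t <;> simp [firstInd, hx, hy]

lemma U2_eq (π : Equiv.Perm (Fin n)) (t : ℕ) :
    U2 n R π 0 t =
      ∑ x, ∑ y, R (π x) (π y) * ((1 - firstInd n t x) * (1 - firstInd n t y)) := by
  refine Finset.sum_congr rfl fun x _ => Finset.sum_congr rfl fun y _ => ?_
  by_cases hx : (x : ℕ) < t <;> by_cases hy : (y : ℕ) < t <;>
    simp [firstInd, hx, hy, not_le.2, not_lt.1]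

lemma U1_eq_add (π : Equiv.Perm (Fin n)) {t : ℕ} (ht : t ≤ n) :
    U1 n R π 0 t =
      ∑ x, ∑ y, degKernel n R (π x) (π y) * (firstInd n t x * firstInd n t y) +
        r0 n R * ((t : ℝ) ^ 2 - t) +
        2 * ((t : ℝ) - 1) * ∑ x, linCoeff n R (π x) * firstInd n t x := by
  rw [U1_eq, sum_kernel_mul_indicator π _ (firstInd_mul_self t), sum_firstInd ht]

lemma U2_eq_add (hs : ∀ i j, R i j = R j i) (hn : 4 ≤ n) (π : Equiv.Perm (Fin n)) {t : ℕ}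
    (ht : t ≤ n) :
    U2 n R π 0 t =
      ∑ x, ∑ y, degKernel n R (π x) (π y) * (firstInd n t x * firstInd n t y) +
        r0 n R * (((n : ℝ) - t) ^ 2 - (n - t)) -
        2 * ((n : ℝ) - t - 1) * ∑ x, linCoeff n R (π x) * firstInd n t x := by
  set χ := firstInd n t
  have hχ : ∀ x, (1 - χ x) * (1 - χ x) = 1 - χ x := fun x => by
    have := firstInd_mul_self t x
    simp only [χ]; linarith
  have hsum : ∑ x, (1 - χ x) = (n : ℝ) - t := by
    simp [Finset.sum_sub_distrib, χ, sum_firstInd ht]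
  have hL : ∑ x, linCoeff n R (π x) * (1 - χ x) = -∑ x, linCoeff n R (π x) * χ x := by
    simp only [mul_sub, mul_one, Finset.sum_sub_distrib]
    rw [Equiv.sum_comp π (linCoeff n R), sum_linCoeff (by omega : 0 < n), zero_sub]
  have hr : ∀ x, ∑ y, degKernel n R (π x) (π y) = 0 := fun x => by
    rw [Equiv.sum_comp π (degKernel n R (π x)), sum_degKernel hn]
  have hc : ∑ x, ∑ y, degKernel n R (π x) (π y) * χ y = 0 := by
    rw [Finset.sum_comm]
    refine Finset.sum_eq_zero fun y _ => ?_
    simp only [← Finset.sum_mul, degKernel_symm hs _ (π y), hr, zero_mul]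
  have hS : ∑ x, ∑ y, degKernel n R (π x) (π y) * ((1 - χ x) * (1 - χ y)) =
      ∑ x, ∑ y, degKernel n R (π x) (π y) * (χ x * χ y) := by
    have e : ∀ x y, degKernel n R (π x) (π y) * ((1 - χ x) * (1 - χ y)) =
        degKernel n R (π x) (π y) * (χ x * χ y) + degKernel n R (π x) (π y) * (1 - χ x) -
          degKernel n R (π x) (π y) * χ y := fun x y => by ring
    simp only [e, Finset.sum_sub_distrib, Finset.sum_add_distrib, hc, ← Finset.sum_mul, hr,
      zero_mul, Finset.sum_const_zero]
    ring
  rw [U2_eq, sum_kernel_mul_indicator π _ hχ, hsum, hL, hS]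
  ring

lemma Uw_eq_add (hs : ∀ i j, R i j = R j i) (hn : 4 ≤ n) (π : Equiv.Perm (Fin n)) {t : ℕ}
    (ht : t ≤ n) :
    Uw n R π 0 t =
      ∑ x, ∑ y, degKernel n R (π x) (π y) * (firstInd n t x * firstInd n t y) +
        r0 n R * (((n : ℝ) - t - 1) * (t ^ 2 - t) + (t - 1) * ((n - t) ^ 2 - (n - t))) / (n - 2) := by
  have h4 : (4 : ℝ) ≤ n := by exact_mod_cast hn
  have h2 : (n : ℝ) - 2 ≠ 0 := by linarith
  rw [Uw, U1_eq_add π ht, U2_eq_add hs hn π ht]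
  field_simp
  push_cast
  ring

lemma Udiff_eq_add (hs : ∀ i j, R i j = R j i) (hn : 4 ≤ n) (π : Equiv.Perm (Fin n)) {t : ℕ}
    (ht : t ≤ n) :
    Udiff n R π 0 t =
      2 * ((n : ℝ) - 2) * ∑ x, linCoeff n R (π x) * firstInd n t x +
        r0 n R * ((t ^ 2 - t) - ((n - t) ^ 2 - (n - t))) := by
  rw [Udiff, U1_eq_add π ht, U2_eq_add hs hn π ht]
  ring

lemma pexp_affine (c d : ℝ) (f : Equiv.Perm (Fin n) → ℝ) :
    pexp n (fun π => c * f π + d) = c * pexp n f + d := by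
  rw [pexp_add, pexp_mul_left, pexp_const]

lemma pvar_affine (c d : ℝ) (f : Equiv.Perm (Fin n) → ℝ) :
    pvar n (fun π => c * f π + d) = c ^ 2 * pvar n f := by
  unfold pvar
  rw [pexp_affine c d f, ← pexp_mul_left (c ^ 2) (fun π => (f π - pexp n f) ^ 2)]
  exact congrArg (pexp n) (funext fun π => by ring)

lemma permStd_affine {c : ℝ} (hc : 0 < c) (d : ℝ) (f : Equiv.Perm (Fin n) → ℝ) :
    permStd (fun π => c * f π + d) = permStd f := by
  funext π
  unfold permStd
  rw [pvar_affine, pexp_affine, Real.sqrt_mul (sq_nonneg c), Real.sqrt_sq hc.le,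
    ← mul_div_mul_left _ (Real.sqrt (pvar n f)) hc.ne']
  congr 1
  ring

/-- The normalized degenerate part of `R`. -/
noncomputable def degUnit (n : ℕ) (R : Fin n → Fin n → ℝ) (i j : Fin n) : ℝ :=
  (Real.sqrt (∑ i, ∑ j, degKernel n R i j ^ 2))⁻¹ * degKernel n R i j

/-- The normalized linear part of `R`. -/
noncomputable def linUnit (n : ℕ) (R : Fin n → Fin n → ℝ) (i : Fin n) : ℝ :=
  (Real.sqrt (∑ i, linCoeff n R i ^ 2))⁻¹ * linCoeff n R i

variable {m : ℕ} {u : Fin m → ℝ}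

lemma floor_mul_le {v : ℝ} (hv : v ≤ 1) : ⌊(n : ℝ) * v⌋₊ ≤ n :=
  Nat.floor_le_of_le (mul_le_of_le_one_right n.cast_nonneg hv)

lemma Uw_standardized (hs : ∀ i j, R i j = R j i) (hn : 4 ≤ n) (hu1 : ∀ i, u i < 1) (i : Fin m)
    (hvar : 0 < pvar n (fun π => Uw n R π 0 ⌊(n : ℝ) * u i⌋₊)) (β : Fin n → ℝ) :
    0 < ∑ i, ∑ j, degKernel n R i j ^ 2 ∧ 0 < pvar n (permStat u (degUnit n R) β (Sum.inl i)) ∧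
      ∀ π, permStd (permStat u (degUnit n R) β (Sum.inl i)) π = Zw n R π 0 ⌊(n : ℝ) * u i⌋₊ := by
  set d := r0 n R * (((n : ℝ) - ⌊(n : ℝ) * u i⌋₊ - 1) * (⌊(n : ℝ) * u i⌋₊ ^ 2 - ⌊(n : ℝ) * u i⌋₊) +
    (⌊(n : ℝ) * u i⌋₊ - 1) * ((n - ⌊(n : ℝ) * u i⌋₊) ^ 2 - (n - ⌊(n : ℝ) * u i⌋₊))) / (n - 2)
    with hd
  have hU : (fun π => Uw n R π 0 ⌊(n : ℝ) * u i⌋₊) = fun π =>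
      1 * permStat u (degKernel n R) β (Sum.inl i) π + d := by
    funext π
    rw [Uw_eq_add hs hn π (floor_mul_le (hu1 i).le), one_mul]
    rfl
  have hpos : 0 < ∑ i, ∑ j, degKernel n R i j ^ 2 := by
    refine lt_of_le_of_ne (Finset.sum_nonneg fun _ _ => Finset.sum_nonneg fun _ _ => sq_nonneg _)
      fun h0 => ?_
    have hz : ∀ i j, degKernel n R i j = 0 := by
      intro i j
      have h1 := (Finset.sum_eq_zero_iff_of_nonneg fun _ _ =>
        Finset.sum_nonneg fun _ _ => sq_nonneg _).1 h0.symm i (Finset.mem_univ i)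
      exact pow_eq_zero_iff (two_ne_zero) |>.1
        ((Finset.sum_eq_zero_iff_of_nonneg fun _ _ => sq_nonneg _).1 h1 j (Finset.mem_univ j))
    have hc : permStat u (degKernel n R) β (Sum.inl i) = fun _ => (0 : ℝ) := by
      funext π; simp [permStat, hz]
    rw [hU, pvar_affine, hc] at hvar
    simp [pvar, pexp] at hvar
  set e := Real.sqrt (∑ i, ∑ j, degKernel n R i j ^ 2) with he
  have he0 : 0 < e := Real.sqrt_pos.2 hpos
  have hS : permStat u (degKernel n R) β (Sum.inl i) = fun π =>
      e * permStat u (degUnit n R) β (Sum.inl i) π := by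
    funext π
    simp only [permStat, Sum.elim_inl, degUnit, ← he, Finset.mul_sum]
    refine Finset.sum_congr rfl fun x _ => Finset.sum_congr rfl fun y _ => ?_
    field_simp
  have hU' : (fun π => Uw n R π 0 ⌊(n : ℝ) * u i⌋₊) = fun π =>
      e * permStat u (degUnit n R) β (Sum.inl i) π + d := by
    rw [hU, hS]; simp only [one_mul]
  refine ⟨hpos, ?_, fun π => ?_⟩
  · rw [hU', pvar_affine] at hvar
    exact pos_of_mul_pos_right hvar (sq_nonneg e)
  · rw [← permStd_affine he0 d, ← hU']
    rfl

lemma Udiff_standardized (hs : ∀ i j, R i j = R j i) (hn : 4 ≤ n) (hu1 : ∀ i, u i < 1) (i : Fin m)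
    (hvar : 0 < pvar n (fun π => Udiff n R π 0 ⌊(n : ℝ) * u i⌋₊)) (E : Fin n → Fin n → ℝ) :
    0 < ∑ i, linCoeff n R i ^ 2 ∧ 0 < pvar n (permStat u E (linUnit n R) (Sum.inr i)) ∧
      ∀ π, permStd (permStat u E (linUnit n R) (Sum.inr i)) π =
        Zdiff n R π 0 ⌊(n : ℝ) * u i⌋₊ := by
  have h4 : (4 : ℝ) ≤ n := by exact_mod_cast hn
  set d := r0 n R * (((⌊(n : ℝ) * u i⌋₊ : ℝ) ^ 2 - ⌊(n : ℝ) * u i⌋₊) -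
    ((n - ⌊(n : ℝ) * u i⌋₊) ^ 2 - (n - ⌊(n : ℝ) * u i⌋₊)))
    with hd
  have hU : (fun π => Udiff n R π 0 ⌊(n : ℝ) * u i⌋₊) = fun π =>
      (2 * ((n : ℝ) - 2)) * permStat u E (linCoeff n R) (Sum.inr i) π + d := by
    funext π
    rw [Udiff_eq_add hs hn π (floor_mul_le (hu1 i).le)]
    rfl
  have hpos : 0 < ∑ i, linCoeff n R i ^ 2 := by
    refine lt_of_le_of_ne (Finset.sum_nonneg fun _ _ => sq_nonneg _) fun h0 => ?_
    have hz : ∀ i, linCoeff n R i = 0 := fun i => pow_eq_zero_iff (two_ne_zero) |>.1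
      ((Finset.sum_eq_zero_iff_of_nonneg fun _ _ => sq_nonneg _).1 h0.symm i (Finset.mem_univ i))
    have hc : permStat u E (linCoeff n R) (Sum.inr i) = fun _ => (0 : ℝ) := by
      funext π; simp [permStat, hz]
    rw [hU, pvar_affine, hc] at hvar
    simp [pvar, pexp] at hvar
  set e := Real.sqrt (∑ i, linCoeff n R i ^ 2) with he
  have he0 : 0 < e := Real.sqrt_pos.2 hpos
  have hS : permStat u E (linCoeff n R) (Sum.inr i) = fun π =>
      e * permStat u E (linUnit n R) (Sum.inr i) π := by
    funext π
    simp only [permStat, Sum.elim_inr, linUnit, ← he, Finset.mul_sum]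
    refine Finset.sum_congr rfl fun x _ => ?_
    field_simp
  have hU' : (fun π => Udiff n R π 0 ⌊(n : ℝ) * u i⌋₊) = fun π =>
      (2 * ((n : ℝ) - 2) * e) * permStat u E (linUnit n R) (Sum.inr i) π + d := by
    rw [hU, hS]; simp only [mul_assoc]
  refine ⟨hpos, ?_, fun π => ?_⟩
  · rw [hU', pvar_affine] at hvar
    exact pos_of_mul_pos_right hvar (sq_nonneg _)
  · rw [← permStd_affine (c := 2 * ((n : ℝ) - 2) * e) (by
      have : 0 < (n : ℝ) - 2 := by linarith
      positivity) d, ← hU']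
    rfl

end Decomposition

section Conditions

variable {n : ℕ}

lemma sum_sum_mul_mul_mul_le {R : Fin n → Fin n → ℝ} (hs : ∀ i j, R i j = R j i)
    (h0 : ∀ i, R i i = 0) :
    2 * ∑ i, ∑ j, (∑ l, R l i * R l j) ^ 2 ≤
      (∑ i, ∑ j, ∑ k, ∑ l, if k ≠ i ∧ k ≠ j ∧ l ≠ i ∧ l ≠ j then
          R i j * R k l * (R i k * R j l + R i l * R j k) else 0) +
        4 * ∑ i, (∑ j, R i j ^ 2) ^ 2 := by
  have hfull : ∑ i, ∑ j, ∑ k, ∑ l, R i j * R k l * (R i k * R j l + R i l * R j k) =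
      2 * ∑ i, ∑ j, (∑ l, R l i * R l j) ^ 2 := by
    simp only [mul_add, Finset.sum_add_distrib, two_mul]
    congr 1
    · rw [Finset.sum_comm]
      refine Finset.sum_congr rfl fun j _ => ?_
      rw [Finset.sum_comm]
      refine Finset.sum_congr rfl fun k _ => ?_
      rw [sq, Finset.sum_mul_sum]
      refine Finset.sum_congr rfl fun i _ => Finset.sum_congr rfl fun l _ => ?_
      rw [hs l j, hs l k]; ring
    · refine Finset.sum_congr rfl fun i _ => ?_
      rw [Finset.sum_comm]
      refine Finset.sum_congr rfl fun k _ => ?_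
      rw [sq, Finset.sum_mul_sum]
      refine Finset.sum_congr rfl fun j _ => Finset.sum_congr rfl fun l _ => ?_
      rw [hs j i, hs l i, hs l k]; ring
  have hpt : ∀ i j k l, R i j * R k l * (R i k * R j l + R i l * R j k) ≤
      (if k ≠ i ∧ k ≠ j ∧ l ≠ i ∧ l ≠ j then
          R i j * R k l * (R i k * R j l + R i l * R j k) else 0) +
        ((if k = i then R i j ^ 2 * R i l ^ 2 else 0) +
          (if l = i then R i j ^ 2 * R i k ^ 2 else 0) +
          (if k = j then R i j ^ 2 * R j l ^ 2 else 0) +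
          (if l = j then R i j ^ 2 * R j k ^ 2 else 0)) := by
    intro i j k l
    have p1 : 0 ≤ (if k = i then R i j ^ 2 * R i l ^ 2 else 0) := by split_ifs <;> positivity
    have p2 : 0 ≤ (if l = i then R i j ^ 2 * R i k ^ 2 else 0) := by split_ifs <;> positivity
    have p3 : 0 ≤ (if k = j then R i j ^ 2 * R j l ^ 2 else 0) := by split_ifs <;> positivity
    have p4 : 0 ≤ (if l = j then R i j ^ 2 * R j k ^ 2 else 0) := by split_ifs <;> positivity
    by_cases hc : k ≠ i ∧ k ≠ j ∧ l ≠ i ∧ l ≠ j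
    · rw [if_pos hc]; linarith
    rw [if_neg hc]
    by_cases h1 : k = i
    · have e : R i j * R k l * (R i k * R j l + R i l * R j k) = R i j ^ 2 * R i l ^ 2 := by
        rw [h1, h0, hs j i]; ring
      rw [if_pos h1] at p1 ⊢; linarith
    by_cases h2 : l = i
    · have e : R i j * R k l * (R i k * R j l + R i l * R j k) = R i j ^ 2 * R i k ^ 2 := by
        rw [h2, h0, hs j i, hs k i]; ring
      rw [if_pos h2] at p2 ⊢; linarith
    by_cases h3 : k = j
    · have e : R i j * R k l * (R i k * R j l + R i l * R j k) = R i j ^ 2 * R j l ^ 2 := by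
        rw [h3, h0]; ring
      rw [if_pos h3] at p3 ⊢; linarith
    have h4 : l = j := by tauto
    have e : R i j * R k l * (R i k * R j l + R i l * R j k) = R i j ^ 2 * R j k ^ 2 := by
      rw [h4, h0, hs k j]; ring
    rw [if_pos h4] at p4 ⊢; linarith
  rw [← hfull]
  refine (Finset.sum_le_sum fun i _ => Finset.sum_le_sum fun j _ => Finset.sum_le_sum fun k _ =>
    Finset.sum_le_sum fun l _ => hpt i j k l).trans (le_of_eq ?_)
  have hT : ∀ i, ∑ j, ∑ l, R i j ^ 2 * R i l ^ 2 = (∑ j, R i j ^ 2) ^ 2 := fun i => by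
    rw [sq (∑ j, R i j ^ 2), Finset.sum_mul_sum]
  have hT' : ∑ i, ∑ j, ∑ l, R i j ^ 2 * R j l ^ 2 = ∑ i, (∑ j, R i j ^ 2) ^ 2 := by
    rw [Finset.sum_comm]
    refine Finset.sum_congr rfl fun j _ => ?_
    rw [← hT j]
    exact Finset.sum_congr rfl fun i _ => Finset.sum_congr rfl fun l _ => by rw [hs i j]
  have e1 : ∀ i j : Fin n, ∑ k, ∑ l, (if k = i then R i j ^ 2 * R i l ^ 2 else 0) =
      ∑ l, R i j ^ 2 * R i l ^ 2 := fun i j => by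
    rw [Finset.sum_comm]; simp
  have e3 : ∀ i j : Fin n, ∑ k, ∑ l, (if k = j then R i j ^ 2 * R j l ^ 2 else 0) =
      ∑ l, R i j ^ 2 * R j l ^ 2 := fun i j => by
    rw [Finset.sum_comm]; simp
  simp only [Finset.sum_add_distrib, e1, e3, Finset.sum_ite_eq', Finset.mem_univ, if_true, hT, hT']
  ring

lemma sum_sum_mul_sq_le (A B : Fin n → Fin n → ℝ) :
    ∑ i, ∑ j, (∑ l, A l i * B l j) ^ 2 ≤ (∑ i, ∑ j, A i j ^ 2) * ∑ i, ∑ j, B i j ^ 2 := by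
  rw [Finset.sum_comm (f := fun i j => A i j ^ 2), Finset.sum_comm (f := fun i j => B i j ^ 2),
    Finset.sum_mul_sum]
  exact Finset.sum_le_sum fun i _ => Finset.sum_le_sum fun j _ =>
    Finset.sum_mul_sq_le_sq_mul_sq _ _ _

/-- A Frobenius-norm perturbation bound for the square of a matrix, relative to its norm. -/
lemma sum_sum_mul_sq_le_of_perturbation {R D : Fin n → Fin n → ℝ} {δ F : ℝ} (hδ0 : 0 ≤ δ)
    (hδ : δ ≤ 1 / 4) (hF : ∑ i, ∑ j, R i j ^ 2 = F)
    (hE : ∑ i, ∑ j, (D i j - R i j) ^ 2 ≤ δ * F)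
    (hR : ∑ i, ∑ j, (∑ l, R l i * R l j) ^ 2 ≤ δ * F ^ 2) :
    ∑ i, ∑ j, (∑ l, D l i * D l j) ^ 2 ≤ 256 * δ * (∑ i, ∑ j, D i j ^ 2) ^ 2 := by
  set E : Fin n → Fin n → ℝ := fun i j => D i j - R i j with hEdef
  set e := ∑ i, ∑ j, E i j ^ 2 with he
  have hE' : e ≤ δ * F := hE
  have hF0 : 0 ≤ F := hF ▸ Finset.sum_nonneg fun _ _ => Finset.sum_nonneg fun _ _ => sq_nonneg _
  have he0 : 0 ≤ e := Finset.sum_nonneg fun _ _ => Finset.sum_nonneg fun _ _ => sq_nonneg _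
  have hFD : F ≤ 2 * ∑ i, ∑ j, D i j ^ 2 + 2 * e := by
    rw [← hF, he]
    simp only [Finset.mul_sum, ← Finset.sum_add_distrib]
    refine Finset.sum_le_sum fun i _ => Finset.sum_le_sum fun j _ => ?_
    simp only [E]
    nlinarith [sq_nonneg (D i j + (D i j - R i j))]
  have hD4 : F ≤ 4 * ∑ i, ∑ j, D i j ^ 2 := by nlinarith
  have h1 : ∑ i, ∑ j, (∑ l, D l i * D l j) ^ 2 ≤
      4 * (∑ i, ∑ j, (∑ l, R l i * R l j) ^ 2) + 4 * (∑ i, ∑ j, (∑ l, R l i * E l j) ^ 2) +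
        4 * (∑ i, ∑ j, (∑ l, E l i * R l j) ^ 2) + 4 * ∑ i, ∑ j, (∑ l, E l i * E l j) ^ 2 := by
    simp only [Finset.mul_sum, ← Finset.sum_add_distrib]
    refine Finset.sum_le_sum fun i _ => Finset.sum_le_sum fun j _ => ?_
    have hs : ∑ l, D l i * D l j = ∑ l, R l i * R l j + ∑ l, R l i * E l j +
        ∑ l, E l i * R l j + ∑ l, E l i * E l j := by
      simp only [← Finset.sum_add_distrib]
      refine Finset.sum_congr rfl fun l _ => ?_
      simp only [E]; ring
    rw [hs]
    generalize ∑ l, R l i * R l j = a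
    generalize ∑ l, R l i * E l j = b
    generalize ∑ l, E l i * R l j = c
    generalize ∑ l, E l i * E l j = d
    nlinarith [sq_nonneg (a - b), sq_nonneg (a - c), sq_nonneg (a - d), sq_nonneg (b - c),
      sq_nonneg (b - d), sq_nonneg (c - d)]
  have h2 := sum_sum_mul_sq_le R E
  have h3 := sum_sum_mul_sq_le E R
  have h4 := sum_sum_mul_sq_le E E
  rw [hF] at h2 h3
  rw [← he] at h2 h3 h4
  have h5 : F * e ≤ δ * F ^ 2 := by nlinarith
  have h6 : e * e ≤ δ * F ^ 2 := by
    have : e * e ≤ (δ * F) * (δ * F) := mul_self_le_mul_self he0 hE'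
    have h7 : 0 ≤ δ * F ^ 2 := by positivity
    nlinarith
  have h8 : F ^ 2 ≤ 16 * (∑ i, ∑ j, D i j ^ 2) ^ 2 := by
    have := mul_self_le_mul_self hF0 hD4
    nlinarith
  calc _ ≤ 16 * (δ * F ^ 2) := by linarith [mul_comm e F]
    _ ≤ 16 * (δ * (16 * (∑ i, ∑ j, D i j ^ 2) ^ 2)) := by gcongr
    _ = _ := by ring

variable {R : Fin n → Fin n → ℝ}

lemma sum_Rbar_sub_sq (hn : 0 < n) :
    ∑ i, (Rbar n R i - r0 n R) ^ 2 = n * (r1sq n R - r0 n R ^ 2) := by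
  have h : (n : ℝ) ≠ 0 := by exact_mod_cast hn.ne'
  have h0 : ∑ i, Rbar n R i = n * r0 n R := by rw [r0, mul_div_cancel₀ _ h]
  have h1 : ∑ i, Rbar n R i ^ 2 = n * r1sq n R := by rw [r1sq, mul_div_cancel₀ _ h]
  have e : ∀ i, (Rbar n R i - r0 n R) ^ 2 =
      Rbar n R i ^ 2 - 2 * r0 n R * Rbar n R i + r0 n R ^ 2 := fun i => by ring
  simp only [e, Finset.sum_add_distrib, Finset.sum_sub_distrib, ← Finset.mul_sum, h0, h1,
    Finset.sum_const, Finset.card_univ, Fintype.card_fin, nsmul_eq_mul]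
  ring

lemma sum_degKernel_sub_sq_le (hn : 4 ≤ n) :
    ∑ i, ∑ j, (degKernel n R i j - R i j) ^ 2 ≤ 14 * (n : ℝ) ^ 2 * r1sq n R := by
  have h4 : (4 : ℝ) ≤ n := by exact_mod_cast hn
  have hα : ∑ i, linCoeff n R i ^ 2 ≤ 9 / 4 * (n * (r1sq n R - r0 n R ^ 2)) := by
    rw [← sum_Rbar_sub_sq (by omega : 0 < n), Finset.mul_sum]
    refine Finset.sum_le_sum fun i _ => ?_
    rw [linCoeff, mul_pow]
    refine mul_le_mul_of_nonneg_right ?_ (sq_nonneg _)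
    have h1 : ((n : ℝ) - 1) / (n - 2) ≤ 3 / 2 := by
      rw [div_le_iff₀ (by linarith)]; linarith
    have h2 : 0 ≤ ((n : ℝ) - 1) / (n - 2) := div_nonneg (by linarith) (by linarith)
    nlinarith
  have hpt : ∀ i j, (degKernel n R i j - R i j) ^ 2 ≤
      3 * (r0 n R ^ 2 + linCoeff n R i ^ 2 + linCoeff n R j ^ 2) := by
    intro i j
    rw [degKernel]
    split_ifs with h
    · have e : R i j - (r0 n R + linCoeff n R i + linCoeff n R j) +
        (r0 n R + linCoeff n R i + linCoeff n R j) - R i j = 0 := by ring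
      rw [e, sq, mul_zero]; positivity
    · nlinarith [sq_nonneg (r0 n R - linCoeff n R i), sq_nonneg (r0 n R - linCoeff n R j),
        sq_nonneg (linCoeff n R i - linCoeff n R j)]
  calc _ ≤ ∑ i, ∑ j, 3 * (r0 n R ^ 2 + linCoeff n R i ^ 2 + linCoeff n R j ^ 2) :=
        Finset.sum_le_sum fun i _ => Finset.sum_le_sum fun j _ => hpt i j
    _ = 3 * (n ^ 2 * r0 n R ^ 2 + 2 * n * ∑ i, linCoeff n R i ^ 2) := by
        simp only [← Finset.mul_sum, Finset.sum_add_distrib, Finset.sum_const, Finset.card_univ,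
          Fintype.card_fin, nsmul_eq_mul]
        ring
    _ ≤ 3 * (n ^ 2 * r0 n R ^ 2 + 2 * n * (9 / 4 * (n * (r1sq n R - r0 n R ^ 2)))) := by gcongr
    _ ≤ _ := by
        have hr1 : 0 ≤ r1sq n R - r0 n R ^ 2 := by
          refine nonneg_of_mul_nonneg_right (a := (n : ℝ)) ?_ (by linarith)
          rw [← sum_Rbar_sub_sq (by omega : 0 < n)]
          exact Finset.sum_nonneg fun _ _ => sq_nonneg _
        have : 0 ≤ (n : ℝ) ^ 2 * (r1sq n R - r0 n R ^ 2) := by positivity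
        have : 0 ≤ (n : ℝ) ^ 2 * r0 n R ^ 2 := by positivity
        nlinarith

lemma rdsq_nonneg (hn : 4 ≤ n) : 0 ≤ rdsq n R := by
  have h4 : (4 : ℝ) ≤ n := by exact_mod_cast hn
  exact div_nonneg (Finset.sum_nonneg fun _ _ => Finset.sum_nonneg fun _ _ => sq_nonneg _)
    (mul_nonneg (by linarith) (by linarith))

lemma sq_mul_rdsq_le (hn : 4 ≤ n) : (n : ℝ) ^ 2 * rdsq n R ≤ 2 * ∑ i, ∑ j, R i j ^ 2 := by
  have h4 : (4 : ℝ) ≤ n := by exact_mod_cast hn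
  have h : (n : ℝ) * (n - 1) * rdsq n R = ∑ i, ∑ j, R i j ^ 2 := by
    rw [rdsq, mul_div_cancel₀]
    exact (mul_pos (by linarith) (by linarith)).ne'
  have := rdsq_nonneg (R := R) hn
  rw [← h]
  have : (n : ℝ) ^ 2 ≤ 2 * (n * (n - 1)) := by nlinarith
  nlinarith

end Conditions

section Asymptotics

variable {R : (n : ℕ) → Fin n → Fin n → ℝ}

lemma eventually_sum_degKernel_mul_sq_le (hs : ∀ n (i j : Fin n), R n i j = R n j i)
    (h0 : ∀ n (i : Fin n), R n i i = 0) (hC1 : Cond1 R) (hC5 : Cond5 R) (hC6 : Cond6 R)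
    {ε : ℝ} (hε : 0 < ε) :
    ∀ᶠ n in atTop, ∑ i, ∑ j, (∑ l, degKernel n (R n) l i * degKernel n (R n) l j) ^ 2 ≤
      ε * (∑ i, ∑ j, degKernel n (R n) i j ^ 2) ^ 2 := by
  set δ := min (ε / 256) (1 / 4) with hδdef
  have hδ : 0 < δ := lt_min (by positivity) (by norm_num)
  obtain ⟨c, hc0, hc⟩ := hC1.exists_pos
  have hc := hc.bound
  have h5 := hC5.bound (show 0 < δ / 8 by positivity)
  have h6 := hC6.bound (show 0 < Real.sqrt (δ / 28) from Real.sqrt_pos.2 (by positivity))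
  have hN : ∀ᶠ n : ℕ in atTop, 32 * c / δ ≤ n :=
    tendsto_natCast_atTop_atTop.eventually_ge_atTop _
  filter_upwards [hc, h5, h6, hN, eventually_ge_atTop 4] with n hc h5 h6 hN hn
  have h4 : (4 : ℝ) ≤ n := by exact_mod_cast hn
  set F := ∑ i, ∑ j, R n i j ^ 2 with hF
  have hrd := rdsq_nonneg (R := R n) hn
  have hF2 : (n : ℝ) ^ 2 * rdsq n (R n) ≤ 2 * F := sq_mul_rdsq_le hn
  have hF4 : (n : ℝ) ^ 4 * rdsq n (R n) ^ 2 ≤ 4 * F ^ 2 := by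
    have := mul_self_le_mul_self (by positivity) hF2
    nlinarith
  have hR := sum_sum_mul_mul_mul_le (hs n) (h0 n)
  rw [Real.norm_eq_abs, Real.norm_eq_abs,
    abs_of_nonneg (by positivity : (0 : ℝ) ≤ (n : ℝ) ^ 4 * rdsq n (R n) ^ 2)] at h5
  rw [Real.norm_eq_abs, Real.norm_eq_abs,
    abs_of_nonneg (by positivity : (0 : ℝ) ≤ (n : ℝ) ^ 3 * rdsq n (R n) ^ 2)] at hc
  rw [Real.norm_of_nonneg (Real.sqrt_nonneg _), Real.norm_of_nonneg (Real.sqrt_nonneg _),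
    ← Real.sqrt_mul (by positivity)] at h6
  have h6' : r1sq n (R n) ≤ δ / 28 * rdsq n (R n) :=
    (Real.sqrt_le_sqrt_iff (by positivity)).1 h6
  have hc' : 4 * ∑ i, (∑ j, R n i j ^ 2) ^ 2 ≤ δ / 2 * F ^ 2 := by
    have h1 : c ≤ δ / 32 * n := by
      rw [div_le_iff₀ hδ] at hN; linarith
    have h2 : c * ((n : ℝ) ^ 3 * rdsq n (R n) ^ 2) ≤
        δ / 32 * n * ((n : ℝ) ^ 3 * rdsq n (R n) ^ 2) :=
      mul_le_mul_of_nonneg_right h1 (by positivity)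
    have h3 : δ / 32 * n * ((n : ℝ) ^ 3 * rdsq n (R n) ^ 2) ≤ δ / 32 * (4 * F ^ 2) := by
      calc _ = δ / 32 * ((n : ℝ) ^ 4 * rdsq n (R n) ^ 2) := by ring
        _ ≤ _ := by gcongr
    linarith [le_abs_self (∑ i, (∑ j, R n i j ^ 2) ^ 2)]
  have h5' := (le_abs_self _).trans (h5.trans (mul_le_mul_of_nonneg_left hF4 (by positivity)))
  have hfro : ∑ i, ∑ j, (degKernel n (R n) i j - R n i j) ^ 2 ≤ δ * F := by
    have h1 : (n : ℝ) ^ 2 * r1sq n (R n) ≤ δ / 28 * (2 * F) := by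
      calc _ ≤ (n : ℝ) ^ 2 * (δ / 28 * rdsq n (R n)) := by gcongr
        _ = δ / 28 * ((n : ℝ) ^ 2 * rdsq n (R n)) := by ring
        _ ≤ _ := by gcongr
    linarith [sum_degKernel_sub_sq_le (R := R n) hn]
  refine (sum_sum_mul_sq_le_of_perturbation hδ.le (min_le_right _ _) hF.symm hfro ?_).trans ?_
  · have := hR.trans (add_le_add h5' hc')
    linarith [show 0 ≤ δ * F ^ 2 by positivity]
  · refine mul_le_mul_of_nonneg_right ?_ (sq_nonneg _)
    linarith [min_le_left (ε / 256) (1 / 4 : ℝ)]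

lemma eventually_sum_abs_Rbar_sub_pow_le (hC2 : Cond2 R) {ε : ℝ} (hε : 0 < ε) :
    ∀ᶠ n in atTop, ∑ i, |Rbar n (R n) i - r0 n (R n)| ^ 3 ≤
      ε * Real.sqrt (∑ i, (Rbar n (R n) i - r0 n (R n)) ^ 2) ^ 3 := by
  filter_upwards [hC2.bound hε, eventually_ge_atTop 4] with n h hn
  rw [← sum_Rbar_sub_sq (by omega)] at h
  have h0 : 0 ≤ ∑ i, (Rbar n (R n) i - r0 n (R n)) ^ 2 := Finset.sum_nonneg fun _ _ => sq_nonneg _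
  rw [Real.norm_of_nonneg (Real.rpow_nonneg h0 _), Real.norm_eq_abs] at h
  have e : (∑ i, (Rbar n (R n) i - r0 n (R n)) ^ 2) ^ ((3 : ℝ) / 2) =
      Real.sqrt (∑ i, (Rbar n (R n) i - r0 n (R n)) ^ 2) ^ 3 := by
    rw [Real.sqrt_eq_rpow, ← Real.rpow_natCast, ← Real.rpow_mul h0]
    norm_num
  rw [e] at h
  exact (le_abs_self _).trans h

lemma eventually_degUnit_le (hs : ∀ n (i j : Fin n), R n i j = R n j i)
    (h0 : ∀ n (i : Fin n), R n i i = 0) (hC1 : Cond1 R) (hC5 : Cond5 R) (hC6 : Cond6 R)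
    {ε : ℝ} (hε : 0 < ε) :
    ∀ᶠ n in atTop, 0 < ∑ i, ∑ j, degKernel n (R n) i j ^ 2 →
      ∑ i, ∑ j, (∑ l, degUnit n (R n) l i * degUnit n (R n) l j) ^ 2 ≤ ε := by
  filter_upwards [eventually_sum_degKernel_mul_sq_le hs h0 hC1 hC5 hC6 hε] with n h hpos
  set S := ∑ i, ∑ j, degKernel n (R n) i j ^ 2 with hS
  have hr : Real.sqrt S ^ 4 = S ^ 2 := by
    rw [show (4 : ℕ) = 2 * 2 by rfl, pow_mul, Real.sq_sqrt hpos.le]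
  have e : ∀ i j, (∑ l, degUnit n (R n) l i * degUnit n (R n) l j) ^ 2 =
      (S ^ 2)⁻¹ * (∑ l, degKernel n (R n) l i * degKernel n (R n) l j) ^ 2 := by
    intro i j
    have : ∑ l, degUnit n (R n) l i * degUnit n (R n) l j =
        (Real.sqrt S)⁻¹ ^ 2 * ∑ l, degKernel n (R n) l i * degKernel n (R n) l j := by
      rw [Finset.mul_sum]
      refine Finset.sum_congr rfl fun l _ => ?_
      simp only [degUnit, ← hS]; ring
    rw [this, mul_pow, ← hr, inv_pow, inv_pow, ← pow_mul]
  simp only [e, ← Finset.mul_sum]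
  rw [inv_mul_le_iff₀ (by positivity)]
  linarith

lemma eventually_linUnit_le (hC2 : Cond2 R) {ε : ℝ} (hε : 0 < ε) :
    ∀ᶠ n in atTop, 0 < ∑ i, linCoeff n (R n) i ^ 2 → ∑ i, |linUnit n (R n) i| ^ 3 ≤ ε := by
  filter_upwards [eventually_sum_abs_Rbar_sub_pow_le hC2 hε, eventually_ge_atTop 4] with n h hn hpos
  have h4 : (4 : ℝ) ≤ n := by exact_mod_cast hn
  set k := ((n : ℝ) - 1) / (n - 2) with hk
  have hk0 : 0 < k := div_pos (by linarith) (by linarith)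
  set T := ∑ i, (Rbar n (R n) i - r0 n (R n)) ^ 2 with hT
  have hS : ∑ i, linCoeff n (R n) i ^ 2 = k ^ 2 * T := by
    rw [hT, Finset.mul_sum]
    exact Finset.sum_congr rfl fun i _ => by rw [linCoeff, mul_pow]
  have hT0 : 0 < T := by
    rw [hS] at hpos
    exact pos_of_mul_pos_right hpos (sq_nonneg k)
  have hsT : 0 < Real.sqrt T := Real.sqrt_pos.2 hT0
  have e : ∀ i, |linUnit n (R n) i| ^ 3 =
      (Real.sqrt T ^ 3)⁻¹ * |Rbar n (R n) i - r0 n (R n)| ^ 3 := by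
    intro i
    have : linUnit n (R n) i = (Real.sqrt T)⁻¹ * (Rbar n (R n) i - r0 n (R n)) := by
      rw [linUnit, hS, Real.sqrt_mul (sq_nonneg k), Real.sqrt_sq hk0.le, linCoeff, ← hk]
      field_simp
    rw [this, abs_mul, mul_pow, abs_of_pos (inv_pos.2 hsT), inv_pow]
  simp only [e, ← Finset.mul_sum]
  rw [inv_mul_le_iff₀ (by positivity)]
  linarith

end Asymptotics

section Normalization

variable {n : ℕ} {R : Fin n → Fin n → ℝ}

lemma sum_degUnit_sq (h : 0 < ∑ i, ∑ j, degKernel n R i j ^ 2) :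
    ∑ i, ∑ j, degUnit n R i j ^ 2 = 1 := by
  simp only [degUnit, mul_pow, ← Finset.mul_sum, inv_pow]
  rw [Real.sq_sqrt h.le, inv_mul_cancel₀ h.ne']

lemma sum_linUnit_sq (h : 0 < ∑ i, linCoeff n R i ^ 2) : ∑ i, linUnit n R i ^ 2 = 1 := by
  simp only [linUnit, mul_pow, ← Finset.mul_sum, inv_pow]
  rw [Real.sq_sqrt h.le, inv_mul_cancel₀ h.ne']

end Normalization

section ConvergenceInDistribution

variable {n : ℕ}

lemma charFun_permDist (f : Equiv.Perm (Fin n) → ℝ) (t : ℝ) :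
    charFun (permDist n f : Measure ℝ) t =
      (n.factorial : ℝ)⁻¹ • ∑ π : Equiv.Perm (Fin n), expChar t (f π) := by
  have hm : (permDist n f : Measure ℝ) =
      Measure.map f (PMF.uniformOfFintype (Equiv.Perm (Fin n))).toMeasure := rfl
  have hf : Measurable f := fun _ _ => trivial
  rw [hm, charFun_apply_real, integral_map hf.aemeasurable (by fun_prop), PMF.integral_eq_sum,
    Finset.smul_sum]
  refine Finset.sum_congr rfl fun π _ => ?_
  simp [PMF.uniformOfFintype_apply, Fintype.card_perm, expChar, mul_comm]

lemma charFun_gaussLimit {v : ℝ} (hv : 0 ≤ v) (t : ℝ) :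
    charFun (gaussLimit v : Measure ℝ) t = Complex.exp ((-(v * t ^ 2 / 2) : ℝ) : ℂ) := by
  have hm : (gaussLimit v : Measure ℝ) = gaussianReal 0 (Real.toNNReal v) := rfl
  rw [hm, charFun_gaussianReal]
  congr 1
  rw [show ((v.toNNReal : NNReal) : ℂ) = ((v.toNNReal : ℝ) : ℂ) from rfl, Real.coe_toNNReal v hv]
  push_cast
  ring

end ConvergenceInDistribution

lemma tendsto_couplingError (t C : ℝ) :
    Tendsto (fun n : ℕ => |t| * Real.sqrt (C * (16 * (Real.sqrt n + 1) / (n - 1)))) atTop (𝓝 0) := by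
  have h1 : Tendsto (fun n : ℕ => 16 / (Real.sqrt (n : ℝ) - 1)) atTop (𝓝 0) :=
    (tendsto_atTop_add_const_right _ (-1) (Real.tendsto_sqrt_atTop.comp
      tendsto_natCast_atTop_atTop)).const_div_atTop 16
  have h2 : Tendsto (fun n : ℕ => 16 * (Real.sqrt n + 1) / ((n : ℝ) - 1)) atTop (𝓝 0) := by
    refine h1.congr' ?_
    filter_upwards [eventually_ge_atTop 4] with n hn
    have h4 : (4 : ℝ) ≤ n := by exact_mod_cast hn
    have hs : 1 < Real.sqrt (n : ℝ) := by
      rw [Real.lt_sqrt zero_le_one]; linarith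
    have e : (n : ℝ) - 1 = (Real.sqrt n - 1) * (Real.sqrt n + 1) := by
      linarith [Real.mul_self_sqrt (n.cast_nonneg : (0 : ℝ) ≤ n)]
    rw [e, mul_div_mul_right _ _ (by linarith)]
  have h3 := ((Real.continuous_sqrt.tendsto _).comp (h2.const_mul C)).const_mul |t|
  simpa using h3

lemma limit_variance_nonneg {m : ℕ} {u : Fin m → ℝ} (hmono : StrictMono u) (hu0 : ∀ i, 0 < u i)
    (hu1 : ∀ i, u i < 1) (a : Fin m ⊕ Fin m → ℝ) :
    0 ≤ ∑ i, ∑ j, (a (Sum.inl i) * a (Sum.inl j) * rhoW (u i) (u j)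
      + a (Sum.inr i) * a (Sum.inr j) * rhoDiff (u i) (u j)) := by
  obtain ⟨p, hp0, hp1, hpu⟩ := exists_label_weights hmono hu0 hu1
  rw [← limit_variance_eq hu0 hu1 (label_cov hmono hp1 hpu) a]
  refine add_nonneg (mul_nonneg zero_le_two (Finset.sum_nonneg fun k _ => mul_nonneg (hp0 k)
    (Finset.sum_nonneg fun l _ => mul_nonneg (hp0 l) (sq_nonneg _))))
    (Finset.sum_nonneg fun k _ => mul_nonneg (hp0 k) (sq_nonneg _))

end RING

/-- Under Conditions (C1)–(C6), for every `m ≥ 1` and `0 < u_1 < … < u_m < 1`,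
the joint vector `(Z_w^π(⌊n·u_1⌋), …, Z_w^π(⌊n·u_m⌋), Z_diff^π(⌊n·u_1⌋), …,
Z_diff^π(⌊n·u_m⌋))` converges in distribution under the permutation null to a
centered `2m`-dimensional Gaussian vector with block-diagonal covariance matrix:
`ρ_w*(u_i,u_j)` on the `Z_w`-block, `ρ_diff*(u_i,u_j)` on the `Z_diff`-block,
and zero cross-covariances (so the limiting processes are independent).
Multivariate convergence is expressed through the Cramér–Wold device, the
limiting variance of `Σ_s a_s X_s` being exactly the block-diagonal quadratic
form `Σ_{ij} a_{w,i}a_{w,j}ρ_w*(u_i,u_j) + Σ_{ij} a_{d,i}a_{d,j}ρ_diff*(u_i,u_j)`. -/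
theorem stmt11 (R : (n : ℕ) → Fin n → Fin n → ℝ)
    (hsym : ∀ n (i j : Fin n), R n i j = R n j i) (hdiag : ∀ n (i : Fin n), R n i i = 0)
    (hC1 : Cond1 R) (hC2 : Cond2 R) (hC3 : Cond3 R) (hC4 : Cond4 R)
    (hC5 : Cond5 R) (hC6 : Cond6 R)
    (m : ℕ) (hm : 1 ≤ m) (u : Fin m → ℝ) (hmono : StrictMono u)
    (hu0 : ∀ i, 0 < u i) (hu1 : ∀ i, u i < 1)
    (hvar : ∀ i : Fin m, ∀ᶠ n in atTop,
      0 < pvar n (fun π => Uw n (R n) π 0 ⌊(n : ℝ) * u i⌋₊)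
      ∧ 0 < pvar n (fun π => Udiff n (R n) π 0 ⌊(n : ℝ) * u i⌋₊)) :
    ∀ a : Fin m ⊕ Fin m → ℝ,
      Tendsto
        (fun n =>
          permDist n (fun π =>
            ∑ s : Fin m ⊕ Fin m,
              a s * Sum.elim (fun i => Zw n (R n) π 0 ⌊(n : ℝ) * u i⌋₊)
                (fun i => Zdiff n (R n) π 0 ⌊(n : ℝ) * u i⌋₊) s))
        atTop
        (𝓝 (gaussLimit
          (∑ i : Fin m, ∑ j : Fin m,
            (a (Sum.inl i) * a (Sum.inl j) * rhoW (u i) (u j)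
              + a (Sum.inr i) * a (Sum.inr j) * rhoDiff (u i) (u j))))) := by
  intro a
  rw [ProbabilityMeasure.tendsto_iff_tendsto_charFun]
  intro t
  rw [charFun_gaussLimit (limit_variance_nonneg hmono hu0 hu1 a)]
  simp only [charFun_permDist]
  obtain ⟨C, K, hCK⟩ := exists_norm_permStat_charFun_sub_le hmono hu0 hu1 a
  rw [Metric.tendsto_nhds]
  intro ε hε
  set B : ℝ := |t| * (12 * (14 * K ^ 4) * t ^ 2 + 11 * K ^ 2 * |t|) with hB
  have hB0 : 0 ≤ B := by positivity
  set θ : ℝ := min 1 (ε / (2 * (B + 1))) with hθdef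
  have hθ : 0 < θ := lt_min one_pos (by positivity)
  have hθB : θ * B < ε / 2 := by
    calc θ * B ≤ ε / (2 * (B + 1)) * B := mul_le_mul_of_nonneg_right (min_le_right _ _) hB0
      _ < ε / (2 * (B + 1)) * (B + 1) := mul_lt_mul_of_pos_left (lt_add_one B) (by positivity)
      _ = ε / 2 := by field_simp
  filter_upwards [(tendsto_couplingError t C).eventually_lt_const (half_pos hε),
    eventually_degUnit_le hsym hdiag hC1 hC5 hC6 (pow_pos hθ 4),
    eventually_linUnit_le hC2 hθ, eventually_all.2 hvar, eventually_ge_atTop 4]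
    with n herr hdeg hlin hv hn
  have i₀ : Fin m := ⟨0, hm⟩
  have hW := fun i => Uw_standardized (hsym n) hn hu1 i (hv i).1 (linUnit n (R n))
  have hL := fun i => Udiff_standardized (hsym n) hn hu1 i (hv i).2 (degUnit n (R n))
  have hD0 := (hW i₀).1
  have hα0 := (hL i₀).1
  have key := hCK n (degUnit n (R n)) (linUnit n (R n)) θ t hn
    (fun i j => by simp only [degUnit, degKernel_symm (hsym n) i j])
    (fun i => by simp only [degUnit, degKernel_self (hdiag n) i, mul_zero])
    (fun i => by simp only [degUnit, ← Finset.mul_sum, sum_degKernel hn i, mul_zero])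
    (sum_degUnit_sq hD0)
    (by simp only [linUnit, ← Finset.mul_sum, sum_linCoeff (by omega : 0 < n), mul_zero])
    (sum_linUnit_sq hα0)
    (fun s => by
      rcases s with i | i
      · exact (hW i).2.1
      · exact (hL i).2.1)
    hθ (min_le_left _ _) (hdeg hD0) (hlin hα0)
  have hstat : ∀ (π : Equiv.Perm (Fin n)) (s : Fin m ⊕ Fin m),
      permStd (permStat u (degUnit n (R n)) (linUnit n (R n)) s) π =
        Sum.elim (fun i => Zw n (R n) π 0 ⌊(n : ℝ) * u i⌋₊)
          (fun i => Zdiff n (R n) π 0 ⌊(n : ℝ) * u i⌋₊) s := by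
    rintro π (i | i)
    · exact (hW i).2.2 π
    · exact (hL i).2.2 π
  simp only [hstat] at key
  rw [dist_eq_norm]
  refine key.trans_lt ?_
  have : |t| * (12 * (14 * K ^ 4 * θ) * t ^ 2 + 11 * K ^ 2 * θ * |t|) = θ * B := by
    rw [hB]; ring
  linarith
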